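/- arXiv:2211.05954 — 6 statements merged into one kernel-verified Lean document; each statement's English description precedes it below -/
import Mathlib

section
/- Consider the Gaussian sequence model with noise level σₙ and the SNR-aware parameter space Θ(kₙ, τₙ). Suppose εₙ = kₙ/n → 0 and μₙ = τₙ/σₙ = ω(√(log εₙ⁻¹)) as n → ∞, and set νₙ = √(2 log εₙ⁻¹). Then the minimax risk satisfies R(Θ(kₙ,τₙ), σₙ) = n σₙ² ( 2 εₙ log εₙ⁻¹ − 2 εₙ νₙ √(2 log νₙ) (1+o(1)) ). Moreover, the hard thresholding estimator η̂_H(y, λₙ) with tuning λₙ = σₙ√(2 log εₙ⁻¹) satisfies sup over θ ∈ Θ(kₙ,τₙ) of E_θ‖η̂_H(y,λₙ) − θ‖₂² = n σₙ² ( 2 εₙ log εₙ⁻¹ − 2 εₙ νₙ √(2 log νₙ) (1+o(1)) ). -/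
open MeasureTheory ProbabilityTheory Filter
open scoped ENNReal NNReal Topology

noncomputable section

/-- Gaussian sequence model: the law of `y` under parameter `θ`, the product of
the Gaussians `N(θ i, σ²)`. -/
def gsm (n : ℕ) (θ : Fin n → ℝ) (σ : ℝ) : Measure (Fin n → ℝ) :=
  MeasureTheory.Measure.pi fun i => gaussianReal (θ i) ((σ ^ 2).toNNReal)

/-- Squared-error risk `E_θ ‖est(y) − θ‖₂²` of an estimator at parameter `θ`. -/
def risk (n : ℕ) (σ : ℝ) (est : (Fin n → ℝ) → Fin n → ℝ) (θ : Fin n → ℝ) : ℝ≥0∞ :=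
  ∫⁻ y, ENNReal.ofReal (∑ i, (est y i - θ i) ^ 2) ∂(gsm n θ σ)

/-- The SNR-aware parameter space `Θ(k,τ) = {θ : ‖θ‖₀ ≤ k, ‖θ‖₂² ≤ k τ²}`. -/
def paramSet (n k : ℕ) (τ : ℝ) : Set (Fin n → ℝ) :=
  {θ | {i | θ i ≠ 0}.ncard ≤ k ∧ ∑ i, (θ i) ^ 2 ≤ (k : ℝ) * τ ^ 2}

/-- Minimax risk: infimum over measurable estimators of the supremum risk over `Θ`. -/
def minimaxRisk (n : ℕ) (σ : ℝ) (Θ : Set (Fin n → ℝ)) : ℝ≥0∞ :=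
  ⨅ (est : (Fin n → ℝ) → Fin n → ℝ) (_ : Measurable est), ⨆ θ ∈ Θ, risk n σ est θ

/-- Hard thresholding estimator `[η̂_H(y,λ)]ᵢ = yᵢ·1{|yᵢ| > λ}`. -/
def hardEst (n : ℕ) (lam : ℝ) : (Fin n → ℝ) → Fin n → ℝ :=
  fun y i => if lam < |y i| then y i else 0

lemma aux_chernoff (s : ℝ) (hs : 0 ≤ s) :
    (gaussianReal 0 1).real {z | s ≤ z} ≤ Real.exp (-s ^ 2 / 2) := by
  have h := measure_ge_le_exp_mul_mgf (μ := gaussianReal 0 1) (X := id) (t := s) s hs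
    (integrable_exp_mul_gaussianReal s)
  rw [mgf_id_gaussianReal, ← Real.exp_add] at h
  refine h.trans (le_of_eq ?_)
  congr 1
  simp
  ring

lemma aux_tail_lower (b : ℝ) (hb : 0 ≤ b) :
    Real.exp (-(b + 1) ^ 2 / 2) / 3 ≤ (gaussianReal 0 1).real {z | b < z} := by
  rw [Measure.real, gaussianReal_apply_eq_integral 0 one_ne_zero,
    ENNReal.toReal_ofReal (integral_nonneg (fun z => gaussianPDFReal_nonneg _ _ _))]
  have h1 : ∫ x in Set.Ioc b (b + 1), (Real.exp (-(b + 1) ^ 2 / 2) / 3)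
      ≤ ∫ x in Set.Ioc b (b + 1), gaussianPDFReal 0 1 x := by
    apply setIntegral_mono_on
    · exact integrableOn_const (by simp)
    · exact (integrable_gaussianPDFReal 0 1).integrableOn
    · exact measurableSet_Ioc
    · intro x hx
      rw [gaussianPDFReal_def]
      have hpi : Real.sqrt (2 * Real.pi * ((1 : ℝ≥0) : ℝ)) ≤ 3 := by
        rw [Real.sqrt_le_left (by norm_num)]
        have := Real.pi_lt_four
        simp
        linarith
      have hpos : 0 < Real.sqrt (2 * Real.pi * ((1 : ℝ≥0) : ℝ)) := by
        apply Real.sqrt_pos.2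
        have := Real.pi_pos
        simp
        linarith
      rw [div_eq_mul_inv, mul_comm]
      apply mul_le_mul
      · exact inv_anti₀ hpos hpi
      · apply Real.exp_le_exp.2
        simp
        have : x ^ 2 ≤ (b + 1) ^ 2 := by
          apply pow_le_pow_left₀ (by linarith [hx.1]) hx.2
        linarith
      · positivity
      · positivity
  have h2 : ∫ x in Set.Ioc b (b + 1), gaussianPDFReal 0 1 x
      ≤ ∫ x in {z | b < z}, gaussianPDFReal 0 1 x := by
    apply setIntegral_mono_set
    · exact (integrable_gaussianPDFReal 0 1).integrableOn
    · exact ae_of_all _ (fun z => gaussianPDFReal_nonneg _ _ _)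
    · exact (show Set.Ioc b (b+1) ⊆ {z | b < z} from fun x hx => hx.1).eventuallyLE
  have h3 : ∫ x in Set.Ioc b (b + 1), (Real.exp (-(b + 1) ^ 2 / 2) / 3) =
     Real.exp (-(b + 1) ^ 2 / 2) / 3 := by simp
  linarith

lemma aux_gauss_shift (a v : ℝ) (hv : 0 < v) :
    gaussianReal a v.toNNReal = (gaussianReal 0 v.toNNReal).withDensity
      (fun y => ENNReal.ofReal (Real.exp ((a * y - a ^ 2 / 2) / v))) := by
  have hv' : v.toNNReal ≠ 0 := by simpa using hv
  rw [gaussianReal_of_var_ne_zero _ hv', gaussianReal_of_var_ne_zero _ hv',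
    ← withDensity_mul _ (measurable_gaussianPDF _ _) (by fun_prop)]
  congr 1
  ext y
  simp only [Pi.mul_apply, gaussianPDF]
  rw [← ENNReal.ofReal_mul (gaussianPDFReal_nonneg _ _ _)]
  congr 1
  simp only [gaussianPDFReal_def, Real.coe_toNNReal v hv.le]
  have h : Real.exp (-(y - a) ^ 2 / (2 * v)) =
      Real.exp (-(y - 0) ^ 2 / (2 * v)) * Real.exp ((a * y - a ^ 2 / 2) / v) := by
    rw [← Real.exp_add]
    congr 1
    field_simp
    ring
  rw [h]
  ring

lemma aux_gsm_update (n : ℕ) (θ : Fin n → ℝ) (σ : ℝ) (hσ : 0 < σ) (i : Fin n) (hi : θ i = 0)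
    (a : ℝ) :
    gsm n (Function.update θ i a) σ = (gsm n θ σ).withDensity
      (fun y => ENNReal.ofReal (Real.exp ((a * y i - a ^ 2 / 2) / σ ^ 2))) := by
  unfold gsm
  apply Measure.pi_eq
  intro s hs
  have hms : MeasurableSet (Set.pi Set.univ s) := MeasurableSet.univ_pi hs
  set g : ℝ → ℝ≥0∞ := fun y => ENNReal.ofReal (Real.exp ((a * y - a ^ 2 / 2) / σ ^ 2)) with hg
  have hgm : Measurable g := by fun_prop
  rw [withDensity_apply _ hms, ← lintegral_indicator hms]
  let X : Fin n → ℝ → ℝ≥0∞ := fun j => (s j).indicator (if j = i then g else fun _ => 1)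
  have hX : ∀ j, Measurable (X j) := by
    intro j
    apply Measurable.indicator _ (hs j)
    split_ifs
    · exact hgm
    · exact measurable_const
  have hprod : ∀ y : Fin n → ℝ, (Set.pi Set.univ s).indicator (fun y => g (y i)) y =
      ∏ j, X j (y j) := by
    intro y
    by_cases hy : y ∈ Set.pi Set.univ s
    · rw [Set.indicator_of_mem hy]
      have : ∀ j, X j (y j) = if j = i then g (y i) else 1 := by
        intro j
        simp only [X]
        rw [Set.indicator_of_mem (hy j trivial)]
        split_ifs with h
        · rw [h]
        · rfl
      simp [this]
    · rw [Set.indicator_of_notMem hy]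
      simp only [Set.mem_pi, Set.mem_univ, true_imp_iff, not_forall] at hy
      obtain ⟨j, hj⟩ := hy
      symm
      apply Finset.prod_eq_zero (Finset.mem_univ j)
      simp only [X]
      rw [Set.indicator_of_notMem hj]
  refine (lintegral_congr hprod).trans ?_
  refine (lintegral_prod_eq_prod_lintegral_of_indepFun Finset.univ (fun j (y : Fin n → ℝ) => X j (y j))
    (iIndepFun_pi (fun j => (hX j).aemeasurable))
    (fun j => (hX j).comp (measurable_pi_apply j))).trans ?_
  apply Finset.prod_congr rfl
  intro j _
  have := (measurePreserving_eval (fun i => gaussianReal (θ i) ((σ ^ 2).toNNReal)) j).lintegral_comp (hX j)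
  refine this.trans ?_
  change ∫⁻ y, (s j).indicator (if j = i then g else fun _ => 1) y
    ∂(gaussianReal (θ j) ((σ ^ 2).toNNReal)) = _
  rw [lintegral_indicator (hs j)]
  by_cases h : j = i
  · subst h
    simp only [if_true, Function.update_self]
    rw [aux_gauss_shift a (σ ^ 2) (by positivity), hi, withDensity_apply _ (hs j)]
  · simp [h, Function.update_of_ne]

lemma aux_scale (σ ν x : ℝ) (hσ : 0 < σ) :
    ∫⁻ y, ENNReal.ofReal (((if σ * ν < |y| then y else 0) - σ * x) ^ 2)
      ∂(gaussianReal (σ * x) ((σ ^ 2).toNNReal)) =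
    ENNReal.ofReal (σ ^ 2) *
      ∫⁻ z, ENNReal.ofReal (if ν < |x + z| then z ^ 2 else x ^ 2) ∂(gaussianReal 0 1) := by
  have h1 : gaussianReal (σ * x) ((σ ^ 2).toNNReal) =
      (gaussianReal 0 1).map (fun z => σ * (x + z)) := by
    have : (fun z : ℝ => σ * (x + z)) = (fun z => σ * z) ∘ (fun z => x + z) := rfl
    rw [this, ← Measure.map_map (by fun_prop) (by fun_prop), gaussianReal_map_const_add,
      gaussianReal_map_const_mul]
    congr 1
    · simp
    · ext
      simp [Real.coe_toNNReal _ (sq_nonneg σ)]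
  have hm : Measurable (fun y : ℝ => ENNReal.ofReal (((if σ * ν < |y| then y else 0) - σ * x) ^ 2)) := by
    apply ENNReal.measurable_ofReal.comp
    apply Measurable.pow_const
    apply Measurable.sub_const
    exact Measurable.ite (measurableSet_lt measurable_const (by fun_prop)) measurable_id measurable_const
  have hm2 : Measurable (fun z : ℝ => ENNReal.ofReal (if ν < |x + z| then z ^ 2 else x ^ 2)) := by
    apply ENNReal.measurable_ofReal.comp
    exact Measurable.ite (measurableSet_lt measurable_const (by fun_prop)) (by fun_prop) measurable_const
  rw [h1, lintegral_map hm (by fun_prop), ← lintegral_const_mul _ hm2]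
  apply lintegral_congr
  intro z
  rw [← ENNReal.ofReal_mul (by positivity)]
  congr 1
  have : (σ * ν < |σ * (x + z)|) ↔ ν < |x + z| := by
    rw [abs_mul, abs_of_pos hσ]
    exact mul_lt_mul_iff_right₀ hσ
  simp only [this]
  split_ifs <;> ring

lemma aux_tendsto : Tendsto (fun z : ℝ => -((z + 1) * gaussianPDFReal 0 1 z)) atTop (𝓝 0) := by
  have h1 := Real.tendsto_pow_mul_exp_neg_atTop_nhds_zero 1
  have h0 := Real.tendsto_pow_mul_exp_neg_atTop_nhds_zero 0
  have h2 : Tendsto (fun z : ℝ => (√(2 * Real.pi * ((1 : ℝ≥0) : ℝ)))⁻¹ * Real.exp (1/2) *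
      (z ^ 1 * Real.exp (-z) + z ^ 0 * Real.exp (-z))) atTop (𝓝 0) := by
    simpa using (h1.add h0).const_mul ((√(2 * Real.pi * ((1 : ℝ≥0) : ℝ)))⁻¹ * Real.exp (1/2))
  suffices h : Tendsto (fun z : ℝ => (z + 1) * gaussianPDFReal 0 1 z) atTop (𝓝 0) by
    simpa using h.neg
  apply tendsto_of_tendsto_of_tendsto_of_le_of_le' tendsto_const_nhds h2
  · filter_upwards [eventually_ge_atTop 0] with z hz
    exact mul_nonneg (by linarith) (gaussianPDFReal_nonneg _ _ _)
  · filter_upwards [eventually_ge_atTop 0] with z hz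
    simp only [gaussianPDFReal_def]
    have : Real.exp (-(z - 0) ^ 2 / (2 * ((1 : ℝ≥0) : ℝ))) ≤ Real.exp (1/2) * Real.exp (-z) := by
      rw [← Real.exp_add]
      apply Real.exp_le_exp.2
      simp
      nlinarith [sq_nonneg (z - 1)]
    calc (z + 1) * ((√(2 * Real.pi * ((1 : ℝ≥0) : ℝ)))⁻¹ * Real.exp (-(z - 0) ^ 2 / (2 * ((1 : ℝ≥0) : ℝ))))
        ≤ (z + 1) * ((√(2 * Real.pi * ((1 : ℝ≥0) : ℝ)))⁻¹ * (Real.exp (1/2) * Real.exp (-z))) := by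
          gcongr
      _ = _ := by ring

lemma aux_pdf_deriv (z : ℝ) :
    HasDerivAt (fun z : ℝ => gaussianPDFReal 0 1 z) (-z * gaussianPDFReal 0 1 z) z := by
  have h : (fun z : ℝ => gaussianPDFReal 0 1 z) =
      fun z => (√(2 * Real.pi * ((1 : ℝ≥0) : ℝ)))⁻¹ * Real.exp (-z ^ 2 / 2) := by
    ext z
    rw [gaussianPDFReal_def]
    simp
  have h2 : gaussianPDFReal 0 1 z =
      (√(2 * Real.pi * ((1 : ℝ≥0) : ℝ)))⁻¹ * Real.exp (-z ^ 2 / 2) := by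
    rw [gaussianPDFReal_def]
    simp
  rw [h, h2]
  have h3 : HasDerivAt (fun z : ℝ => -z ^ 2 / 2) (-z) z := by
    have := ((hasDerivAt_pow 2 z).neg).div_const 2
    exact this.congr_deriv (by push_cast; ring)
  have := (h3.exp).const_mul (√(2 * Real.pi * ((1 : ℝ≥0) : ℝ)))⁻¹
  exact this.congr_deriv (by ring)

lemma aux_tail_sq (ν : ℝ) (hν : 1 ≤ ν) :
    ∫⁻ z in Set.Ioi ν, ENNReal.ofReal (z ^ 2) ∂(gaussianReal 0 1) ≤
      ENNReal.ofReal ((ν + 1) * Real.exp (-ν ^ 2 / 2) / 2) := by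
  set F : ℝ → ℝ := fun z => -((z + 1) * gaussianPDFReal 0 1 z) with hF
  set F' : ℝ → ℝ := fun z => (z ^ 2 + z - 1) * gaussianPDFReal 0 1 z with hF'
  have hd : ∀ z ∈ Set.Ici ν, HasDerivAt F (F' z) z := by
    intro z _
    have := ((((hasDerivAt_id z).add_const 1)).mul (aux_pdf_deriv z)).neg
    exact this.congr_deriv (by simp only [hF', id]; ring)
  have hpos : ∀ z ∈ Set.Ioi ν, 0 ≤ F' z := by
    intro z hz
    have hz' : ν < z := hz
    exact mul_nonneg (by nlinarith) (gaussianPDFReal_nonneg _ _ _)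
  have hint := integrableOn_Ioi_deriv_of_nonneg' hd hpos aux_tendsto
  have heq := integral_Ioi_of_hasDerivAt_of_nonneg' hd hpos aux_tendsto
  rw [gaussianReal_of_var_ne_zero _ one_ne_zero, restrict_withDensity measurableSet_Ioi,
    lintegral_withDensity_eq_lintegral_mul _ (measurable_gaussianPDF _ _) (by fun_prop)]
  calc ∫⁻ z in Set.Ioi ν, (gaussianPDF 0 1 * fun z => ENNReal.ofReal (z ^ 2)) z
      ≤ ∫⁻ z in Set.Ioi ν, ENNReal.ofReal (F' z) := by
        apply setLIntegral_mono' measurableSet_Ioi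
        intro z hz
        have hz' : ν < z := hz
        simp only [Pi.mul_apply, gaussianPDF]
        rw [← ENNReal.ofReal_mul (gaussianPDFReal_nonneg _ _ _)]
        apply ENNReal.ofReal_le_ofReal
        rw [hF', mul_comm]
        apply mul_le_mul_of_nonneg_right _ (gaussianPDFReal_nonneg _ _ _)
        linarith
    _ = ENNReal.ofReal (∫ z in Set.Ioi ν, F' z) := by
        rw [ofReal_integral_eq_lintegral_ofReal hint]
        exact (ae_restrict_iff' measurableSet_Ioi).2 (ae_of_all _ hpos)
    _ ≤ _ := by
        rw [heq]
        apply ENNReal.ofReal_le_ofReal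
        simp only [hF, gaussianPDFReal_def]
        have hc : (√(2 * Real.pi * ((1 : ℝ≥0) : ℝ)))⁻¹ ≤ 2⁻¹ := by
          apply inv_anti₀ (by norm_num)
          apply Real.le_sqrt_of_sq_le
          have := Real.pi_gt_three
          simp
          linarith
        have he : Real.exp (-(ν - 0) ^ 2 / (2 * ((1 : ℝ≥0) : ℝ))) = Real.exp (-ν ^ 2 / 2) := by simp
        rw [he]
        have := mul_le_mul_of_nonneg_left hc (show 0 ≤ (ν + 1) * Real.exp (-ν ^ 2 / 2) by positivity)
        linarith

lemma aux_r0 (ν : ℝ) (hν : 1 ≤ ν) :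
    ∫⁻ z, ENNReal.ofReal (if ν < |0 + z| then z ^ 2 else 0 ^ 2) ∂(gaussianReal 0 1) ≤
      ENNReal.ofReal ((ν + 1) * Real.exp (-ν ^ 2 / 2)) := by
  have hneg : ∫⁻ z in Set.Iio (-ν), ENNReal.ofReal (z ^ 2) ∂(gaussianReal 0 1) =
      ∫⁻ z in Set.Ioi ν, ENNReal.ofReal (z ^ 2) ∂(gaussianReal 0 1) := by
    conv_rhs => rw [← neg_zero, ← gaussianReal_map_neg]
    rw [setLIntegral_map measurableSet_Ioi (by fun_prop) (by fun_prop)]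
    simp [Set.preimage, Set.Iio, lt_neg]
  have h := aux_tail_sq ν hν
  calc _ ≤ ∫⁻ z, ((Set.Ioi ν).indicator (fun z => ENNReal.ofReal (z ^ 2)) z +
          (Set.Iio (-ν)).indicator (fun z => ENNReal.ofReal (z ^ 2)) z) ∂(gaussianReal 0 1) := by
        apply lintegral_mono
        intro z
        simp only [zero_add]
        split_ifs with hz
        · rcases lt_abs.1 hz with h1 | h1
          · rw [Set.indicator_of_mem (show z ∈ Set.Ioi ν from h1)]
            exact le_self_add
          · rw [Set.indicator_of_mem (show z ∈ Set.Iio (-ν) from (by simp; linarith))]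
            exact le_add_self
        · simp
    _ = ∫⁻ z in Set.Ioi ν, ENNReal.ofReal (z ^ 2) ∂(gaussianReal 0 1) +
        ∫⁻ z in Set.Iio (-ν), ENNReal.ofReal (z ^ 2) ∂(gaussianReal 0 1) := by
        rw [lintegral_add_left (Measurable.indicator (by fun_prop) measurableSet_Ioi),
          lintegral_indicator measurableSet_Ioi, lintegral_indicator measurableSet_Iio]
    _ ≤ ENNReal.ofReal ((ν + 1) * Real.exp (-ν ^ 2 / 2) / 2) +
        ENNReal.ofReal ((ν + 1) * Real.exp (-ν ^ 2 / 2) / 2) := by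
        rw [hneg]
        exact add_le_add h h
    _ = _ := by
        rw [← ENNReal.ofReal_add (by positivity) (by positivity)]
        congr 1
        ring

lemma aux_sq : ∫⁻ z, ENNReal.ofReal (z ^ 2) ∂(gaussianReal 0 1) = 1 := by
  have hm : MemLp id 2 (gaussianReal 0 1) := memLp_id_gaussianReal' 2 (by simp)
  have hv := variance_eq_sub hm
  rw [variance_id_gaussianReal] at hv
  have hi : Integrable (fun z : ℝ => z ^ 2) (gaussianReal 0 1) := hm.integrable_sq
  rw [← ofReal_integral_eq_lintegral_ofReal hi (ae_of_all _ fun z => sq_nonneg z)]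
  have h1 : ∫ z, z ^ 2 ∂(gaussianReal 0 1) = 1 := by
    simp at hv
    exact hv.symm
  rw [h1]
  simp

lemma aux_rx (ν x : ℝ) :
    ∫⁻ z, ENNReal.ofReal (if ν < |x + z| then z ^ 2 else x ^ 2) ∂(gaussianReal 0 1) ≤
      ENNReal.ofReal (1 + x ^ 2 * (gaussianReal 0 1).real {z | z ≤ ν - x}) := by
  have hs : MeasurableSet {z : ℝ | z ≤ ν - x} := measurableSet_Iic
  calc _ ≤ ∫⁻ z, (ENNReal.ofReal (z ^ 2) +
          {z : ℝ | z ≤ ν - x}.indicator (fun _ => ENNReal.ofReal (x ^ 2)) z) ∂(gaussianReal 0 1) := by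
        apply lintegral_mono
        intro z
        dsimp only
        split_ifs with hz
        · exact le_self_add
        · rw [Set.indicator_of_mem]
          · exact le_add_self
          · have := (abs_le.1 (not_lt.1 hz)).2
            simp
            linarith
    _ = 1 + ENNReal.ofReal (x ^ 2) * (gaussianReal 0 1) {z | z ≤ ν - x} := by
        rw [lintegral_add_left (by fun_prop), aux_sq, lintegral_indicator hs]
        simp
    _ = _ := by
        rw [ENNReal.ofReal_add (by norm_num) (by positivity), ENNReal.ofReal_mul (by positivity)]
        simp [Measure.real]

lemma aux_sym (ν x : ℝ) :
    ∫⁻ z, ENNReal.ofReal (if ν < |x + z| then z ^ 2 else x ^ 2) ∂(gaussianReal 0 1) =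
    ∫⁻ z, ENNReal.ofReal (if ν < |-x + z| then z ^ 2 else (-x) ^ 2) ∂(gaussianReal 0 1) := by
  conv_rhs => rw [← neg_zero, ← gaussianReal_map_neg]
  have hm2 : Measurable (fun z : ℝ => ENNReal.ofReal (if ν < |-x + z| then z ^ 2 else (-x) ^ 2)) := by
    apply ENNReal.measurable_ofReal.comp
    exact Measurable.ite (measurableSet_lt measurable_const (by fun_prop)) (by fun_prop) measurable_const
  rw [lintegral_map hm2 (by fun_prop)]
  apply lintegral_congr
  intro z
  rw [show -x + -z = -(x + z) by ring, abs_neg]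
  simp

lemma aux_num (ν s x : ℝ) (hs : 13 ≤ s) (hνs : 20 * s ≤ ν) (hs2 : s ^ 2 ≤ 2 * ν)
    (he : Real.exp (s ^ 2 / 2) = ν) (hx : 0 ≤ x) :
    1 + x ^ 2 * (gaussianReal 0 1).real {z | z ≤ ν - x} ≤ ν ^ 2 - 2 * ν * s + 7 * ν := by
  have hP1 : (gaussianReal 0 1).real {z | z ≤ ν - x} ≤ 1 := measureReal_le_one
  have hν : 260 ≤ ν := by linarith
  rcases le_or_gt x (ν - s + 2) with hA | hA
  · have : x ^ 2 * (gaussianReal 0 1).real {z | z ≤ ν - x} ≤ (ν - s + 2) ^ 2 * 1 := by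
      apply mul_le_mul _ hP1 measureReal_nonneg (by positivity)
      exact pow_le_pow_left₀ hx hA 2
    nlinarith
  rcases le_or_gt x (ν + 1) with hB | hB
  · set q := (gaussianReal 0 1).real {z | s - 2 < z} with hq
    have hq1 : (gaussianReal 0 1).real {z | z ≤ ν - x} ≤ 1 - q := by
      have hc : {z : ℝ | s - 2 < z} = {z : ℝ | z ≤ s - 2}ᶜ := by ext; simp
      have : (gaussianReal 0 1).real {z | z ≤ s - 2} = 1 - q := by
        rw [hq, hc, probReal_compl_eq_one_sub (show MeasurableSet {z : ℝ | z ≤ s - 2} from measurableSet_Iic)]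
        ring
      rw [← this]
      apply measureReal_mono _ (by finiteness)
      intro z hz
      simp at hz ⊢
      linarith
    have hq2 := aux_tail_lower (s - 2) (by linarith)
    rw [← hq] at hq2
    have hνq : 2 * s + 3 ≤ ν * q := by
      have h1 : ν * (Real.exp (-(s - 2 + 1) ^ 2 / 2) / 3) = Real.exp (s - 1 / 2) / 3 := by
        rw [← he, ← mul_div_assoc, ← Real.exp_add]
        congr 2
        ring
      have h2 := Real.quadratic_le_exp_of_nonneg (show 0 ≤ s - 1 / 2 by linarith)
      have h3 : 2 * s + 3 ≤ Real.exp (s - 1 / 2) / 3 := by nlinarith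
      have h4 := mul_le_mul_of_nonneg_left hq2 (show 0 ≤ ν by linarith)
      linarith
    have hq0 : 0 ≤ q := measureReal_nonneg
    have hqle : q ≤ 1 := measureReal_le_one
    have : x ^ 2 * (gaussianReal 0 1).real {z | z ≤ ν - x} ≤ (ν + 1) ^ 2 * (1 - q) := by
      apply mul_le_mul _ hq1 measureReal_nonneg (by positivity)
      exact pow_le_pow_left₀ hx hB 2
    have h5 : ν * (2 * s + 3) ≤ ν * (ν * q) := mul_le_mul_of_nonneg_left hνq (by linarith)
    nlinarith
  · set d := x - ν with hd
    have hd1 : 1 ≤ d := by linarith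
    have hP : (gaussianReal 0 1).real {z | z ≤ ν - x} ≤ Real.exp (-d ^ 2 / 2) := by
      refine le_trans (le_of_eq ?_) (aux_chernoff d (by linarith))
      conv_lhs => rw [← neg_zero, ← gaussianReal_map_neg]
      rw [map_measureReal_apply measurable_neg (show MeasurableSet {z : ℝ | z ≤ ν - x} from measurableSet_Iic)]
      congr 1
      ext z
      simp only [Set.mem_preimage, Set.mem_ofPred_eq]
      constructor <;> intro h <;> linarith
    have hx2 : x ≤ ν * Real.exp (d / ν) := by
      have := Real.add_one_le_exp (d / ν)
      have h2 := mul_le_mul_of_nonneg_left this (show 0 ≤ ν by linarith)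
      have h3 : ν * (d / ν + 1) = x := by
        rw [hd]; field_simp; ring
      linarith
    have h6 : x ^ 2 * (gaussianReal 0 1).real {z | z ≤ ν - x} ≤
        (ν * Real.exp (d / ν)) ^ 2 * Real.exp (-d ^ 2 / 2) :=
      mul_le_mul (pow_le_pow_left₀ hx hx2 2) hP measureReal_nonneg (by positivity)
    have h7 : (ν * Real.exp (d / ν)) ^ 2 * Real.exp (-d ^ 2 / 2) ≤ ν ^ 2 * (4 / 5) := by
      rw [mul_pow, mul_assoc, ← Real.exp_nat_mul, ← Real.exp_add]
      apply mul_le_mul_of_nonneg_left _ (by positivity)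
      have h8 : ((2 : ℕ) : ℝ) * (d / ν) + -d ^ 2 / 2 ≤ -(1 / 4) := by
        have : d / ν ≤ d / 8 := div_le_div_of_nonneg_left (by linarith) (by norm_num) (by linarith)
        push_cast
        nlinarith
      refine (Real.exp_le_exp.2 h8).trans ?_
      rw [Real.exp_neg]
      have := Real.add_one_le_exp (1 / 4 : ℝ)
      calc (Real.exp (1/4))⁻¹ ≤ (5/4 : ℝ)⁻¹ := inv_anti₀ (by norm_num) (by linarith)
        _ = 4 / 5 := by norm_num
    nlinarith

lemma aux_risk_hard (n : ℕ) (σ lam : ℝ) (θ : Fin n → ℝ) :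
    risk n σ (hardEst n lam) θ = ∑ i, ∫⁻ y, ENNReal.ofReal (((if lam < |y| then y else 0) - θ i) ^ 2)
      ∂(gaussianReal (θ i) ((σ ^ 2).toNNReal)) := by
  have hm : ∀ i, Measurable (fun y : ℝ => ENNReal.ofReal (((if lam < |y| then y else 0) - θ i) ^ 2)) := by
    intro i
    apply ENNReal.measurable_ofReal.comp
    apply Measurable.pow_const
    apply Measurable.sub_const
    exact Measurable.ite (measurableSet_lt measurable_const (by fun_prop)) measurable_id measurable_const
  unfold risk hardEst gsm
  simp_rw [ENNReal.ofReal_sum_of_nonneg (fun i _ => sq_nonneg _)]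
  rw [lintegral_finsetSum (f := fun i (y : Fin n → ℝ) =>
    ENNReal.ofReal (((if lam < |y i| then y i else 0) - θ i) ^ 2)) _
    (fun i _ => (hm i).comp (measurable_pi_apply i))]
  apply Finset.sum_congr rfl
  intro i _
  exact (measurePreserving_eval (fun i => gaussianReal (θ i) ((σ ^ 2).toNNReal)) i).lintegral_comp (hm i)

lemma aux_hard_upper (n k : ℕ) (σ τ ν s : ℝ) (hσ : 0 < σ) (hs : 13 ≤ s) (hνs : 20 * s ≤ ν)
    (hs2 : s ^ 2 ≤ 2 * ν) (he : Real.exp (s ^ 2 / 2) = ν)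
    (hnk : (n : ℝ) * Real.exp (-ν ^ 2 / 2) = k) (θ : Fin n → ℝ) (hθ : θ ∈ paramSet n k τ) :
    risk n σ (hardEst n (σ * ν)) θ ≤
      ENNReal.ofReal (k * σ ^ 2 * (ν ^ 2 - 2 * ν * s + 9 * ν)) := by
  classical
  have hν : 260 ≤ ν := by linarith
  rw [aux_risk_hard]
  set A : ℝ := ν ^ 2 - 2 * ν * s + 7 * ν with hA
  set C : ℝ := (ν + 1) * Real.exp (-ν ^ 2 / 2) with hC
  have hC0 : 0 ≤ C := by positivity
  have hA0 : 0 ≤ A := by nlinarith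
  have hterm : ∀ i, ∫⁻ y, ENNReal.ofReal (((if σ * ν < |y| then y else 0) - θ i) ^ 2)
      ∂(gaussianReal (θ i) ((σ ^ 2).toNNReal)) ≤
      ENNReal.ofReal (σ ^ 2 * ((if θ i ≠ 0 then A else 0) + C)) := by
    intro i
    obtain ⟨x, hx⟩ : ∃ x, θ i = σ * x := ⟨θ i / σ, by field_simp⟩
    rw [hx, aux_scale σ ν x hσ, ENNReal.ofReal_mul (by positivity)]
    gcongr
    by_cases h0 : x = 0
    · subst h0
      refine (aux_r0 ν (by linarith)).trans ?_
      apply ENNReal.ofReal_le_ofReal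
      simp [hC]
    · have hne : σ * x ≠ 0 := mul_ne_zero hσ.ne' h0
      rw [if_pos hne]
      have key : ∀ x : ℝ, 0 ≤ x → ∫⁻ z, ENNReal.ofReal (if ν < |x + z| then z ^ 2 else x ^ 2)
          ∂(gaussianReal 0 1) ≤ ENNReal.ofReal (A + C) := by
        intro x hx
        refine (aux_rx ν x).trans ?_
        apply ENNReal.ofReal_le_ofReal
        have := aux_num ν s x hs hνs hs2 he hx
        linarith
      rcases le_total 0 x with h | h
      · exact key x h
      · rw [aux_sym]
        exact key (-x) (by linarith)
  refine (Finset.sum_le_sum (fun i _ => hterm i)).trans ?_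
  rw [← ENNReal.ofReal_sum_of_nonneg]
  swap
  · intro i _
    have : 0 ≤ (if θ i ≠ 0 then A else 0) := by split_ifs <;> simp [hA0]
    positivity
  apply ENNReal.ofReal_le_ofReal
  rw [← Finset.mul_sum, Finset.sum_add_distrib, ← Finset.sum_filter, Finset.sum_const, Finset.sum_const]
  have hcard : ((Finset.univ.filter (fun i => θ i ≠ 0)).card : ℝ) ≤ k := by
    have := hθ.1
    rw [Set.ncard_eq_toFinset_card'] at this
    have h2 : (Finset.univ.filter (fun i => θ i ≠ 0)).card ≤ k := by
      convert this using 2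
      ext; simp
    exact_mod_cast h2
  simp only [nsmul_eq_mul, Finset.card_univ, Fintype.card_fin]
  have h1 : (n : ℝ) * C = k * (ν + 1) := by
    rw [hC, ← hnk]; ring
  rw [h1]
  have h2 := mul_le_mul_of_nonneg_right hcard hA0
  have hk0 : (0 : ℝ) ≤ k := Nat.cast_nonneg k
  have h3 : ((Finset.univ.filter (fun i => θ i ≠ 0)).card : ℝ) * A + k * (ν + 1) ≤
      k * (ν ^ 2 - 2 * ν * s + 9 * ν) := by
    nlinarith
  have := mul_le_mul_of_nonneg_left h3 (sq_nonneg σ)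
  linarith

lemma aux_alg (m : ℕ) (g t : Fin m → ℝ) (a B : ℝ) (hg0 : ∀ j, 0 ≤ g j) (hgB : ∀ j, g j ≤ B)
    (hB : 0 ≤ B) :
    a ^ 2 * ∑ j, g j ≤ ∑ j, g j * ∑ j', (t j' - if j' = j then a else 0) ^ 2 + a ^ 2 * B := by
  set G := ∑ j, g j with hG
  have hG0 : 0 ≤ G := Finset.sum_nonneg (fun j _ => hg0 j)
  rcases hG0.eq_or_lt with h | h
  · rw [← h, mul_zero]
    have : 0 ≤ ∑ j, g j * ∑ j', (t j' - if j' = j then a else 0) ^ 2 :=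
      Finset.sum_nonneg (fun j _ => mul_nonneg (hg0 j) (Finset.sum_nonneg (fun _ _ => sq_nonneg _)))
    positivity
  · have h1 : ∀ j, ∑ j', (t j' - if j' = j then a else 0) ^ 2 =
        (∑ j', t j' ^ 2) - 2 * a * t j + a ^ 2 := by
      intro j
      have : ∀ j', (t j' - if j' = j then a else 0) ^ 2 =
          t j' ^ 2 + (if j' = j then a ^ 2 - 2 * a * t j' else 0) := by
        intro j'
        split_ifs <;> ring
      simp_rw [this, Finset.sum_add_distrib]
      simp
      ring
    have h2 : ∑ j, g j * ∑ j', (t j' - if j' = j then a else 0) ^ 2 =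
        ∑ j, (G * t j ^ 2 - 2 * a * g j * t j) + a ^ 2 * G := by
      have h5 : ∀ j, g j * ∑ j', (t j' - if j' = j then a else 0) ^ 2 =
          (∑ j', t j' ^ 2) * g j - 2 * a * g j * t j + a ^ 2 * g j := by
        intro j
        rw [h1]
        ring
      simp_rw [h5]
      rw [Finset.sum_add_distrib, Finset.sum_sub_distrib, Finset.sum_sub_distrib,
        ← Finset.mul_sum, ← Finset.mul_sum, ← Finset.mul_sum, ← hG]
      ring
    have h3 : ∑ j, (a ^ 2 * B / G * g j) = a ^ 2 * B := by
      rw [← Finset.mul_sum, ← hG]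
      field_simp
    have h4 : 0 ≤ ∑ j, ((G * t j ^ 2 - 2 * a * g j * t j) + a ^ 2 * B / G * g j) := by
      apply Finset.sum_nonneg
      intro j _
      have : (G * t j ^ 2 - 2 * a * g j * t j) + a ^ 2 * B / G * g j =
          ((G * t j - a * g j) ^ 2 + a ^ 2 * g j * (B - g j)) / G := by
        field_simp
        ring
      rw [this]
      have := mul_nonneg (mul_nonneg (sq_nonneg a) (hg0 j)) (sub_nonneg.2 (hgB j))
      positivity
    rw [Finset.sum_add_distrib, h3] at h4
    rw [h2]
    linarith

lemma aux_block (n m : ℕ) (θ : Fin n → ℝ) (σ : ℝ) (hσ : 0 < σ) (e : Fin m → Fin n)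
    (hinj : Function.Injective e) (hθ : ∀ j, θ (e j) = 0) (a T B : ℝ) (ha : 0 ≤ a)
    (hB : Real.exp ((a * T - a ^ 2 / 2) / σ ^ 2) ≤ B)
    (est : (Fin n → ℝ) → Fin n → ℝ) (hest : Measurable est) :
    ∑ j, ENNReal.ofReal (a ^ 2) * gsm n (Function.update θ (e j) a) σ {y | y (e j) ≤ T} ≤
    ∑ j, ∫⁻ y, ENNReal.ofReal (∑ j', (est y (e j') - Function.update θ (e j) a (e j')) ^ 2)
      ∂(gsm n (Function.update θ (e j) a) σ) + ENNReal.ofReal (a ^ 2 * B) := by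
  have hprob : IsProbabilityMeasure (gsm n θ σ) := by unfold gsm; infer_instance
  have hB0 : 0 ≤ B := (Real.exp_pos _).le.trans hB
  have hcoord : ∀ j, Measurable (fun y => est y j) := fun j => (measurable_pi_apply j).comp hest
  set L : Fin m → (Fin n → ℝ) → ℝ := fun j y => Real.exp ((a * y (e j) - a ^ 2 / 2) / σ ^ 2) with hL
  have hLm : ∀ j, Measurable (L j) := fun j => by simp only [hL]; fun_prop
  set S : Fin m → Set (Fin n → ℝ) := fun j => {y | y (e j) ≤ T} with hS
  have hSm : ∀ j, MeasurableSet (S j) := fun j =>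
    measurableSet_le (measurable_pi_apply _) measurable_const
  set g : Fin m → (Fin n → ℝ) → ℝ := fun j => (S j).indicator (L j) with hg
  have hgm : ∀ j, Measurable (g j) := fun j => (hLm j).indicator (hSm j)
  have hg0 : ∀ j y, 0 ≤ g j y := fun j y =>
    Set.indicator_nonneg (fun _ _ => (Real.exp_pos _).le) y
  have hgB : ∀ j y, g j y ≤ B := by
    intro j y
    simp only [hg]
    by_cases hy : y ∈ S j
    · rw [Set.indicator_of_mem hy]
      refine le_trans ?_ hB
      apply Real.exp_le_exp.2
      have : y (e j) ≤ T := hy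
      gcongr
    · rw [Set.indicator_of_notMem hy]
      exact hB0
  have hgL : ∀ j y, g j y ≤ L j y := by
    intro j y
    exact Set.indicator_le_self' (fun _ _ => (Real.exp_pos _).le) y
  have hupd : ∀ j j', Function.update θ (e j) a (e j') = if j' = j then a else 0 := by
    intro j j'
    by_cases h : j' = j
    · simp [h]
    · rw [Function.update_of_ne (fun hh => h (hinj hh)), hθ, if_neg h]
  simp_rw [hupd]
  have hDm : ∀ j, Measurable (fun y => ENNReal.ofReal (∑ j', (est y (e j') - if j' = j then a else 0) ^ 2)) := by
    intro j
    apply ENNReal.measurable_ofReal.comp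
    apply Finset.measurable_sum
    intro j' _
    exact ((hcoord (e j')).sub_const _).pow_const 2
  have h1 : ∀ j, gsm n (Function.update θ (e j) a) σ (S j) =
      ∫⁻ y, ENNReal.ofReal (g j y) ∂(gsm n θ σ) := by
    intro j
    rw [aux_gsm_update n θ σ hσ (e j) (hθ j) a, withDensity_apply _ (hSm j),
      ← lintegral_indicator (hSm j)]
    apply lintegral_congr
    intro y
    simp only [hg]
    by_cases hy : y ∈ S j
    · rw [Set.indicator_of_mem hy, Set.indicator_of_mem hy]
    · rw [Set.indicator_of_notMem hy, Set.indicator_of_notMem hy]; simp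
  have h2 : ∀ j, ∫⁻ y, ENNReal.ofReal (g j y * ∑ j', (est y (e j') - if j' = j then a else 0) ^ 2) ∂(gsm n θ σ)
      ≤ ∫⁻ y, ENNReal.ofReal (∑ j', (est y (e j') - if j' = j then a else 0) ^ 2)
      ∂(gsm n (Function.update θ (e j) a) σ) := by
    intro j
    rw [aux_gsm_update n θ σ hσ (e j) (hθ j) a, lintegral_withDensity_eq_lintegral_mul _
      (show Measurable (fun y : Fin n → ℝ =>
        ENNReal.ofReal (Real.exp ((a * y (e j) - a ^ 2 / 2) / σ ^ 2))) by fun_prop) (hDm j)]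
    apply lintegral_mono
    intro y
    simp only [Pi.mul_apply]
    rw [ENNReal.ofReal_mul (hg0 j y)]
    gcongr
    exact hgL j y
  refine le_trans ?_ (add_le_add_left (Finset.sum_le_sum (fun j _ => h2 j)) _)
  change ∑ j, ENNReal.ofReal (a ^ 2) * gsm n (Function.update θ (e j) a) σ (S j) ≤ _
  simp_rw [h1]
  have hm1 : ∀ j, Measurable (fun y => ENNReal.ofReal (g j y)) :=
    fun j => ENNReal.measurable_ofReal.comp (hgm j)
  have hm2 : ∀ j, Measurable (fun y => ENNReal.ofReal (g j y * ∑ j', (est y (e j') - if j' = j then a else 0) ^ 2)) := by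
    intro j
    simp_rw [ENNReal.ofReal_mul (hg0 j _)]
    exact (hm1 j).mul (hDm j)
  rw [← Finset.mul_sum, ← lintegral_finsetSum _ (fun j _ => hm1 j),
    ← lintegral_finsetSum _ (fun j _ => hm2 j),
    ← lintegral_const_mul _ (Finset.measurable_sum _ (fun j _ => hm1 j))]
  have hc : ENNReal.ofReal (a ^ 2 * B) = ∫⁻ _, ENNReal.ofReal (a ^ 2 * B) ∂(gsm n θ σ) := by simp
  rw [hc, ← lintegral_add_right _ measurable_const]
  apply lintegral_mono
  intro y
  dsimp only
  have hnn : ∀ j, 0 ≤ g j y * ∑ j', (est y (e j') - if j' = j then a else 0) ^ 2 :=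
    fun j => mul_nonneg (hg0 j y) (Finset.sum_nonneg (fun _ _ => sq_nonneg _))
  rw [← ENNReal.ofReal_sum_of_nonneg (fun j _ => hg0 j y),
    ← ENNReal.ofReal_sum_of_nonneg (fun j _ => hnn j),
    ← ENNReal.ofReal_mul (sq_nonneg a),
    ← ENNReal.ofReal_add (Finset.sum_nonneg (fun j _ => hnn j)) (by positivity)]
  exact ENNReal.ofReal_le_ofReal
    (aux_alg m (fun j => g j y) (fun j => est y (e j)) a B (fun j => hg0 j y) (fun j => hgB j y) hB0)

lemma aux_prob (n : ℕ) (θ : Fin n → ℝ) (σ x s : ℝ) (hσ : 0 < σ) (hs : 0 ≤ s) (i : Fin n) :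
    ENNReal.ofReal (1 - Real.exp (-s ^ 2 / 2)) ≤
      gsm n (Function.update θ i (σ * x)) σ {y | y i ≤ σ * (x + s)} := by
  have h0 : gsm n (Function.update θ i (σ * x)) σ {y | y i ≤ σ * (x + s)} =
      gaussianReal (σ * x) ((σ ^ 2).toNNReal) (Set.Iic (σ * (x + s))) := by
    have := (measurePreserving_eval (fun j => gaussianReal (Function.update θ i (σ * x) j)
      ((σ ^ 2).toNNReal)) i).measure_preimage (measurableSet_Iic (a := σ * (x + s))).nullMeasurableSet
    simp only [Function.update_self] at this
    exact this
  have h1 : gaussianReal (σ * x) ((σ ^ 2).toNNReal) =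
      (gaussianReal 0 1).map (fun z => σ * (x + z)) := by
    have : (fun z : ℝ => σ * (x + z)) = (fun z => σ * z) ∘ (fun z => x + z) := rfl
    rw [this, ← Measure.map_map (by fun_prop) (by fun_prop), gaussianReal_map_const_add,
      gaussianReal_map_const_mul]
    congr 1
    · simp
    · ext
      simp [Real.coe_toNNReal _ (sq_nonneg σ)]
  rw [h0, h1, Measure.map_apply (by fun_prop) measurableSet_Iic]
  have h2 : (fun z : ℝ => σ * (x + z)) ⁻¹' Set.Iic (σ * (x + s)) = Set.Iic s := by
    ext z
    simp [hσ]
  rw [h2, ← ofReal_measureReal]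
  apply ENNReal.ofReal_le_ofReal
  have h3 := aux_chernoff s hs
  have h4 : (gaussianReal 0 1).real (Set.Iic s) + (gaussianReal 0 1).real {z | s ≤ z} ≥ 1 := by
    have : (Set.univ : Set ℝ) = Set.Iic s ∪ {z | s ≤ z} := by
      ext z
      simp [le_total]
    rw [← probReal_univ (μ := gaussianReal 0 1), this]
    exact measureReal_union_le _ _
  linarith

lemma aux_sum_update (k m : ℕ) (b : Fin k) (f : (Fin k → Fin m) → ℝ≥0∞) :
    ∑ J : Fin k → Fin m, ∑ j, f (Function.update J b j) = m * ∑ J, f J := by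
  have hinv : Function.Involutive (fun p : (Fin k → Fin m) × Fin m =>
      (Function.update p.1 b p.2, p.1 b)) := by
    rintro ⟨J, j⟩
    simp
  have h1 : ∑ p : (Fin k → Fin m) × Fin m, f (Function.update p.1 b p.2) =
      ∑ p : (Fin k → Fin m) × Fin m, f p.1 :=
    Equiv.sum_comp hinv.toPerm (fun p : (Fin k → Fin m) × Fin m => f p.1)
  rw [Fintype.sum_prod_type, Fintype.sum_prod_type] at h1
  rw [h1]
  simp [Finset.mul_sum]

def auxTheta (n k m : ℕ) (e : Fin k × Fin m → Fin n) (a : ℝ) (J : Fin k → Fin m) : Fin n → ℝ :=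
  open Classical in fun i => if ∃ b, e (b, J b) = i then a else 0

lemma aux_theta_mem (n k m : ℕ) (e : Fin k × Fin m → Fin n) (a τ : ℝ) (ha : a ^ 2 ≤ τ ^ 2)
    (J : Fin k → Fin m) : auxTheta n k m e a J ∈ paramSet n k τ := by
  classical
  set I : Finset (Fin n) := Finset.univ.image (fun b => e (b, J b)) with hI
  have hIc : I.card ≤ k := by
    refine Finset.card_image_le.trans ?_
    simp
  have hmem : ∀ i, (∃ b, e (b, J b) = i) ↔ i ∈ I := by
    intro i; simp [hI]
  constructor
  · have : {i | auxTheta n k m e a J i ≠ 0} ⊆ (I : Set (Fin n)) := by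
      intro i hi
      by_contra h
      apply hi
      unfold auxTheta
      rw [if_neg]
      rw [hmem]
      exact h
    refine (Set.ncard_le_ncard this).trans ?_
    rw [Set.ncard_coe_finset]
    exact hIc
  · have h1 : ∀ i, (auxTheta n k m e a J i) ^ 2 = if i ∈ I then a ^ 2 else 0 := by
      intro i
      unfold auxTheta
      simp only [hmem]
      split_ifs <;> simp
    simp_rw [h1]
    rw [← Finset.sum_filter, Finset.sum_const, nsmul_eq_mul]
    have h2 : ((Finset.univ.filter (fun i => i ∈ I)).card : ℝ) ≤ k := by
      simp
      exact hIc
    exact mul_le_mul h2 ha (sq_nonneg _) (Nat.cast_nonneg _)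

lemma aux_theta_update (n k m : ℕ) (e : Fin k × Fin m → Fin n) (he : Function.Injective e) (a : ℝ)
    (J : Fin k → Fin m) (b : Fin k) : ∃ θ : Fin n → ℝ, (∀ j, θ (e (b, j)) = 0) ∧
      ∀ j, auxTheta n k m e a (Function.update J b j) = Function.update θ (e (b, j)) a := by
  classical
  refine ⟨fun i => if ∃ b', b' ≠ b ∧ e (b', J b') = i then a else 0, ?_, ?_⟩
  · intro j
    dsimp only
    rw [if_neg]
    rintro ⟨b', hb', h⟩
    have := he h
    simp at this
    exact hb' this.1
  · intro j
    ext i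
    unfold auxTheta
    by_cases hi : i = e (b, j)
    · subst hi
      rw [Function.update_self, if_pos ⟨b, by simp⟩]
    · rw [Function.update_of_ne hi]
      congr 1
      apply propext
      constructor
      · rintro ⟨b', h⟩
        have hb : b' ≠ b := by
          rintro rfl
          simp at h
          exact hi h.symm
        rw [Function.update_of_ne hb] at h
        exact ⟨b', hb, h⟩
      · rintro ⟨b', hb, h⟩
        exact ⟨b', by rw [Function.update_of_ne hb]; exact h⟩

lemma aux_lower (n k m : ℕ) (σ τ ν s : ℝ) (hm : 0 < m) (hkm : k * m ≤ n) (hσ : 0 < σ)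
    (hs : 13 ≤ s) (hνs : 20 * s ≤ ν)
    (he : Real.exp (s ^ 2 / 2) = ν)
    (hmν : Real.exp (ν ^ 2 / 2) ≤ 2 * m) (hτ : σ * ν ≤ τ)
    (est : (Fin n → ℝ) → Fin n → ℝ) (hest : Measurable est) :
    ENNReal.ofReal (k * σ ^ 2 * (ν ^ 2 - 2 * ν * s - 9 * ν)) ≤
      ⨆ θ ∈ paramSet n k τ, risk n σ est θ := by
  classical
  set M := ⨆ θ ∈ paramSet n k τ, risk n σ est θ with hM
  have hν : 260 ≤ ν := by linarith
  set x := ν - s - 1 with hx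
  have hx0 : 0 < x := by linarith
  set a := σ * x with ha
  have ha0 : 0 < a := by positivity
  have haτ : a ^ 2 ≤ τ ^ 2 := by
    apply pow_le_pow_left₀ ha0.le
    refine le_trans ?_ hτ
    rw [ha]
    gcongr
    linarith
  let e : Fin k × Fin m → Fin n := fun p => Fin.castLE hkm (finProdFinEquiv p)
  have heinj : Function.Injective e :=
    (Fin.castLE_injective hkm).comp finProdFinEquiv.injective
  set Cc : ℝ := ν ^ 2 - 2 * ν * s - 9 * ν with hCc
  have hm0 : (0 : ℝ) < m := by exact_mod_cast hm
  let D : (Fin k → Fin m) → Fin k → ℝ≥0∞ := fun J b =>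
    ∫⁻ y, ENNReal.ofReal (∑ j', (est y (e (b, j')) - auxTheta n k m e a J (e (b, j'))) ^ 2)
      ∂(gsm n (auxTheta n k m e a J) σ)
  have hcoord : ∀ j, Measurable (fun y => est y j) := fun j => (measurable_pi_apply j).comp hest
  have hrisk : ∀ J, ∑ b, D J b ≤ M := by
    intro J
    have h1 : risk n σ est (auxTheta n k m e a J) ≤ M :=
      le_iSup₂_of_le _ (aux_theta_mem n k m e a τ haτ J) le_rfl
    refine le_trans ?_ h1
    simp only [D, risk]
    rw [← lintegral_finsetSum]
    · apply lintegral_mono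
      intro y
      dsimp only
      rw [← ENNReal.ofReal_sum_of_nonneg (fun b _ => Finset.sum_nonneg (fun _ _ => sq_nonneg _))]
      apply ENNReal.ofReal_le_ofReal
      rw [← Fintype.sum_prod_type (f := fun p : Fin k × Fin m =>
        (est y (e p) - auxTheta n k m e a J (e p)) ^ 2)]
      rw [← Finset.sum_image (f := fun i => (est y i - auxTheta n k m e a J i) ^ 2)
        (s := Finset.univ) (g := e) (fun p _ q _ h => heinj h)]
      exact Finset.sum_le_sum_of_subset_of_nonneg (Finset.subset_univ _) (fun _ _ _ => sq_nonneg _)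
    · intro b _
      apply ENNReal.measurable_ofReal.comp
      apply Finset.measurable_sum
      intro j' _
      exact ((hcoord _).sub_const _).pow_const 2
  have hblock : ∀ J b, (m : ℝ≥0∞) * ENNReal.ofReal (σ ^ 2 * Cc) ≤
      ∑ j, D (Function.update J b j) b := by
    intro J b
    obtain ⟨θ, hθ0, hθ⟩ := aux_theta_update n k m e heinj a J b
    have hB : Real.exp ((a * (σ * (x + s)) - a ^ 2 / 2) / σ ^ 2) ≤ m * (4 / ν) := by
      have h1 : (a * (σ * (x + s)) - a ^ 2 / 2) / σ ^ 2 = ν ^ 2 / 2 + (-ν + (1 - s ^ 2) / 2) := by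
        rw [ha, hx]
        field_simp
        ring
      rw [h1, Real.exp_add]
      have h2 : Real.exp (-ν + (1 - s ^ 2) / 2) ≤ ν⁻¹ := by
        have : Real.exp (-ν + (1 - s ^ 2) / 2) ≤ Real.exp (-ν) := by
          apply Real.exp_le_exp.2; nlinarith
        refine this.trans ?_
        rw [Real.exp_neg]
        apply inv_anti₀ (by linarith)
        linarith [Real.add_one_le_exp ν]
      calc Real.exp (ν ^ 2 / 2) * Real.exp (-ν + (1 - s ^ 2) / 2) ≤ (2 * m) * ν⁻¹ := by
            gcongr
        _ ≤ m * (4 / ν) := by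
            rw [div_eq_mul_inv]
            have : 0 ≤ m * ν⁻¹ := by positivity
            linarith
    have h1 := aux_block n m θ σ hσ (fun j => e (b, j)) (fun j j' h => by
      have := heinj h
      simpa using this) hθ0 a (σ * (x + s)) (m * (4 / ν)) ha0.le hB est hest
    have h2 : ∀ j, D (Function.update J b j) b =
        ∫⁻ y, ENNReal.ofReal (∑ j', (est y (e (b, j')) - Function.update θ (e (b, j)) a (e (b, j'))) ^ 2)
      ∂(gsm n (Function.update θ (e (b, j)) a) σ) := by
      intro j
      simp only [D]
      rw [hθ j]
    simp_rw [← h2] at h1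
    have h3 : (m : ℝ≥0∞) * (ENNReal.ofReal (a ^ 2) * ENNReal.ofReal (1 - Real.exp (-s ^ 2 / 2))) ≤
        ∑ j, D (Function.update J b j) b + ENNReal.ofReal (a ^ 2 * (m * (4 / ν))) := by
      refine le_trans ?_ h1
      have : (m : ℝ≥0∞) * (ENNReal.ofReal (a ^ 2) * ENNReal.ofReal (1 - Real.exp (-s ^ 2 / 2))) =
          ∑ j : Fin m, ENNReal.ofReal (a ^ 2) * ENNReal.ofReal (1 - Real.exp (-s ^ 2 / 2)) := by simp
      rw [this]
      apply Finset.sum_le_sum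
      intro j _
      gcongr
      exact aux_prob n θ σ x s hσ (by linarith) (e (b, j))
    have hexp : Real.exp (-s ^ 2 / 2) = ν⁻¹ := by
      rw [← he, ← Real.exp_neg]; congr 1; ring
    have hinv : ν⁻¹ ≤ 1 := inv_le_one_of_one_le₀ (by linarith)
    have hc0 : 0 ≤ Cc := by nlinarith
    rw [hexp] at h3
    have hx2 : x ^ 2 ≤ ν ^ 2 := pow_le_pow_left₀ hx0.le (by linarith) 2
    have hfin : σ ^ 2 * Cc + a ^ 2 * (4 / ν) ≤ a ^ 2 * (1 - ν⁻¹) := by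
      have hh : Cc ≤ x ^ 2 * (1 - 5 * ν⁻¹) := by
        have h5 : x ^ 2 * ν⁻¹ ≤ ν := by
          calc x ^ 2 * ν⁻¹ ≤ ν ^ 2 * ν⁻¹ := by gcongr
            _ = ν := by field_simp
        rw [hCc]
        nlinarith
      have := mul_le_mul_of_nonneg_left hh (sq_nonneg σ)
      rw [ha, div_eq_mul_inv, mul_pow]
      nlinarith
    have h4 : (m : ℝ≥0∞) * ENNReal.ofReal (σ ^ 2 * Cc) + ENNReal.ofReal (a ^ 2 * (m * (4 / ν))) ≤
        ∑ j, D (Function.update J b j) b + ENNReal.ofReal (a ^ 2 * (m * (4 / ν))) := by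
      refine le_trans ?_ h3
      rw [← ENNReal.ofReal_natCast, ← ENNReal.ofReal_mul hm0.le, ← ENNReal.ofReal_mul (sq_nonneg a),
        ← ENNReal.ofReal_mul hm0.le, ← ENNReal.ofReal_add (by positivity) (by positivity)]
      apply ENNReal.ofReal_le_ofReal
      have := mul_le_mul_of_nonneg_left hfin hm0.le
      linarith
    exact (ENNReal.add_le_add_iff_right ENNReal.ofReal_ne_top).1 h4
  have hNe : (m : ℝ≥0∞) ≠ 0 := by exact_mod_cast hm.ne'
  have hNt : (m : ℝ≥0∞) ≠ ∞ := ENNReal.natCast_ne_top m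
  have hsumJ : ∀ b, (m : ℝ≥0∞) ^ k * ENNReal.ofReal (σ ^ 2 * Cc) ≤ ∑ J, D J b := by
    intro b
    have h1 := aux_sum_update k m b (fun J => D J b)
    have h2 : ∑ J : Fin k → Fin m, (m : ℝ≥0∞) * ENNReal.ofReal (σ ^ 2 * Cc) ≤
        ∑ J : Fin k → Fin m, ∑ j, D (Function.update J b j) b :=
      Finset.sum_le_sum (fun J _ => hblock J b)
    rw [h1] at h2
    have h3 : ∑ J : Fin k → Fin m, (m : ℝ≥0∞) * ENNReal.ofReal (σ ^ 2 * Cc) =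
        m * ((m : ℝ≥0∞) ^ k * ENNReal.ofReal (σ ^ 2 * Cc)) := by
      simp
      ring
    rw [h3] at h2
    exact (ENNReal.mul_le_mul_iff_right hNe hNt).1 h2
  have htot : (m : ℝ≥0∞) ^ k * (k * ENNReal.ofReal (σ ^ 2 * Cc)) ≤ (m : ℝ≥0∞) ^ k * M := by
    calc (m : ℝ≥0∞) ^ k * (k * ENNReal.ofReal (σ ^ 2 * Cc))
        = ∑ b : Fin k, (m : ℝ≥0∞) ^ k * ENNReal.ofReal (σ ^ 2 * Cc) := by simp; ring
      _ ≤ ∑ b, ∑ J, D J b := Finset.sum_le_sum (fun b _ => hsumJ b)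
      _ = ∑ J, ∑ b, D J b := Finset.sum_comm
      _ ≤ ∑ J : Fin k → Fin m, M := Finset.sum_le_sum (fun J _ => hrisk J)
      _ = (m : ℝ≥0∞) ^ k * M := by simp
  have h := (ENNReal.mul_le_mul_iff_right (pow_ne_zero k hNe) (ENNReal.pow_ne_top hNt)).1 htot
  refine le_trans (le_of_eq ?_) h
  rw [mul_assoc, ENNReal.ofReal_mul (Nat.cast_nonneg k), ENNReal.ofReal_natCast]

lemma aux_hardEst_meas (n : ℕ) (lam : ℝ) : Measurable (hardEst n lam) := by
  unfold hardEst
  apply measurable_pi_lambda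
  intro i
  exact Measurable.ite (measurableSet_lt measurable_const (by fun_prop)) (by fun_prop) measurable_const

lemma aux_squeeze (X : ℕ → ℝ≥0∞) (A ν s : ℕ → ℝ)
    (hA : ∀ᶠ n in atTop, 0 < A n) (hs : Tendsto s atTop atTop)
    (hνs : ∀ᶠ n in atTop, 20 * s n ≤ ν n)
    (hl : ∀ᶠ n in atTop, ENNReal.ofReal (A n * (ν n ^ 2 - 2 * ν n * s n - 9 * ν n)) ≤ X n)
    (hu : ∀ᶠ n in atTop, X n ≤ ENNReal.ofReal (A n * (ν n ^ 2 - 2 * ν n * s n + 9 * ν n))) :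
    ∃ c : ℕ → ℝ, Tendsto c atTop (𝓝 1) ∧
      ∀ᶠ n in atTop, X n = ENNReal.ofReal (A n * (ν n ^ 2 - 2 * ν n * s n * c n)) := by
  refine ⟨fun n => (A n * ν n ^ 2 - (X n).toReal) / (A n * (2 * ν n * s n)), ?_, ?_⟩
  · have ht : Tendsto (fun n => 9 / 2 * (s n)⁻¹) atTop (𝓝 0) := by
      simpa using (tendsto_inv_atTop_zero.comp hs).const_mul (9 / 2 : ℝ)
    have hlo : Tendsto (fun n => 1 - 9 / 2 * (s n)⁻¹) atTop (𝓝 1) := by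
      simpa using ht.const_sub 1
    have hhi : Tendsto (fun n => 1 + 9 / 2 * (s n)⁻¹) atTop (𝓝 1) := by
      simpa using ht.const_add 1
    have key : ∀ᶠ n in atTop,
        1 - 9 / 2 * (s n)⁻¹ ≤ (A n * ν n ^ 2 - (X n).toReal) / (A n * (2 * ν n * s n)) ∧
        (A n * ν n ^ 2 - (X n).toReal) / (A n * (2 * ν n * s n)) ≤ 1 + 9 / 2 * (s n)⁻¹ := by
      filter_upwards [hA, hs.eventually_ge_atTop 13, hνs, hl, hu] with n h1 h2 h3 h4 h5
      have hν : 0 < ν n := by linarith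
      have hs0 : 0 < s n := by linarith
      have hXt : X n ≠ ∞ := ne_top_of_le_ne_top ENNReal.ofReal_ne_top h5
      have h6 : A n * (ν n ^ 2 - 2 * ν n * s n - 9 * ν n) ≤ (X n).toReal :=
        (ENNReal.ofReal_le_iff_le_toReal hXt).1 h4
      have h7 : (X n).toReal ≤ A n * (ν n ^ 2 - 2 * ν n * s n + 9 * ν n) := by
        apply ENNReal.toReal_le_of_le_ofReal _ h5
        apply mul_nonneg h1.le
        nlinarith
      have hD : 0 < A n * (2 * ν n * s n) := by positivity
      rw [le_div_iff₀ hD, div_le_iff₀ hD]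
      have e1 : (1 - 9 / 2 * (s n)⁻¹) * (A n * (2 * ν n * s n)) =
          A n * (2 * ν n * s n - 9 * ν n) := by field_simp
      have e2 : (1 + 9 / 2 * (s n)⁻¹) * (A n * (2 * ν n * s n)) =
          A n * (2 * ν n * s n + 9 * ν n) := by field_simp
      rw [e1, e2]
      constructor <;> linarith
    exact tendsto_of_tendsto_of_tendsto_of_le_of_le' hlo hhi (key.mono fun _ h => h.1)
      (key.mono fun _ h => h.2)
  · filter_upwards [hA, hs.eventually_ge_atTop 13, hνs, hu] with n h1 h2 h3 h5
    have hν : 0 < ν n := by linarith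
    have hs0 : 0 < s n := by linarith
    have hXt : X n ≠ ∞ := ne_top_of_le_ne_top ENNReal.ofReal_ne_top h5
    have : A n * (ν n ^ 2 - 2 * ν n * s n *
        ((A n * ν n ^ 2 - (X n).toReal) / (A n * (2 * ν n * s n)))) = (X n).toReal := by
      field_simp
      ring
    rw [this, ENNReal.ofReal_toReal hXt]

/-- Theorem `thm::regime_4`, Regime III. -/
theorem statement8
    (k : ℕ → ℕ) (τ σ ε μ ν : ℕ → ℝ)
    (hk : ∀ n, 1 ≤ n → 1 ≤ k n ∧ k n ≤ n)
    (hτ : ∀ n, 0 < τ n) (hσ : ∀ n, 0 < σ n)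
    (hε : ∀ n, ε n = (k n : ℝ) / n) (hμ : ∀ n, μ n = τ n / σ n)
    (hν : ∀ n, ν n = Real.sqrt (2 * Real.log (ε n)⁻¹))
    (hε0 : Tendsto ε atTop (𝓝 0))
    (hμω : Tendsto (fun n => Real.sqrt (Real.log (ε n)⁻¹) / μ n) atTop (𝓝 0)) :
    (∃ c : ℕ → ℝ, Tendsto c atTop (𝓝 1) ∧
      ∀ᶠ n : ℕ in atTop,
        minimaxRisk n (σ n) (paramSet n (k n) (τ n)) =
          ENNReal.ofReal ((n : ℝ) * σ n ^ 2 *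
            (2 * ε n * Real.log (ε n)⁻¹ -
              2 * ε n * ν n * Real.sqrt (2 * Real.log (ν n)) * c n))) ∧
    (∃ c : ℕ → ℝ, Tendsto c atTop (𝓝 1) ∧
      ∀ᶠ n : ℕ in atTop,
        (⨆ θ ∈ paramSet n (k n) (τ n),
            risk n (σ n) (hardEst n (σ n * Real.sqrt (2 * Real.log (ε n)⁻¹))) θ) =
          ENNReal.ofReal ((n : ℝ) * σ n ^ 2 *
            (2 * ε n * Real.log (ε n)⁻¹ -
              2 * ε n * ν n * Real.sqrt (2 * Real.log (ν n)) * c n))) := by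
  set s : ℕ → ℝ := fun n => Real.sqrt (2 * Real.log (ν n)) with hsdef
  have hεpos : ∀ᶠ n in atTop, 0 < ε n := by
    filter_upwards [eventually_ge_atTop 1] with n hn
    rw [hε]
    have h1 : 0 < k n := (hk n hn).1
    have h2 : 0 < n := hn
    positivity
  have hlog : Tendsto (fun n => Real.log (ε n)⁻¹) atTop atTop := by
    apply Real.tendsto_log_atTop.comp
    apply tendsto_inv_nhdsGT_zero.comp
    rw [tendsto_nhdsWithin_iff]
    exact ⟨hε0, hεpos⟩
  have hνt : Tendsto ν atTop atTop := by
    rw [show ν = fun n => Real.sqrt (2 * Real.log (ε n)⁻¹) from funext hν]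
    exact Real.tendsto_sqrt_atTop.comp (hlog.const_mul_atTop (by norm_num))
  have hst : Tendsto s atTop atTop :=
    Real.tendsto_sqrt_atTop.comp ((Real.tendsto_log_atTop.comp hνt).const_mul_atTop (by norm_num))
  have hsq : ∀ᶠ n in atTop, s n ^ 2 = 2 * Real.log (ν n) := by
    filter_upwards [hνt.eventually_ge_atTop 1] with n hn
    exact Real.sq_sqrt (mul_nonneg (by norm_num) (Real.log_nonneg hn))
  have hs2 : ∀ᶠ n in atTop, s n ^ 2 ≤ 2 * ν n := by
    filter_upwards [hsq, hνt.eventually_ge_atTop 1] with n h1 h2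
    rw [h1]
    linarith [Real.log_le_self (show 0 ≤ ν n by linarith)]
  have hνs : ∀ᶠ n in atTop, 20 * s n ≤ ν n := by
    filter_upwards [hs2, hνt.eventually_ge_atTop 800] with n h1 h2
    apply abs_le_of_sq_le_sq' _ (by linarith) |>.2
    nlinarith
  have hes : ∀ᶠ n in atTop, Real.exp (s n ^ 2 / 2) = ν n := by
    filter_upwards [hsq, hνt.eventually_ge_atTop 1] with n h1 h2
    rw [h1, mul_div_cancel_left₀ _ (by norm_num), Real.exp_log (by linarith)]
  have hν2 : ∀ᶠ n in atTop, ν n ^ 2 = 2 * Real.log (ε n)⁻¹ := by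
    filter_upwards [hlog.eventually_ge_atTop 0] with n hn
    rw [hν]
    exact Real.sq_sqrt (by linarith)
  have hnk : ∀ᶠ n : ℕ in atTop, (n : ℝ) * Real.exp (-ν n ^ 2 / 2) = k n := by
    filter_upwards [hν2, hεpos, eventually_ge_atTop 1] with n h1 h2 h3
    have : -ν n ^ 2 / 2 = Real.log (ε n) := by
      rw [neg_div, h1, Real.log_inv]; ring
    rw [this, Real.exp_log h2, hε]
    have : (n : ℝ) ≠ 0 := by positivity
    field_simp
  have hτν : ∀ᶠ n in atTop, σ n * ν n ≤ τ n := by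
    filter_upwards [hμω.eventually (gt_mem_nhds (show (0:ℝ) < 1 / 2 by norm_num)),
      hlog.eventually_ge_atTop 0] with n h1 h2
    have hμ0 : 0 < μ n := by rw [hμ]; exact div_pos (hτ n) (hσ n)
    rw [div_lt_iff₀ hμ0] at h1
    have h3 : ν n ≤ 2 * Real.sqrt (Real.log (ε n)⁻¹) := by
      rw [hν, show (2 : ℝ) * Real.sqrt (Real.log (ε n)⁻¹) = Real.sqrt (4 * Real.log (ε n)⁻¹) by
        rw [Real.sqrt_mul (by norm_num), show (4 : ℝ) = 2 ^ 2 by norm_num, Real.sqrt_sq (by norm_num)]]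
      apply Real.sqrt_le_sqrt
      linarith
    have h4 : ν n ≤ τ n / σ n := by rw [← hμ]; linarith
    rw [le_div_iff₀ (hσ n)] at h4
    linarith
  have hU : ∀ᶠ n in atTop, (⨆ θ ∈ paramSet n (k n) (τ n),
      risk n (σ n) (hardEst n (σ n * Real.sqrt (2 * Real.log (ε n)⁻¹))) θ) ≤
      ENNReal.ofReal (k n * σ n ^ 2 * (ν n ^ 2 - 2 * ν n * s n + 9 * ν n)) := by
    filter_upwards [hst.eventually_ge_atTop 13, hνs, hs2, hes, hnk] with n h1 h2 h3 h4 h5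
    apply iSup₂_le
    intro θ hθ
    rw [← hν]
    exact aux_hard_upper n (k n) (σ n) (τ n) (ν n) (s n) (hσ n) h1 h2 h3 h4 h5 θ hθ
  have hL : ∀ᶠ n in atTop, ENNReal.ofReal (k n * σ n ^ 2 * (ν n ^ 2 - 2 * ν n * s n - 9 * ν n)) ≤
      minimaxRisk n (σ n) (paramSet n (k n) (τ n)) := by
    filter_upwards [hst.eventually_ge_atTop 13, hνs, hes, hnk, hτν, eventually_ge_atTop 1]
      with n h1 h2 h4 h5 h6 h7
    obtain ⟨hk1, hk2⟩ := hk n h7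
    apply le_iInf₂
    intro est hest
    have hm : 0 < n / k n := Nat.div_pos hk2 hk1
    refine aux_lower n (k n) (n / k n) (σ n) (τ n) (ν n) (s n) hm (Nat.mul_div_le n (k n)) (hσ n)
      h1 h2 h4 ?_ h6 est hest
    have hlt : n < k n * (n / k n + 1) := Nat.lt_mul_div_succ n hk1
    have hle : n ≤ k n * (2 * (n / k n)) := hlt.le.trans (Nat.mul_le_mul_left _ (by omega))
    have hle' : (n : ℝ) ≤ k n * (2 * ((n / k n : ℕ) : ℝ)) := by exact_mod_cast hle
    have hkpos : (0 : ℝ) < k n := by exact_mod_cast hk1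
    have hexp : (n : ℝ) = k n * Real.exp (ν n ^ 2 / 2) := by
      rw [← h5, mul_assoc, ← Real.exp_add]
      have : -ν n ^ 2 / 2 + ν n ^ 2 / 2 = 0 := by ring
      rw [this]; simp
    rw [hexp] at hle'
    exact le_of_mul_le_mul_left hle' hkpos
  have hLU : ∀ n, minimaxRisk n (σ n) (paramSet n (k n) (τ n)) ≤
      ⨆ θ ∈ paramSet n (k n) (τ n),
      risk n (σ n) (hardEst n (σ n * Real.sqrt (2 * Real.log (ε n)⁻¹))) θ :=
    fun n => iInf₂_le _ (aux_hardEst_meas n _)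
  have hA : ∀ᶠ n in atTop, 0 < (k n : ℝ) * σ n ^ 2 := by
    filter_upwards [eventually_ge_atTop 1] with n hn
    have h1 : 0 < k n := (hk n hn).1
    have := hσ n
    positivity
  have hform : ∀ c : ℕ → ℝ, ∀ᶠ n : ℕ in atTop,
      (k n : ℝ) * σ n ^ 2 * (ν n ^ 2 - 2 * ν n * s n * c n) = (n : ℝ) * σ n ^ 2 *
            (2 * ε n * Real.log (ε n)⁻¹ -
              2 * ε n * ν n * Real.sqrt (2 * Real.log (ν n)) * c n) := by
    intro c
    filter_upwards [hν2, eventually_ge_atTop 1] with n h1 h2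
    have hn : (n : ℝ) ≠ 0 := by positivity
    have h3 : (k n : ℝ) = n * ε n := by rw [hε]; field_simp
    rw [h3, h1]
    ring
  constructor
  · obtain ⟨c, hc, h⟩ := aux_squeeze _ _ ν s hA hst hνs hL
      (hU.mono fun n h => (hLU n).trans h)
    refine ⟨c, hc, ?_⟩
    filter_upwards [h, hform c] with n h1 h2
    rw [h1, h2]
  · obtain ⟨c, hc, h⟩ := aux_squeeze _ _ ν s hA hst hνs (hL.mono fun n h => h.trans (hLU n)) hU
    refine ⟨c, hc, ?_⟩
    filter_upwards [h, hform c] with n h1 h2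
    rw [h1, h2]
end
end

section
/- Consider the Gaussian sequence model with noise level σₙ and the SNR-aware parameter space Θ(kₙ, τₙ). Suppose εₙ = kₙ/n → 0 and μₙ = τₙ/σₙ = ω(√(log εₙ⁻¹)) as n → ∞, and set νₙ = √(2 log εₙ⁻¹). Then the optimally tuned soft thresholding estimator has supremum risk: inf over λ ≥ 0 of sup over θ ∈ Θ(kₙ,τₙ) of E_θ‖η̂_S(y,λ) − θ‖₂² = n σₙ² ( 2 εₙ log εₙ⁻¹ − 6 εₙ log νₙ (1+o(1)) ). -/
open MeasureTheory ProbabilityTheory Filter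
open scoped ENNReal NNReal Topology

noncomputable section

/-- Soft thresholding estimator `[η̂_S(y,λ)]ᵢ = sign(yᵢ)(|yᵢ|−λ)₊`. -/
def softEst (n : ℕ) (lam : ℝ) : (Fin n → ℝ) → Fin n → ℝ :=
  fun y i => Real.sign (y i) * max (|y i| - lam) 0


def sft (l y : ℝ) : ℝ := Real.sign y * max (|y| - l) 0

lemma sft_of_nonneg {l y : ℝ} (hl : 0 ≤ l) (hy : 0 ≤ y) : sft l y = max (y - l) 0 := by
  unfold sft
  rcases hy.eq_or_lt with rfl | h
  · simp [hl]
  · rw [Real.sign_of_pos h, abs_of_pos h, one_mul]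

lemma sft_of_neg {l y : ℝ} (hy : y < 0) : sft l y = - max (-y - l) 0 := by
  unfold sft
  rw [Real.sign_of_neg hy, abs_of_neg hy]; ring

lemma sft_measurable (l : ℝ) : Measurable (sft l) := by
  have h : Measurable (Real.sign) := by
    unfold Real.sign
    exact Measurable.ite measurableSet_Iio measurable_const
      (Measurable.ite measurableSet_Ioi measurable_const measurable_const)
  unfold sft
  fun_prop

lemma sft_scale {s l y : ℝ} (hs : 0 < s) : sft (s * l) (s * y) = s * sft l y := by
  unfold sft
  have h1 : Real.sign (s * y) = Real.sign y := by
    rcases lt_trichotomy y 0 with h | rfl | h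
    · rw [Real.sign_of_neg h, Real.sign_of_neg (mul_neg_of_pos_of_neg hs h)]
    · simp
    · rw [Real.sign_of_pos h, Real.sign_of_pos (mul_pos hs h)]
  have h2 : max (s * |y| - s * l) 0 = s * max (|y| - l) 0 := by
    rw [mul_max_of_nonneg _ _ hs.le, mul_zero, mul_sub]
  rw [h1, abs_mul, abs_of_pos hs, h2]
  ring

/-- clip -/
def clp (l y : ℝ) : ℝ := max (-l) (min y l)

lemma sft_eq_clp {l y : ℝ} (hl : 0 ≤ l) : sft l y = y - clp l y := by
  unfold clp
  rcases le_or_gt 0 y with h | h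
  · rw [sft_of_nonneg hl h]
    rcases le_total y l with h1 | h1
    · rw [min_eq_left h1, max_eq_right (by linarith), max_eq_right (by linarith)]; ring
    · rw [min_eq_right h1, max_eq_left (by linarith), max_eq_right (by linarith)]
  · rw [sft_of_neg h, min_eq_left (by linarith)]
    rcases le_total (-y) l with h1 | h1
    · rw [max_eq_right (by linarith), max_eq_right (by linarith)]; ring
    · rw [max_eq_left (by linarith), max_eq_left (by linarith)]; ring

lemma clp_mono (l : ℝ) : Monotone (clp l) := by
  intro a b h
  unfold clp
  gcongr

lemma clp_sq {l : ℝ} (hl : 0 ≤ l) (y : ℝ) : clp l y ^ 2 ≤ l ^ 2 := by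
  apply sq_le_sq'
  · exact le_max_left _ _
  · exact max_le (by linarith) (min_le_right _ _)

lemma upper_pt {l : ℝ} (hl : 0 ≤ l) (m z : ℝ) :
    (sft l (m + z) - m) ^ 2 ≤ z ^ 2 - 2 * clp l m * z + l ^ 2 := by
  rw [sft_eq_clp hl]
  have h1 := clp_sq hl (m + z)
  have h2 : 0 ≤ z * (clp l (m + z) - clp l m) := by
    rcases le_total 0 z with h | h
    · exact mul_nonneg h (sub_nonneg.2 (clp_mono l (by linarith)))
    · exact mul_nonneg_of_nonpos_of_nonpos h (sub_nonpos.2 (clp_mono l (by linarith)))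
  nlinarith

lemma lower_pt {L l m : ℝ} (hL : 0 ≤ L) (hl : L ≤ l) (hm : 2 * L ≤ m) (hm0 : 0 < m) (z : ℝ) :
    L ^ 2 - 2 * L * z - L / m * z ^ 2 ≤ (sft l (m + z) - m) ^ 2 := by
  have hx : sft l (m + z) - m ≤ z - L + z ^ 2 / (2 * m) := by
    have h0 : sft l (m + z) ≤ max (m + z - L) 0 := by
      rcases le_or_gt 0 (m + z) with h | h
      · rw [sft_of_nonneg (hL.trans hl) h]; gcongr
      · rw [sft_of_neg h]
        have := le_max_right (-(m + z) - l) 0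
        have := le_max_right ((m + z) - L) 0
        linarith
    have hq : 0 ≤ z ^ 2 / (2 * m) := by positivity
    have h3 : -z - m / 2 ≤ z ^ 2 / (2 * m) := by
      rw [le_div_iff₀ (by positivity)]
      nlinarith [sq_nonneg (z + m)]
    have h4 : max (m + z - L) 0 ≤ m + z - L + z ^ 2 / (2 * m) := max_le (by linarith) (by linarith)
    linarith
  have h5 : L / m * z ^ 2 = 2 * L * (z ^ 2 / (2 * m)) := by field_simp
  rw [h5]
  nlinarith [sq_nonneg (sft l (m + z) - m + L), mul_le_mul_of_nonneg_left hx hL]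

abbrev γ₁ : Measure ℝ := gaussianReal 0 1

def rho (l m : ℝ) : ℝ≥0∞ := ∫⁻ z, ENNReal.ofReal ((sft l (m + z) - m) ^ 2) ∂γ₁

lemma g_int1 : Integrable (fun z : ℝ => z) γ₁ :=
  (memLp_id_gaussianReal 1).integrable (by simp)

lemma g_int2 : Integrable (fun z : ℝ => z ^ 2) γ₁ :=
  (memLp_id_gaussianReal 2).integrable_sq

lemma g_sq : ∫ z, z ^ 2 ∂γ₁ = 1 := by
  have h := variance_eq_sub (memLp_id_gaussianReal (μ := 0) (v := 1) 2)
  rw [variance_id_gaussianReal] at h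
  simpa using h.symm

lemma ofReal_int_le {f : ℝ → ℝ} (hf : Integrable f γ₁) :
    ENNReal.ofReal (∫ x, f x ∂γ₁) ≤ ∫⁻ x, ENNReal.ofReal (f x) ∂γ₁ := by
  rw [integral_eq_lintegral_pos_part_sub_lintegral_neg_part hf]
  refine (ENNReal.ofReal_le_ofReal (sub_le_self _ ENNReal.toReal_nonneg)).trans ?_
  exact ENNReal.ofReal_toReal_le

lemma quad_int (a b c : ℝ) : Integrable (fun z : ℝ => a * z ^ 2 + b * z + c) γ₁ :=
  ((g_int2.const_mul a).add (g_int1.const_mul b)).add (integrable_const c)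

lemma quad_integral (a b c : ℝ) : ∫ z : ℝ, a * z ^ 2 + b * z + c ∂γ₁ = a + c := by
  have h : Integrable (fun z : ℝ => a * z ^ 2 + b * z) γ₁ :=
    (g_int2.const_mul a).add (g_int1.const_mul b)
  rw [integral_add h (integrable_const c), integral_add (g_int2.const_mul a) (g_int1.const_mul b), integral_const_mul, integral_const_mul,
    g_sq, integral_id_gaussianReal]
  simp

lemma rho_upper {l : ℝ} (hl : 0 ≤ l) (m : ℝ) : rho l m ≤ ENNReal.ofReal (1 + l ^ 2) := by
  unfold rho
  rw [← quad_integral 1 (-2 * clp l m) (l ^ 2),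
    ofReal_integral_eq_lintegral_ofReal (quad_int _ _ _)]
  · refine lintegral_mono fun z => ENNReal.ofReal_le_ofReal ((upper_pt hl m z).trans (le_of_eq ?_))
    ring
  · refine Eventually.of_forall fun z => ?_
    have := (sq_nonneg _).trans (upper_pt hl m z)
    simp only [Pi.zero_apply]
    linarith

lemma rho_lower {L l m : ℝ} (hL : 0 ≤ L) (hl : L ≤ l) (hm : 2 * L ≤ m) (hm0 : 0 < m) :
    ENNReal.ofReal (L ^ 2 - 1 / 2) ≤ rho l m := by
  have h : L ^ 2 - 1 / 2 ≤ ∫ z : ℝ, (- (L / m)) * z ^ 2 + (- 2 * L) * z + L ^ 2 ∂γ₁ := by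
    rw [quad_integral]
    have : L / m ≤ 1 / 2 := by rw [div_le_div_iff₀ hm0 (by norm_num)]; linarith
    linarith
  refine (ENNReal.ofReal_le_ofReal h).trans ((ofReal_int_le (quad_int _ _ _)).trans ?_)
  refine lintegral_mono fun z => ENNReal.ofReal_le_ofReal (le_trans (le_of_eq ?_) (lower_pt hL hl hm hm0 z))
  ring

lemma gauss_lint {f : ℝ → ℝ≥0∞} (hf : Measurable f) :
    ∫⁻ z, f z ∂γ₁ = ∫⁻ z, gaussianPDF 0 1 z * f z := by
  rw [γ₁, gaussianReal_of_var_ne_zero 0 one_ne_zero,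
    lintegral_withDensity_eq_lintegral_mul _ (measurable_gaussianPDF 0 1) hf]
  rfl

lemma pdf_eq (z : ℝ) : gaussianPDF 0 1 z = ENNReal.ofReal ((√(2 * Real.pi))⁻¹ * Real.exp (- z ^ 2 / 2)) := by
  simp [gaussianPDF, gaussianPDFReal]

lemma sqrt2pi : 1 ≤ √(2 * Real.pi) := by
  rw [Real.one_le_sqrt]; linarith [Real.pi_gt_three]

lemma half_upper {l : ℝ} (hl : 0 < l) :
    ∫⁻ z, ENNReal.ofReal ((max (z - l) 0) ^ 2) ∂γ₁ ≤
      ENNReal.ofReal (16 * Real.exp (- l ^ 2 / 2) / l ^ 3) := by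
  rw [gauss_lint (by fun_prop)]
  have key : ∀ z, gaussianPDF 0 1 z * ENNReal.ofReal ((max (z - l) 0) ^ 2) ≤
      (Set.Ioi l).indicator (fun z => ENNReal.ofReal (8 / l ^ 2 * Real.exp (-(l/2) * z))) z := by
    intro z
    by_cases hz : z ∈ Set.Ioi l
    · rw [Set.indicator_of_mem hz, pdf_eq, ← ENNReal.ofReal_mul (by positivity)]
      apply ENNReal.ofReal_le_ofReal
      have hz' : l < z := hz
      rw [max_eq_left (by linarith)]
      have h1 : (√(2 * Real.pi))⁻¹ ≤ 1 := inv_le_one_of_one_le₀ sqrt2pi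
      have h2 := Real.quadratic_le_exp_of_nonneg (x := l / 2 * (z - l)) (by
        have : 0 < z - l := by linarith
        positivity)
      have h3 : (z - l) ^ 2 ≤ 8 / l ^ 2 * Real.exp (l / 2 * (z - l)) := by
        rw [div_mul_eq_mul_div, le_div_iff₀ (by positivity)]
        have : 0 ≤ l / 2 * (z - l) := mul_nonneg (by positivity) (by linarith)
        nlinarith
      have h4 : Real.exp (-z ^ 2 / 2) * Real.exp (l / 2 * (z - l)) ≤ Real.exp (-(l/2) * z) := by
        rw [← Real.exp_add]
        apply Real.exp_le_exp.2
        nlinarith [sq_nonneg (z - l)]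
      calc (√(2 * Real.pi))⁻¹ * Real.exp (-z ^ 2 / 2) * (z - l) ^ 2
          ≤ 1 * Real.exp (-z ^ 2 / 2) * (8 / l ^ 2 * Real.exp (l / 2 * (z - l))) := by gcongr
        _ = 8 / l ^ 2 * (Real.exp (-z ^ 2 / 2) * Real.exp (l / 2 * (z - l))) := by ring
        _ ≤ _ := by gcongr
    · rw [Set.indicator_of_notMem hz]
      have hz' : z ≤ l := not_lt.1 hz
      rw [max_eq_right (by linarith)]; simp
  refine (lintegral_mono key).trans ?_
  rw [lintegral_indicator measurableSet_Ioi, ← ofReal_integral_eq_lintegral_ofReal]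
  · apply ENNReal.ofReal_le_ofReal
    rw [integral_const_mul, integral_exp_mul_Ioi (by linarith)]
    apply le_of_eq
    have : -(l/2) * l = - l ^ 2 / 2 := by ring
    rw [this]; field_simp; norm_num
  · exact (integrableOn_exp_mul_Ioi (by linarith) l).const_mul _
  · exact Eventually.of_forall fun z => by simp only [Pi.zero_apply]; positivity

lemma rho_zero_upper {l : ℝ} (hl : 0 < l) :
    rho l 0 ≤ ENNReal.ofReal (32 * Real.exp (- l ^ 2 / 2) / l ^ 3) := by
  have h1 := half_upper hl
  have h2 : ∫⁻ z, ENNReal.ofReal ((max (-z - l) 0) ^ 2) ∂γ₁ =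
      ∫⁻ z, ENNReal.ofReal ((max (z - l) 0) ^ 2) ∂γ₁ := by
    have h : (γ₁).map (fun x => -x) = γ₁ := by
      have := gaussianReal_map_neg (μ := 0) (v := 1)
      rwa [neg_zero] at this
    conv_rhs => rw [← h]
    rw [lintegral_map (by fun_prop) (by fun_prop)]
  have h3 : rho l 0 ≤ ∫⁻ z, (ENNReal.ofReal ((max (z - l) 0) ^ 2) +
      ENNReal.ofReal ((max (-z - l) 0) ^ 2)) ∂γ₁ := by
    refine lintegral_mono fun z => ?_
    simp only [zero_add, sub_zero]
    rcases le_or_gt 0 z with h | h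
    · rw [sft_of_nonneg hl.le h]; exact le_self_add
    · rw [sft_of_neg h, neg_sq]; exact le_add_self
  rw [lintegral_add_left (by fun_prop), h2] at h3
  refine h3.trans ((add_le_add h1 h1).trans (le_of_eq ?_))
  rw [← ENNReal.ofReal_add (by positivity) (by positivity)]
  congr 1; ring

def c0 : ℝ := (√(2 * Real.pi))⁻¹ * Real.exp (-4)

lemma c0_pos : 0 < c0 := by unfold c0; positivity

lemma rho_zero_lower {l : ℝ} (hl : 0 ≤ l) :
    ENNReal.ofReal (c0 * Real.exp (- l ^ 2 / 2) / (1 + l) ^ 3) ≤ rho l 0 := by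
  unfold rho
  have hm := sft_measurable l
  rw [gauss_lint (by fun_prop)]
  set a := 1 / (1 + l) with ha
  have ha0 : 0 < a := by positivity
  have ha1 : a ≤ 1 := by rw [ha, div_le_one (by positivity)]; linarith
  have hal : a * l ≤ 1 := by rw [ha, div_mul_eq_mul_div, div_le_one (by positivity)]; linarith
  have key : ∀ z, (Set.Icc (l + a) (l + 2 * a)).indicator
      (fun _ => ENNReal.ofReal (c0 * Real.exp (- l ^ 2 / 2) * a ^ 2)) z ≤
      gaussianPDF 0 1 z * ENNReal.ofReal ((sft l (0 + z) - 0) ^ 2) := by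
    intro z
    by_cases hz : z ∈ Set.Icc (l + a) (l + 2 * a)
    · rw [Set.indicator_of_mem hz, pdf_eq, ← ENNReal.ofReal_mul (by positivity)]
      apply ENNReal.ofReal_le_ofReal
      obtain ⟨hz1, hz2⟩ := hz
      rw [zero_add, sub_zero, sft_of_nonneg hl (by linarith), max_eq_left (by linarith)]
      have h1 : Real.exp (-4) * Real.exp (-l ^ 2 / 2) ≤ Real.exp (- z ^ 2 / 2) := by
        rw [← Real.exp_add]
        apply Real.exp_le_exp.2
        have : z ^ 2 ≤ (l + 2 * a) ^ 2 := by apply pow_le_pow_left₀ (by linarith) hz2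
        nlinarith
      have h2 : a ^ 2 ≤ (z - l) ^ 2 := pow_le_pow_left₀ ha0.le (by linarith) 2
      calc c0 * Real.exp (- l ^ 2 / 2) * a ^ 2
          = (√(2 * Real.pi))⁻¹ * (Real.exp (-4) * Real.exp (-l ^ 2 / 2)) * a ^ 2 := by unfold c0; ring
        _ ≤ _ := by gcongr
    · rw [Set.indicator_of_notMem hz]; exact zero_le
  refine le_trans (le_of_eq ?_) (lintegral_mono key)
  rw [lintegral_indicator measurableSet_Icc, setLIntegral_const, Real.volume_Icc,
    ← ENNReal.ofReal_mul (by have := c0_pos; positivity)]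
  congr 1
  rw [ha]; field_simp; ring

lemma risk_eq (n : ℕ) {s : ℝ} (hs : 0 < s) (l : ℝ) (θ : Fin n → ℝ) :
    risk n s (softEst n (s * l)) θ = ENNReal.ofReal (s ^ 2) * ∑ i, rho l (θ i / s) := by
  unfold risk gsm
  have hm := sft_measurable (s * l)
  have hm' := sft_measurable l
  have h1 : ∀ y : Fin n → ℝ, ENNReal.ofReal (∑ i, (softEst n (s * l) y i - θ i) ^ 2) =
      ∑ i, ENNReal.ofReal ((sft (s * l) (y i) - θ i) ^ 2) := fun y =>
    ENNReal.ofReal_sum_of_nonneg fun i _ => sq_nonneg _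
  simp_rw [h1]
  rw [lintegral_finsetSum _ (fun i _ => by fun_prop), Finset.mul_sum]
  refine Finset.sum_congr rfl fun i _ => ?_
  have h2 := (measurePreserving_eval (fun i => gaussianReal (θ i) ((s ^ 2).toNNReal)) i).lintegral_comp
    (f := fun x => ENNReal.ofReal ((sft (s * l) x - θ i) ^ 2)) (by fun_prop)
  simp only [Function.eval] at h2
  rw [h2]
  have h3 : gaussianReal (θ i) ((s ^ 2).toNNReal) = (γ₁).map (fun z => θ i + s * z) := by
    have e : (fun z : ℝ => θ i + s * z) = (fun x => θ i + x) ∘ (fun z => s * z) := rfl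
    rw [e, ← Measure.map_map (by fun_prop) (by fun_prop), gaussianReal_map_const_mul,
      gaussianReal_map_const_add]
    congr 1
    · simp
    · ext; simp [sq_nonneg]
  rw [h3, lintegral_map (by fun_prop) (by fun_prop)]
  unfold rho
  rw [← lintegral_const_mul _ (by fun_prop)]
  refine lintegral_congr fun z => ?_
  rw [← ENNReal.ofReal_mul (by positivity)]
  have h4 : θ i + s * z = s * (θ i / s + z) := by field_simp
  have h5 : θ i = s * (θ i / s) := by field_simp
  congr 1
  rw [h4, sft_scale hs]
  conv_lhs => rw [h5]
  rw [mul_div_cancel_left₀ _ hs.ne']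
  ring

lemma main_upper {n k : ℕ} {s τ ν : ℝ} (hn : 1 ≤ n) (hs : 0 < s) (hν : 1 ≤ ν)
    (hε : Real.exp (- ν ^ 2 / 2) = (k : ℝ) / n) (hl : (ν / 2) ^ 2 ≤ ν ^ 2 - 6 * Real.log ν)
    (θ : Fin n → ℝ) (hθ : θ ∈ paramSet n k τ) :
    risk n s (softEst n (s * √(ν ^ 2 - 6 * Real.log ν))) θ ≤
      ENNReal.ofReal (s ^ 2 * (k * (ν ^ 2 - 6 * Real.log ν + 257))) := by
  set l := √(ν ^ 2 - 6 * Real.log ν) with hldef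
  have hl2 : l ^ 2 = ν ^ 2 - 6 * Real.log ν := Real.sq_sqrt ((sq_nonneg _).trans hl)
  have hlν : ν / 2 ≤ l := Real.le_sqrt_of_sq_le hl
  have hl0 : 0 < l := by linarith
  have hn0 : (0 : ℝ) < n := by exact_mod_cast hn
  rw [risk_eq n hs, ENNReal.ofReal_mul (by positivity)]
  gcongr
  have hz : rho l 0 ≤ ENNReal.ofReal (256 * (k / n)) := by
    refine (rho_zero_upper hl0).trans (ENNReal.ofReal_le_ofReal ?_)
    have e1 : Real.exp (- l ^ 2 / 2) = (k : ℝ) / n * ν ^ 3 := by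
      rw [← hε, hl2]
      have : ν ^ 3 = Real.exp (3 * Real.log ν) := by
        have h := Real.exp_log (show 0 < ν by linarith)
        calc ν ^ 3 = (Real.exp (Real.log ν)) ^ 3 := by rw [h]
          _ = _ := by rw [← Real.exp_nat_mul]; norm_num
      rw [this, ← Real.exp_add]
      congr 1; ring
    rw [e1, div_le_iff₀ (by positivity)]
    have : (ν / 2) ^ 3 ≤ l ^ 3 := pow_le_pow_left₀ (by linarith) hlν 3
    have hk : (0:ℝ) ≤ k / n := by positivity
    nlinarith [mul_le_mul_of_nonneg_left this hk]
  have hsum : ∑ i, rho l (θ i / s) ≤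
      ∑ i : Fin n, (ENNReal.ofReal (256 * (k / n)) + if θ i ≠ 0 then ENNReal.ofReal (1 + l ^ 2) else 0) := by
    refine Finset.sum_le_sum fun i _ => ?_
    by_cases h : θ i = 0
    · simpa [h] using hz
    · simp only [ne_eq, h, not_false_eq_true, if_true]
      exact (rho_upper hl0.le _).trans le_add_self
  refine hsum.trans ?_
  rw [Finset.sum_add_distrib, ← Finset.sum_filter, Finset.sum_const, Finset.sum_const]
  have hc : (Finset.univ.filter (fun i => θ i ≠ 0)).card ≤ k := by
    have := hθ.1
    rwa [Set.ncard_eq_toFinset_card', Set.toFinset_ofPred] at this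
  have h2 : (Finset.univ.filter (fun i => θ i ≠ 0)).card • ENNReal.ofReal (1 + l ^ 2) ≤
      k • ENNReal.ofReal (1 + l ^ 2) := by
    gcongr
  refine (add_le_add le_rfl h2).trans (le_of_eq ?_)
  rw [← ENNReal.ofReal_nsmul, ← ENNReal.ofReal_nsmul, ← ENNReal.ofReal_add (by positivity) (by positivity)]
  congr 1
  rw [hl2]
  simp only [Finset.card_univ, Fintype.card_fin, nsmul_eq_mul]
  field_simp
  ring

def CL : ℝ := 1 / 2 + |2 + 2 * Real.log (c0 / 16 / 2)|

lemma main_lower {n k : ℕ} {s τ ν l : ℝ} (hn : 1 ≤ n) (hs : 0 < s) (hν : 1 ≤ ν)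
    (hkn : 2 * k ≤ n)
    (hε : Real.exp (- ν ^ 2 / 2) = (k : ℝ) / n) (hμ : 2 * ν ≤ τ / s) (hl : 0 ≤ l) :
    ∃ θ ∈ paramSet n k τ, ENNReal.ofReal (s ^ 2 * (k * (ν ^ 2 - 6 * Real.log ν - CL))) ≤
      risk n s (softEst n (s * l)) θ := by
  have hn0 : (0 : ℝ) < n := by exact_mod_cast hn
  obtain ⟨T, -, hT⟩ := Finset.exists_subset_card_eq (s := (Finset.univ : Finset (Fin n))) (n := k)
    (by simp; omega)
  refine ⟨fun i => if i ∈ T then τ else 0, ⟨?_, ?_⟩, ?_⟩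
  · rw [← hT, ← Set.ncard_coe_finset T]
    refine Set.ncard_le_ncard (fun i hi => ?_) (Set.toFinite _)
    by_contra h
    simp at hi h
    exact h hi.1
  · simp [ite_pow, hT]
  · rw [risk_eq n hs, ENNReal.ofReal_mul (by positivity)]
    gcongr
    have hsum : ∑ i : Fin n, rho l ((if i ∈ T then τ else 0) / s) =
        k * rho l (τ / s) + ((n - k : ℕ) : ℝ≥0∞) * rho l 0 := by
      have : ∀ i : Fin n, rho l ((if i ∈ T then τ else 0) / s) =
          if i ∈ T then rho l (τ / s) else rho l 0 := by
        intro i; split_ifs <;> simp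
      simp_rw [this]
      rw [Finset.sum_ite, Finset.sum_const, Finset.sum_const]
      have h1 : Finset.univ.filter (fun i => i ∈ T) = T := by ext; simp
      have h2 : Finset.univ.filter (fun i => i ∉ T) = Tᶜ := by ext; simp
      rw [h1, h2, Finset.card_compl, hT]
      simp
    rw [hsum]
    have hlog : 0 ≤ Real.log ν := Real.log_nonneg hν
    have hCL : 1 / 2 ≤ CL := by unfold CL; linarith [abs_nonneg (2 + 2 * Real.log (c0 / 16 / 2))]
    rcases le_or_gt ν l with h | h
    · have h1 := rho_lower (by linarith) h hμ (by linarith)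
      have h2 : ENNReal.ofReal (k * (ν ^ 2 - 6 * Real.log ν - CL)) ≤ k * rho l (τ / s) := by
        rw [ENNReal.ofReal_mul (by positivity), ENNReal.ofReal_natCast]
        gcongr
        refine le_trans (ENNReal.ofReal_le_ofReal ?_) h1
        linarith
      exact h2.trans le_self_add
    · have h1 := rho_lower (m := τ / s) hl le_rfl (by linarith) (by linarith)
      have h2 := rho_zero_lower hl
      have hc0 := c0_pos
      have h3 : ENNReal.ofReal (k * (l ^ 2 - 1 / 2) +
          ((n - k : ℕ) : ℝ) * (c0 * Real.exp (- l ^ 2 / 2) / (1 + l) ^ 3)) ≤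
          k * rho l (τ / s) + ((n - k : ℕ) : ℝ≥0∞) * rho l 0 := by
        refine ENNReal.ofReal_add_le.trans ?_
        rw [ENNReal.ofReal_mul (by positivity), ENNReal.ofReal_mul (by positivity),
          ENNReal.ofReal_natCast, ENNReal.ofReal_natCast]
        gcongr
      refine le_trans (ENNReal.ofReal_le_ofReal ?_) h3
      have hν3 : ν ^ 3 = Real.exp (3 * Real.log ν) := by
        have h := Real.exp_log (show 0 < ν by linarith)
        calc ν ^ 3 = (Real.exp (Real.log ν)) ^ 3 := by rw [h]
          _ = _ := by rw [← Real.exp_nat_mul]; norm_num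
      set E := Real.exp ((ν ^ 2 - l ^ 2) / 2 - 3 * Real.log ν) with hE
      have hEeq : Real.exp (- l ^ 2 / 2) = (k : ℝ) / n * ν ^ 3 * E := by
        rw [← hε, hν3, hE, ← Real.exp_add, ← Real.exp_add]
        congr 1; ring
      have hnk : (n : ℝ) / 2 ≤ ((n - k : ℕ) : ℝ) := by
        rw [Nat.cast_sub (by omega)]
        have : (2 * k : ℝ) ≤ n := by exact_mod_cast hkn
        linarith
      have hfrac : c0 * ((k : ℝ) / n * E) / 8 ≤ c0 * Real.exp (- l ^ 2 / 2) / (1 + l) ^ 3 := by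
        rw [div_le_div_iff₀ (by norm_num) (by positivity), hEeq]
        have : (1 + l) ^ 3 ≤ (2 * ν) ^ 3 := pow_le_pow_left₀ (by linarith) (by linarith) 3
        have hp : 0 ≤ c0 * ((k : ℝ) / n * E) := by positivity
        nlinarith [mul_le_mul_of_nonneg_left this hp]
      have hmul : (k : ℝ) * (c0 / 16 * E) ≤
          ((n - k : ℕ) : ℝ) * (c0 * Real.exp (- l ^ 2 / 2) / (1 + l) ^ 3) := by
        calc (k : ℝ) * (c0 / 16 * E) = n / 2 * (c0 * ((k : ℝ) / n * E) / 8) := by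
              field_simp; ring
          _ ≤ _ := by gcongr
      have hexp : 2 * (1 + ((ν ^ 2 - l ^ 2) / 2 - 3 * Real.log ν) + Real.log (c0 / 16 / 2)) ≤ c0 / 16 * E := by
        have h := Real.add_one_le_exp (((ν ^ 2 - l ^ 2) / 2 - 3 * Real.log ν) + Real.log (c0 / 16 / 2))
        rw [Real.exp_add, Real.exp_log (by positivity), ← hE] at h
        linarith
      have hfin : ν ^ 2 - 6 * Real.log ν - CL ≤ (l ^ 2 - 1 / 2) + c0 / 16 * E := by
        unfold CL
        linarith [neg_abs_le (2 + 2 * Real.log (c0 / 16 / 2))]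
      have := mul_le_mul_of_nonneg_left hfin (Nat.cast_nonneg (α := ℝ) k)
      linarith

/-- Proposition `lem::lasso-risk-regime-4`. -/
theorem statement9
    (k : ℕ → ℕ) (τ σ ε μ ν : ℕ → ℝ)
    (hk : ∀ n, 1 ≤ n → 1 ≤ k n ∧ k n ≤ n)
    (hτ : ∀ n, 0 < τ n) (hσ : ∀ n, 0 < σ n)
    (hε : ∀ n, ε n = (k n : ℝ) / n) (hμ : ∀ n, μ n = τ n / σ n)
    (hν : ∀ n, ν n = Real.sqrt (2 * Real.log (ε n)⁻¹))
    (hε0 : Tendsto ε atTop (𝓝 0))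
    (hμω : Tendsto (fun n => Real.sqrt (Real.log (ε n)⁻¹) / μ n) atTop (𝓝 0)) :
    ∃ c : ℕ → ℝ, Tendsto c atTop (𝓝 1) ∧
      ∀ᶠ n : ℕ in atTop,
        (⨅ (lam : ℝ) (_ : 0 ≤ lam),
            ⨆ θ ∈ paramSet n (k n) (τ n), risk n (σ n) (softEst n lam) θ) =
          ENNReal.ofReal ((n : ℝ) * σ n ^ 2 *
            (2 * ε n * Real.log (ε n)⁻¹ - 6 * ε n * Real.log (ν n) * c n)) := by

  set V : ℕ → ℝ≥0∞ := fun n => ⨅ (lam : ℝ) (_ : 0 ≤ lam),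
            ⨆ θ ∈ paramSet n (k n) (τ n), risk n (σ n) (softEst n lam) θ with hV
  -- asymptotics
  have hεpos : ∀ᶠ n in atTop, 0 < ε n := by
    filter_upwards [eventually_ge_atTop 1] with n hn
    rw [hε]
    have h1 : (0 : ℝ) < k n := by exact_mod_cast (hk n hn).1
    have h2 : (0 : ℝ) < n := by exact_mod_cast hn
    positivity
  have hlogtop : Tendsto (fun n => Real.log (ε n)⁻¹) atTop atTop := by
    refine Real.tendsto_log_atTop.comp ?_
    exact tendsto_inv_nhdsGT_zero.comp (tendsto_nhdsWithin_iff.2 ⟨hε0, hεpos⟩)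
  have hνtop : Tendsto ν atTop atTop := by
    have : ν = fun n => √(2 * Real.log (ε n)⁻¹) := funext hν
    rw [this]
    exact Real.tendsto_sqrt_atTop.comp (hlogtop.const_mul_atTop (by norm_num))
  have hlogν : Tendsto (fun n => Real.log (ν n)) atTop atTop := Real.tendsto_log_atTop.comp hνtop
  have hsmall : ∀ᶠ x : ℝ in atTop, (x / 2) ^ 2 ≤ x ^ 2 - 6 * Real.log x := by
    filter_upwards [eventually_ge_atTop 8] with x hx
    have := Real.log_le_sub_one_of_pos (show 0 < x by linarith)
    nlinarith
  have hbd : ∀ᶠ n in atTop, ν n ^ 2 = 2 * Real.log (ε n)⁻¹ ∧ 0 < Real.log (ν n) ∧ 0 < k n ∧ 1 ≤ n ∧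
      ENNReal.ofReal (σ n ^ 2 * (k n * (ν n ^ 2 - 6 * Real.log (ν n) - CL))) ≤ V n ∧
      V n ≤ ENNReal.ofReal (σ n ^ 2 * (k n * (ν n ^ 2 - 6 * Real.log (ν n) + 257))) ∧
      0 ≤ ν n ^ 2 - 6 * Real.log (ν n) + 257 := by
    filter_upwards [hεpos, eventually_ge_atTop 1, hνtop.eventually hsmall,
      hνtop.eventually (eventually_ge_atTop 1), hlogtop.eventually (eventually_ge_atTop 0),
      hlogν.eventually (eventually_gt_atTop 0), hε0.eventually (eventually_lt_nhds (show (0:ℝ) < 1/2 by norm_num)),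
      hμω.eventually (eventually_lt_nhds (show (0:ℝ) < 1/4 by norm_num))]
      with n hεp hn hsm hν1 hlog hlν hεh hμh
    have hνsq : ν n ^ 2 = 2 * Real.log (ε n)⁻¹ := by
      rw [hν]; exact Real.sq_sqrt (by linarith)
    have hn0 : (0 : ℝ) < n := by exact_mod_cast hn
    have hexp : Real.exp (- ν n ^ 2 / 2) = (k n : ℝ) / n := by
      rw [hνsq, ← hε, Real.log_inv]
      have : -(2 * -Real.log (ε n)) / 2 = Real.log (ε n) := by ring
      rw [this, Real.exp_log hεp]
    have hs := hσ n
    have hμp : 0 < μ n := by rw [hμ]; exact div_pos (hτ n) hs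
    have hμ2 : 2 * ν n ≤ τ n / σ n := by
      rw [← hμ]
      rw [div_lt_iff₀ hμp] at hμh
      have h2 : √(Real.log (ε n)⁻¹) ^ 2 = Real.log (ε n)⁻¹ := Real.sq_sqrt hlog
      have : ν n ≤ 2 * √(Real.log (ε n)⁻¹) := by
        apply le_of_sq_le_sq _ (by positivity)
        rw [hνsq, mul_pow, h2]; linarith
      linarith
    have hkn : 2 * k n ≤ n := by
      rw [hε, div_lt_iff₀ hn0] at hεh
      have : (2 * k n : ℝ) ≤ n := by linarith
      exact_mod_cast this
    refine ⟨hνsq, hlν, (hk n hn).1, hn, ?_, ?_, ?_⟩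
    · refine le_iInf₂ fun lam hlam => ?_
      obtain ⟨θ, hθ, h⟩ := main_lower (l := lam / σ n) hn hs hν1 hkn hexp hμ2 (by positivity)
      rw [mul_div_cancel₀ _ hs.ne'] at h
      exact h.trans (le_iSup₂ (f := fun θ (_ : θ ∈ paramSet n (k n) (τ n)) => risk n (σ n) (softEst n lam) θ) θ hθ)
    · refine (iInf₂_le (σ n * √(ν n ^ 2 - 6 * Real.log (ν n))) (by positivity)).trans ?_
      exact iSup₂_le fun θ hθ => main_upper hn hs hν1 hexp hsm θ hθ
    · linarith [sq_nonneg (ν n / 2)]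
  refine ⟨fun n => (ν n ^ 2 - (V n).toReal / (σ n ^ 2 * k n)) / (6 * Real.log (ν n)), ?_, ?_⟩
  · have hCL : 0 ≤ CL := by unfold CL; positivity
    have hz : Tendsto (fun n => (CL + 257) / (6 * Real.log (ν n))) atTop (𝓝 0) :=
      (hlogν.const_mul_atTop (by norm_num : (0:ℝ) < 6)).const_div_atTop _
    rw [tendsto_iff_norm_sub_tendsto_zero]
    refine squeeze_zero' (Eventually.of_forall fun n => norm_nonneg _) ?_ hz
    filter_upwards [hbd] with n ⟨h1, h2, h3, h4, h5, h6, h7⟩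
    have hs := hσ n
    have hk0 : (0 : ℝ) < k n := by exact_mod_cast h3
    have hp : 0 < σ n ^ 2 * k n := by positivity
    have hfin : V n ≠ ∞ := ne_top_of_le_ne_top ENNReal.ofReal_ne_top h6
    have hup : (V n).toReal / (σ n ^ 2 * k n) ≤ ν n ^ 2 - 6 * Real.log (ν n) + 257 := by
      rw [div_le_iff₀ hp]
      have := ENNReal.toReal_le_of_le_ofReal (by positivity) h6
      linarith
    have hlo : ν n ^ 2 - 6 * Real.log (ν n) - CL ≤ (V n).toReal / (σ n ^ 2 * k n) := by
      rw [le_div_iff₀ hp]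
      have := (ENNReal.ofReal_le_iff_le_toReal hfin).1 h5
      linarith
    rw [Real.norm_eq_abs, div_sub_one (by positivity), abs_div, abs_of_pos (show 0 < 6 * Real.log (ν n) by positivity)]
    gcongr
    rw [abs_le]
    constructor <;> linarith
  · filter_upwards [hbd] with n ⟨h1, h2, h3, h4, h5, h6, h7⟩
    have hs := hσ n
    have hk0 : (0 : ℝ) < k n := by exact_mod_cast h3
    have hn0 : (0 : ℝ) < n := by exact_mod_cast h4
    have hfin : V n ≠ ∞ := ne_top_of_le_ne_top ENNReal.ofReal_ne_top h6
    change V n = _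
    have : (n : ℝ) * σ n ^ 2 * (2 * ε n * Real.log (ε n)⁻¹ - 6 * ε n * Real.log (ν n) *
        ((ν n ^ 2 - (V n).toReal / (σ n ^ 2 * k n)) / (6 * Real.log (ν n)))) = (V n).toReal := by
      have e1 : 2 * ε n * Real.log (ε n)⁻¹ = ε n * ν n ^ 2 := by rw [h1]; ring
      rw [e1, hε]
      have := h2.ne'
      field_simp
      ring
    rw [this, ENNReal.ofReal_toReal hfin]
end
end

section
/- Consider the Gaussian sequence model with noise level σₙ and the SNR-aware parameter space Θ(kₙ, τₙ). Suppose εₙ = kₙ/n → 0 and μₙ = τₙ/σₙ = ω(√(log εₙ⁻¹)) as n → ∞. Then the optimally tuned linear estimator has supremum risk: inf over λ ≥ 0 of sup over θ ∈ Θ(kₙ,τₙ) of E_θ‖η̂_L(y,λ) − θ‖₂² = n σₙ² εₙ μₙ² / (1 + εₙ μₙ²), and this quantity is ω( n σₙ² εₙ log(εₙ⁻¹) ), i.e. n σₙ² εₙ log(εₙ⁻¹) divided by it tends to 0. -/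
open MeasureTheory ProbabilityTheory Filter
open scoped ENNReal NNReal Topology

noncomputable section

/-- Linear (ridge) estimator `[η̂_L(y,λ)]ᵢ = yᵢ/(1+λ)`. -/
def linEst (n : ℕ) (lam : ℝ) : (Fin n → ℝ) → Fin n → ℝ := fun y i => y i / (1 + lam)

lemma aux_one (m s b : ℝ) :
    ∫⁻ x, ENNReal.ofReal ((x / b - m) ^ 2) ∂(gaussianReal m ((s ^ 2).toNNReal)) =
      ENNReal.ofReal ((1 / b) ^ 2 * s ^ 2 + (1 - 1 / b) ^ 2 * m ^ 2) := by
  set v := (s ^ 2).toNNReal with hv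
  have hL : MemLp (fun x : ℝ => x) 2 (gaussianReal m v) := memLp_id_gaussianReal' 2 (by simp)
  have hc : MemLp (fun x : ℝ => x - m) 2 (gaussianReal m v) := hL.sub (memLp_const m)
  have hi1 : Integrable (fun x : ℝ => x - m) (gaussianReal m v) := hc.integrable (by norm_num)
  have hi0 : Integrable (fun x : ℝ => x) (gaussianReal m v) := hL.integrable (by norm_num)
  have hi2 : Integrable (fun x : ℝ => (x - m) ^ 2) (gaussianReal m v) := hc.integrable_sq
  have e1 : ∫ x, (x - m) ∂(gaussianReal m v) = 0 := by
    rw [integral_sub hi0 (integrable_const m), integral_id_gaussianReal]; simp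
  have e2 : ∫ x, (x - m) ^ 2 ∂(gaussianReal m v) = s ^ 2 := by
    have h := variance_fun_id_gaussianReal (μ := m) (v := v)
    rw [variance_eq_integral (by fun_prop), integral_id_gaussianReal] at h
    rw [h, hv, Real.coe_toNNReal _ (sq_nonneg s)]
  have hf : (fun x : ℝ => (x / b - m) ^ 2) = fun x =>
      ((1 / b) ^ 2 * (x - m) ^ 2 + (-2 * (1 / b) * (1 - 1 / b) * m) * (x - m))
        + (1 - 1 / b) ^ 2 * m ^ 2 := by
    funext x; ring
  have hI : Integrable (fun x : ℝ => (x / b - m) ^ 2) (gaussianReal m v) := by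
    rw [hf]
    exact ((hi2.const_mul _).add (hi1.const_mul _)).add (integrable_const _)
  have hA : Integrable (fun x : ℝ => (1 / b) ^ 2 * (x - m) ^ 2
      + (-2 * (1 / b) * (1 - 1 / b) * m) * (x - m)) (gaussianReal m v) :=
    (hi2.const_mul _).add (hi1.const_mul _)
  rw [← ofReal_integral_eq_lintegral_ofReal hI (ae_of_all _ fun x => sq_nonneg _), hf,
    integral_add hA (integrable_const _),
    integral_add (hi2.const_mul _) (hi1.const_mul _), integral_const_mul, integral_const_mul,
    e1, e2]
  simp

lemma aux_risk (n : ℕ) (s l : ℝ) (θ : Fin n → ℝ) :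
    risk n s (linEst n l) θ = ENNReal.ofReal
      ((1 / (1 + l)) ^ 2 * (n * s ^ 2) + (1 - 1 / (1 + l)) ^ 2 * ∑ i, θ i ^ 2) := by
  unfold risk linEst gsm
  simp_rw [ENNReal.ofReal_sum_of_nonneg (fun i _ => sq_nonneg _)]
  rw [lintegral_finsetSum _ (fun i _ => by fun_prop)]
  have h : ∀ i : Fin n, ∫⁻ y : Fin n → ℝ, ENNReal.ofReal ((y i / (1 + l) - θ i) ^ 2)
      ∂(Measure.pi fun i => gaussianReal (θ i) ((s ^ 2).toNNReal)) =
      ENNReal.ofReal ((1 / (1 + l)) ^ 2 * s ^ 2 + (1 - 1 / (1 + l)) ^ 2 * θ i ^ 2) := by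
    intro i
    rw [← aux_one]
    exact (measurePreserving_eval (fun i => gaussianReal (θ i) ((s ^ 2).toNNReal)) i).lintegral_comp
      (f := fun x => ENNReal.ofReal ((x / (1 + l) - θ i) ^ 2)) (by fun_prop)
  rw [Finset.sum_congr rfl (fun i _ => h i),
    ← ENNReal.ofReal_sum_of_nonneg (fun i _ => by positivity)]
  congr 1
  rw [Finset.sum_add_distrib, Finset.mul_sum, Finset.sum_const, Finset.card_univ, Fintype.card_fin,
    nsmul_eq_mul]
  ring

lemma aux_sup (n k : ℕ) (hn : 1 ≤ n) (hk : 1 ≤ k) (t s l : ℝ) :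
    ⨆ θ ∈ paramSet n k t, risk n s (linEst n l) θ = ENNReal.ofReal
      ((1 / (1 + l)) ^ 2 * (n * s ^ 2) + (1 - 1 / (1 + l)) ^ 2 * (k * t ^ 2)) := by
  apply le_antisymm
  · refine iSup₂_le fun θ hθ => ?_
    rw [aux_risk]
    apply ENNReal.ofReal_le_ofReal
    have := hθ.2
    gcongr
  · have hsum : ∑ i, (Pi.single (⟨0, hn⟩ : Fin n) (Real.sqrt k * t) : Fin n → ℝ) i ^ 2
        = k * t ^ 2 := by
      rw [Finset.sum_eq_single (⟨0, hn⟩ : Fin n)]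
      · simp [mul_pow]
      · intro b _ hb
        simp [Pi.single_eq_of_ne hb]
      · simp
    have hmem : (Pi.single (⟨0, hn⟩ : Fin n) (Real.sqrt k * t) : Fin n → ℝ) ∈ paramSet n k t := by
      refine ⟨?_, hsum.le⟩
      refine le_trans ?_ hk
      rw [← Set.ncard_singleton (⟨0, hn⟩ : Fin n)]
      apply Set.ncard_le_ncard _ (Set.finite_singleton _)
      intro i hi
      by_contra hne
      exact hi (Pi.single_eq_of_ne hne _)
    refine le_trans (le_of_eq ?_) (le_iSup₂ _ hmem)
    rw [aux_risk, hsum]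

/-- Proposition `prop:ridge:thirdregime`. -/
theorem statement10
    (k : ℕ → ℕ) (τ σ ε μ : ℕ → ℝ)
    (hk : ∀ n, 1 ≤ n → 1 ≤ k n ∧ k n ≤ n)
    (hτ : ∀ n, 0 < τ n) (hσ : ∀ n, 0 < σ n)
    (hε : ∀ n, ε n = (k n : ℝ) / n) (hμ : ∀ n, μ n = τ n / σ n)
    (hε0 : Tendsto ε atTop (𝓝 0))
    (hμω : Tendsto (fun n => Real.sqrt (Real.log (ε n)⁻¹) / μ n) atTop (𝓝 0)) :
    (∀ n : ℕ,
      (⨅ (lam : ℝ) (_ : 0 ≤ lam),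
          ⨆ θ ∈ paramSet n (k n) (τ n), risk n (σ n) (linEst n lam) θ) =
        ENNReal.ofReal ((n : ℝ) * σ n ^ 2 * ε n * μ n ^ 2 / (1 + ε n * μ n ^ 2))) ∧
    Tendsto
      (fun n : ℕ => ((n : ℝ) * σ n ^ 2 * ε n * Real.log (ε n)⁻¹) /
        ((n : ℝ) * σ n ^ 2 * ε n * μ n ^ 2 / (1 + ε n * μ n ^ 2)))
      atTop (𝓝 0) := by
  refine ⟨fun n => ?_, ?_⟩
  · rcases Nat.eq_zero_or_pos n with rfl | hn
    · refine le_antisymm ((iInf₂_le 0 le_rfl).trans ?_) (by simp)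
      refine iSup₂_le fun θ _ => ?_
      rw [aux_risk]; simp
    · obtain ⟨hk1, _⟩ := hk n hn
      simp_rw [aux_sup n (k n) hn hk1]
      have hn' : (0 : ℝ) < n := by exact_mod_cast hn
      have hk' : (0 : ℝ) < k n := by exact_mod_cast hk1
      have hs := hσ n
      have ht := hτ n
      have hval : (n : ℝ) * σ n ^ 2 * ε n * μ n ^ 2 / (1 + ε n * μ n ^ 2) =
          (n * σ n ^ 2) * (k n * τ n ^ 2) / (n * σ n ^ 2 + k n * τ n ^ 2) := by
        rw [hε, hμ]; field_simp
      rw [hval]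
      set N := (n : ℝ) * σ n ^ 2 with hN
      set K := (k n : ℝ) * τ n ^ 2 with hK
      have hNp : 0 < N := by positivity
      have hKp : 0 < K := by positivity
      apply le_antisymm
      · refine (iInf₂_le (N / K) (by positivity)).trans (le_of_eq ?_)
        congr 1
        field_simp
        ring
      · refine le_iInf₂ fun l hl => ENNReal.ofReal_le_ofReal ?_
        generalize 1 / (1 + l) = a
        rw [div_le_iff₀ (by positivity)]
        nlinarith [sq_nonneg (a * N - (1 - a) * K)]
  · have h1 := (hμω.pow 2).add ((Real.continuous_negMulLog.tendsto 0).comp hε0)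
    simp only [Real.negMulLog_zero, add_zero, ne_eq, OfNat.ofNat_ne_zero, not_false_eq_true,
      zero_pow] at h1
    refine h1.congr' ?_
    filter_upwards [eventually_ge_atTop 1] with n hn
    obtain ⟨hk1, hk2⟩ := hk n hn
    have hn' : (0 : ℝ) < n := by exact_mod_cast hn
    have hk' : (0 : ℝ) < k n := by exact_mod_cast hk1
    have hs := hσ n
    have ht := hτ n
    have hm : 0 < μ n := by rw [hμ]; positivity
    have he : 0 < ε n := by rw [hε]; positivity
    have he1 : ε n ≤ 1 := by
      rw [hε, div_le_one hn']; exact_mod_cast hk2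
    have hlog : 0 ≤ Real.log (ε n)⁻¹ := Real.log_nonneg ((one_le_inv₀ he).2 he1)
    rw [div_pow, Real.sq_sqrt hlog]
    simp only [Function.comp, Real.negMulLog, Real.log_inv]
    field_simp
    ring
end
end

section
/- Let r_e(μ; λ, γ) = E((1+γ)⁻¹ η̂_S(μ+z, λ) − μ)² with z ~ N(0,1), where η̂_S(x,λ) = sign(x)(|x|−λ)₊. For any λ > 0 and γ ∈ [0, ∞]: (i) μ ↦ r_e(μ; λ, γ) is symmetric about 0 and increasing on [0, ∞); (ii) for every c > 0, the maximum of r_e(x; λ, γ) + r_e(y; λ, γ) over pairs (x,y) with x² + y² = c² equals 2·r_e(c/√2; λ, γ). -/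
open MeasureTheory ProbabilityTheory Filter
open scoped ENNReal NNReal Topology

noncomputable section

/-- Soft thresholding function `η̂_S(x,λ) = sign(x)(|x|−λ)₊`. -/
def softThresh (lam x : ℝ) : ℝ := Real.sign x * max (|x| - lam) 0

/-- One-dimensional soft–linear (elastic) risk
`r_e(μ; λ, γ) = E((1+γ)⁻¹ η̂_S(μ+z,λ) − μ)²`, `z ~ N(0,1)`, for `γ ∈ [0,∞]`
(with the convention that `γ = ∞` gives the zero estimator, so `r_e = μ²`). -/
def re (lam : ℝ) (gam : ℝ≥0∞) (μ : ℝ) : ℝ :=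
  ∫ z, (((1 + gam)⁻¹).toReal * softThresh lam (μ + z) - μ) ^ 2 ∂(gaussianReal 0 1)

def sD (lam x : ℝ) : ℝ := if lam < |x| then 1 else 0

lemma soft_eq (lam : ℝ) (h : 0 < lam) (x : ℝ) :
    softThresh lam x = max (x - lam) 0 - max (-x - lam) 0 := by
  unfold softThresh
  rcases lt_trichotomy x 0 with hx | hx | hx
  · rw [Real.sign_of_neg hx, abs_of_neg hx, max_eq_right (by linarith : x - lam ≤ 0)]; ring
  · subst hx; simp
  · rw [Real.sign_of_pos hx, abs_of_pos hx, max_eq_right (by linarith : -x - lam ≤ 0)]; ring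

lemma soft_neg (lam : ℝ) (h : 0 < lam) (x : ℝ) : softThresh lam (-x) = - softThresh lam x := by
  rw [soft_eq lam h, soft_eq lam h, neg_neg]; ring

lemma soft_lip (lam : ℝ) (h : 0 < lam) (x y : ℝ) :
    |softThresh lam x - softThresh lam y| ≤ |x - y| := by
  rw [soft_eq lam h, soft_eq lam h]
  rcases le_total x y with hxy | hxy
  · rw [abs_of_nonpos (sub_nonpos.2 hxy), abs_le]
    constructor <;> rcases max_cases (x - lam) 0 with h1 | h1 <;> rcases max_cases (-x - lam) 0 with h2 | h2 <;>
      rcases max_cases (y - lam) 0 with h3 | h3 <;> rcases max_cases (-y - lam) 0 with h4 | h4 <;> linarith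
  · rw [abs_of_nonneg (sub_nonneg.2 hxy), abs_le]
    constructor <;> rcases max_cases (x - lam) 0 with h1 | h1 <;> rcases max_cases (-x - lam) 0 with h2 | h2 <;>
      rcases max_cases (y - lam) 0 with h3 | h3 <;> rcases max_cases (-y - lam) 0 with h4 | h4 <;> linarith

lemma soft_abs (lam : ℝ) (h : 0 < lam) (x : ℝ) : |softThresh lam x| ≤ |x| := by
  have := soft_lip lam h x 0
  have h0 : softThresh lam 0 = 0 := by simp [softThresh]
  simpa [h0] using this

lemma soft_cont (lam : ℝ) (h : 0 < lam) : Continuous (softThresh lam) := by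
  have : softThresh lam = fun x => max (x - lam) 0 - max (-x - lam) 0 := funext (soft_eq lam h)
  rw [this]; fun_prop

lemma soft_mul (lam : ℝ) (x : ℝ) : softThresh lam x * sD lam x = softThresh lam x := by
  unfold softThresh sD
  split_ifs with h
  · simp
  · rw [max_eq_right (by linarith)]; simp

lemma soft_deriv (lam : ℝ) (h : 0 < lam) (x : ℝ) (hx : |x| ≠ lam) :
    HasDerivAt (softThresh lam) (sD lam x) x := by
  rcases lt_or_gt_of_ne hx with hx | hx
  · have : sD lam x = 0 := by simp [sD, hx.le]
    rw [this]
    refine (hasDerivAt_const x (0:ℝ)).congr_of_eventuallyEq ?_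
    filter_upwards [(continuous_abs.tendsto x).eventually_lt_const hx] with y hy
    simp only [softThresh]
    rw [max_eq_right (by linarith)]; simp
  · have : sD lam x = 1 := by simp [sD, hx]
    rw [this]
    rcases lt_abs.1 hx with hx | hx
    · refine ((hasDerivAt_id x).sub_const lam).congr_of_eventuallyEq ?_
      filter_upwards [lt_mem_nhds hx] with y hy
      rw [soft_eq lam h, max_eq_left (by linarith), max_eq_right (by linarith)]; simp
    · refine ((hasDerivAt_id x).add_const lam).congr_of_eventuallyEq ?_
      filter_upwards [gt_mem_nhds (show x < -lam by linarith)] with y hy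
      rw [soft_eq lam h, max_eq_right (by linarith), max_eq_left (by linarith)]; simp; ring

abbrev G : Measure ℝ := gaussianReal 0 1

lemma ae_ne (lam μ : ℝ) : ∀ᵐ z ∂G, |μ + z| ≠ lam := by
  have : NullSingletonClass G := nullSingletonClass_gaussianReal one_ne_zero
  have h : ({lam - μ, -lam - μ} : Set ℝ)ᶜ ∈ ae G :=
    compl_mem_ae_iff.2 ((Set.toFinite _).measure_zero G)
  filter_upwards [h] with z hz h1
  apply hz
  rcases eq_or_eq_neg_of_abs_eq h1 with h | h
  · left; linarith
  · right; simp; linarith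

lemma sD_meas (lam : ℝ) : Measurable (sD lam) := by
  unfold sD
  exact Measurable.ite (measurableSet_lt measurable_const continuous_abs.measurable) measurable_const measurable_const

lemma int_abs : Integrable (fun z : ℝ => |z|) G :=
  ((memLp_id_gaussianReal 1).integrable (by norm_num)).abs

lemma int_sq : Integrable (fun z : ℝ => z^2) G :=
  (memLp_id_gaussianReal 2).integrable_sq

lemma int_soft (lam : ℝ) (h : 0 < lam) (μ : ℝ) : Integrable (fun z => softThresh lam (μ + z)) G := by
  have hc := soft_cont lam h
  refine ((integrable_const |μ|).add int_abs).mono' (by fun_prop) (ae_of_all _ fun z => ?_)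
  exact (soft_abs lam h _).trans (abs_add_le _ _)

lemma int_soft2 (lam : ℝ) (h : 0 < lam) (μ : ℝ) : Integrable (fun z => softThresh lam (μ + z) ^ 2) G := by
  have hc := soft_cont lam h
  refine ((integrable_const (2 * μ^2)).add (int_sq.const_mul 2)).mono' (by fun_prop) (ae_of_all _ fun z => ?_)
  rw [Real.norm_eq_abs, abs_of_nonneg (sq_nonneg _)]
  have := sq_le_sq.2 (soft_abs lam h (μ + z))
  simp only [Pi.add_apply]
  nlinarith [sq_nonneg (μ - z)]

def mm (lam μ : ℝ) : ℝ := ∫ z, softThresh lam (μ + z) ∂G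
def SS (lam μ : ℝ) : ℝ := ∫ z, softThresh lam (μ + z) ^ 2 ∂G
def pp (lam μ : ℝ) : ℝ := ∫ z in (-lam - μ)..(lam - μ), gaussianPDFReal 0 1 z

lemma int_sD (lam : ℝ) (h : 0 < lam) (μ : ℝ) : ∫ z, sD lam (μ + z) ∂G = 1 - pp lam μ := by
  have h1 : (fun z => sD lam (μ + z)) = fun z => 1 - (Set.Icc (-lam - μ) (lam - μ)).indicator 1 z := by
    funext z
    by_cases hz : z ∈ Set.Icc (-lam - μ) (lam - μ)
    · have : |μ + z| ≤ lam := abs_le.2 ⟨by linarith [hz.1], by linarith [hz.2]⟩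
      simp [hz, sD, this]
    · have : lam < |μ + z| := by
        by_contra h2
        have := abs_le.1 (not_lt.1 h2)
        exact hz ⟨by linarith, by linarith⟩
      simp [hz, sD, this]
  rw [h1, integral_sub (integrable_const _) ((integrable_indicator_iff measurableSet_Icc).2 (integrable_const _).integrableOn)]
  congr 1
  · simp
  · rw [integral_gaussianReal_eq_integral_smul one_ne_zero, pp, intervalIntegral.integral_of_le (by linarith), ← integral_Icc_eq_integral_Ioc, ← integral_indicator measurableSet_Icc]
    congr 1; funext z
    by_cases hz : z ∈ Set.Icc (-lam - μ) (lam - μ) <;> simp [hz]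

lemma mm_deriv (lam : ℝ) (h : 0 < lam) (μ : ℝ) : HasDerivAt (mm lam) (1 - pp lam μ) μ := by
  rw [← int_sD lam h]
  have hc := soft_cont lam h
  have hm := sD_meas lam
  refine (hasDerivAt_integral_of_dominated_loc_of_lip (F := fun μ z => softThresh lam (μ + z))
    (F' := fun z => sD lam (μ + z)) (bound := fun _ => 1) (Metric.ball_mem_nhds μ one_pos)
    (Eventually.of_forall fun x => by fun_prop) (int_soft lam h μ) (hm.comp (measurable_const_add μ)).aestronglyMeasurable
    (ae_of_all _ fun z => ?_) (integrable_const _) ?_).2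
  · refine LipschitzOnWith.of_dist_le_mul fun x _ y _ => ?_
    have := soft_lip lam h (x + z) (y + z)
    simpa [Real.dist_eq] using this
  · filter_upwards [ae_ne lam μ] with z hz
    exact (soft_deriv lam h _ hz).comp_add_const μ z

lemma SS_deriv (lam : ℝ) (h : 0 < lam) (μ : ℝ) : HasDerivAt (SS lam) (2 * mm lam μ) μ := by
  have h1 : 2 * mm lam μ = ∫ z, 2 * softThresh lam (μ + z) ∂G := by
    rw [integral_const_mul]; rfl
  rw [h1]
  have hc := soft_cont lam h
  refine (hasDerivAt_integral_of_dominated_loc_of_lip (F := fun μ z => softThresh lam (μ + z) ^ 2)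
    (F' := fun z => 2 * softThresh lam (μ + z)) (bound := fun z => 2 * (|μ| + 1 + |z|)) (Metric.ball_mem_nhds μ one_pos)
    (Eventually.of_forall fun x => by fun_prop) (int_soft2 lam h μ) (by fun_prop)
    (ae_of_all _ fun z => ?_) (((integrable_const _).add int_abs).const_mul 2) ?_).2
  · refine LipschitzOnWith.of_dist_le_mul fun x hx y hy => ?_
    have hl := soft_lip lam h (x + z) (y + z)
    have hb : ∀ x ∈ Metric.ball μ 1, |softThresh lam (x + z)| ≤ |μ| + 1 + |z| := by
      intro x hx
      rw [Metric.mem_ball, Real.dist_eq] at hx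
      have a1 := soft_abs lam h (x + z)
      have a2 := abs_add_le x z
      have a3 := abs_add_le (x - μ) μ
      rw [sub_add_cancel] at a3
      linarith
    have hx' := hb x hx
    have hy' := hb y hy
    rw [Real.dist_eq, Real.dist_eq, Real.coe_nnabs, abs_of_nonneg (show 0 ≤ 2 * (|μ| + 1 + |z|) by positivity), sq_sub_sq, abs_mul]
    rw [add_sub_add_right_eq_sub] at hl
    have := abs_add_le (softThresh lam (x+z)) (softThresh lam (y+z))
    exact mul_le_mul (by linarith) hl (abs_nonneg _) (by positivity)
  · filter_upwards [ae_ne lam μ] with z hz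
    have := ((soft_deriv lam h _ hz).comp_add_const μ z).pow 2
    refine this.congr_deriv ?_
    simp [mul_assoc, soft_mul]

lemma phi_cont : Continuous (gaussianPDFReal 0 1) := by
  rw [gaussianPDFReal_def]; fun_prop

lemma pp_deriv (lam μ : ℝ) : HasDerivAt (pp lam)
    (gaussianPDFReal 0 1 (-lam - μ) - gaussianPDFReal 0 1 (lam - μ)) μ := by
  have hI : ∀ a b, IntervalIntegrable (gaussianPDFReal 0 1) volume a b := fun a b => phi_cont.intervalIntegrable a b
  have hF : ∀ x, HasDerivAt (fun u => ∫ z in (0:ℝ)..u, gaussianPDFReal 0 1 z) (gaussianPDFReal 0 1 x) x :=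
    fun x => intervalIntegral.integral_hasDerivAt_right (hI _ _) (phi_cont.stronglyMeasurableAtFilter _ _) phi_cont.continuousAt
  have e : pp lam = fun μ => (∫ z in (0:ℝ)..(lam - μ), gaussianPDFReal 0 1 z) - ∫ z in (0:ℝ)..(-lam - μ), gaussianPDFReal 0 1 z := by
    funext x
    exact (intervalIntegral.integral_interval_sub_left (hI _ _) (hI _ _)).symm
  rw [e]
  refine (((hF (lam - μ)).comp μ ((hasDerivAt_id μ).const_sub lam)).sub ((hF (-lam - μ)).comp μ ((hasDerivAt_id μ).const_sub (-lam)))).congr_deriv ?_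
  ring

lemma pp_pos (lam : ℝ) (h : 0 < lam) (μ : ℝ) : 0 < pp lam μ := by
  refine intervalIntegral.intervalIntegral_pos_of_pos (phi_cont.intervalIntegrable _ _) (fun x => gaussianPDFReal_pos _ _ _ one_ne_zero) (by linarith)

lemma pp_anti (lam : ℝ) (h : 0 < lam) : AntitoneOn (pp lam) (Set.Ici 0) := by
  refine antitoneOn_of_deriv_nonpos (convex_Ici 0) (fun x _ => (pp_deriv lam x).continuousAt.continuousWithinAt)
    (fun x _ => (pp_deriv lam x).differentiableAt.differentiableWithinAt) fun x hx => ?_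
  rw [interior_Ici] at hx
  have hx : 0 < x := hx
  rw [(pp_deriv lam x).deriv, sub_nonpos]
  simp only [gaussianPDFReal]
  gcongr ?_ * Real.exp (?_ / ?_)
  nlinarith

lemma mm_zero (lam : ℝ) (h : 0 < lam) : mm lam 0 = 0 := by
  have h1 : mm lam 0 = - mm lam 0 := by
    conv_lhs => rw [mm]
    have : G = G.map (fun x => -x) := by simp [G, gaussianReal_map_neg]
    have hc := soft_cont lam h
    rw [this, integral_map (by fun_prop) (by fun_prop), mm, ← integral_neg]
    congr 1; funext z
    rw [zero_add, zero_add, soft_neg lam h]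
  linarith

lemma mm_convex (lam : ℝ) (h : 0 < lam) : ConvexOn ℝ (Set.Ici 0) (mm lam) := by
  refine MonotoneOn.convexOn_of_deriv (convex_Ici 0) (fun x _ => (mm_deriv lam h x).continuousAt.continuousWithinAt)
    (fun x _ => (mm_deriv lam h x).differentiableAt.differentiableWithinAt) fun x hx y hy hxy => ?_
  rw [interior_Ici] at hx hy
  rw [(mm_deriv lam h x).deriv, (mm_deriv lam h y).deriv]
  have := pp_anti lam h (Set.mem_Ici.2 (le_of_lt hx)) (Set.mem_Ici.2 (le_of_lt hy)) hxy
  linarith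

lemma mm_ratio (lam : ℝ) (h : 0 < lam) (x y : ℝ) (hx : 0 < x) (hxy : x ≤ y) :
    mm lam x / x ≤ mm lam y / y := by
  have := (mm_convex lam h).secant_mono (a := 0) (x := x) (y := y) (by simp) hx.le (hx.le.trans hxy) hx.ne' (by linarith : (0:ℝ) < y).ne' hxy
  simpa [mm_zero lam h] using this

lemma mm_le (lam : ℝ) (h : 0 < lam) (x : ℝ) (hx : 0 ≤ x) : mm lam x ≤ x := by
  have : MonotoneOn (fun x => x - mm lam x) (Set.Ici 0) := by
    have hd : ∀ x, HasDerivAt (fun x => x - mm lam x) (1 - (1 - pp lam x)) x := fun x => (hasDerivAt_id x).sub (mm_deriv lam h x)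
    refine monotoneOn_of_deriv_nonneg (convex_Ici 0) (fun x _ => (hd x).continuousAt.continuousWithinAt)
      (fun x _ => (hd x).differentiableAt.differentiableWithinAt) fun x hx => ?_
    rw [(hd x).deriv]
    linarith [pp_pos lam h x]
  have := this (Set.self_mem_Ici) hx hx
  simp only [mm_zero lam h] at this
  linarith
def rr (lam k μ : ℝ) : ℝ := k^2 * SS lam μ - 2 * k * (μ * mm lam μ) + μ^2

lemma rr_eq (lam : ℝ) (h : 0 < lam) (k μ : ℝ) :
    ∫ z, (k * softThresh lam (μ + z) - μ) ^ 2 ∂(gaussianReal 0 1) = rr lam k μ := by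
  have e : (fun z => (k * softThresh lam (μ + z) - μ) ^ 2) = fun z => k^2 * softThresh lam (μ + z) ^ 2 - (2 * k * μ) * softThresh lam (μ + z) + μ^2 := by
    funext z; ring
  have i1 := (int_soft2 lam h μ).const_mul (k^2)
  have i2 := (int_soft lam h μ).const_mul (2*k*μ)
  have i3 : Integrable (fun z => k^2 * softThresh lam (μ + z) ^ 2 - (2 * k * μ) * softThresh lam (μ + z)) G := i1.sub i2
  rw [e, integral_add i3 (integrable_const _), integral_sub i1 i2, integral_const_mul, integral_const_mul]
  simp [rr, mm, SS]; ring

def hh (lam k μ : ℝ) : ℝ := (1 - k) + k * pp lam μ - k * (1 - k) * (mm lam μ / μ)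

lemma rr_deriv0 (lam : ℝ) (h : 0 < lam) (k μ : ℝ) :
    HasDerivAt (rr lam k) (k^2 * (2 * mm lam μ) - 2 * k * (1 * mm lam μ + μ * (1 - pp lam μ)) + 2 * μ) μ := by
  have := (((SS_deriv lam h μ).const_mul (k^2)).sub (((hasDerivAt_id μ).mul (mm_deriv lam h μ)).const_mul (2*k))).add ((hasDerivAt_id μ).pow 2)
  refine this.congr_deriv ?_
  simp

lemma rr_deriv (lam : ℝ) (h : 0 < lam) (k μ : ℝ) (hμ : 0 < μ) :
    HasDerivAt (rr lam k) (2 * μ * hh lam k μ) μ := by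
  refine (rr_deriv0 lam h k μ).congr_deriv ?_
  unfold hh; field_simp; ring

lemma hh_pos (lam : ℝ) (h : 0 < lam) (k μ : ℝ) (hk : 0 ≤ k) (hk1 : k ≤ 1) (hμ : 0 < μ) :
    0 < hh lam k μ := by
  have h1 : mm lam μ / μ ≤ 1 := (div_le_one hμ).2 (mm_le lam h μ hμ.le)
  have h2 := pp_pos lam h μ
  have h3 : k * (1 - k) * (mm lam μ / μ) ≤ k * (1 - k) * 1 :=
    mul_le_mul_of_nonneg_left h1 (mul_nonneg hk (by linarith))
  unfold hh
  rcases hk.eq_or_lt with hk | hk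
  · subst hk; simp
  · have := mul_pos hk h2
    nlinarith [sq_nonneg (1 - k)]

lemma hh_anti (lam : ℝ) (h : 0 < lam) (k x y : ℝ) (hk : 0 ≤ k) (hk1 : k ≤ 1) (hx : 0 < x) (hxy : x ≤ y) :
    hh lam k y ≤ hh lam k x := by
  have h1 := mul_le_mul_of_nonneg_left (mm_ratio lam h x y hx hxy) (mul_nonneg hk (sub_nonneg.2 hk1))
  have h2 := mul_le_mul_of_nonneg_left (pp_anti lam h (Set.mem_Ici.2 hx.le) (Set.mem_Ici.2 (hx.le.trans hxy)) hxy) hk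
  unfold hh; linarith

lemma rr_mono (lam : ℝ) (h : 0 < lam) (k : ℝ) (hk : 0 ≤ k) (hk1 : k ≤ 1) :
    StrictMonoOn (rr lam k) (Set.Ici 0) := by
  refine strictMonoOn_of_deriv_pos (convex_Ici 0) (fun x _ => (rr_deriv0 lam h k x).continuousAt.continuousWithinAt) fun x hx => ?_
  rw [interior_Ici] at hx
  have hx : 0 < x := hx
  rw [(rr_deriv lam h k x hx).deriv]
  have := hh_pos lam h k x hk hk1 hx
  positivity

lemma rr_conc (lam : ℝ) (h : 0 < lam) (k : ℝ) (hk : 0 ≤ k) (hk1 : k ≤ 1) :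
    ConcaveOn ℝ (Set.Ici 0) (fun t => rr lam k (√t)) := by
  have hc : Continuous (rr lam k) := continuous_iff_continuousAt.2 fun x => (rr_deriv0 lam h k x).continuousAt
  have hd : ∀ t, 0 < t → HasDerivAt (fun t => rr lam k (√t)) (hh lam k (√t)) t := by
    intro t ht
    have hs := Real.sqrt_pos.2 ht
    refine ((rr_deriv lam h k _ hs).comp t (Real.hasDerivAt_sqrt ht.ne')).congr_deriv ?_
    field_simp
  refine AntitoneOn.concaveOn_of_deriv (convex_Ici 0) (by fun_prop) ?_ ?_
  · intro x hx
    rw [interior_Ici] at hx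
    exact (hd x hx).differentiableAt.differentiableWithinAt
  · intro x hx y hy hxy
    rw [interior_Ici] at hx hy
    rw [(hd x hx).deriv, (hd y hy).deriv]
    exact hh_anti lam h k _ _ hk hk1 (Real.sqrt_pos.2 hx) (Real.sqrt_le_sqrt hxy)

lemma rr_even (lam : ℝ) (h : 0 < lam) (k μ : ℝ) : rr lam k (-μ) = rr lam k μ := by
  rw [← rr_eq lam h, ← rr_eq lam h]
  have hc := soft_cont lam h
  have : gaussianReal 0 1 = (gaussianReal 0 1).map (fun x => -x) := by simp [gaussianReal_map_neg]
  conv_lhs => rw [this, integral_map (by fun_prop) (by fun_prop)]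
  congr 1; funext z
  rw [← neg_add, soft_neg lam h]; ring

/-- Lemma `lem::elastic-net-risk`. -/
theorem statement13 (lam : ℝ) (hlam : 0 < lam) (gam : ℝ≥0∞) :
    ((∀ μ : ℝ, re lam gam (-μ) = re lam gam μ) ∧
      StrictMonoOn (re lam gam) (Set.Ici 0)) ∧
    (∀ c : ℝ, 0 < c →
      IsGreatest
        {v : ℝ | ∃ x y : ℝ, x ^ 2 + y ^ 2 = c ^ 2 ∧ v = re lam gam x + re lam gam y}
        (2 * re lam gam (c / Real.sqrt 2))) := by
  have e : re lam gam = rr lam ((1 + gam)⁻¹).toReal := funext fun μ => rr_eq lam hlam _ μ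
  rw [e]
  have hk : 0 ≤ ((1 + gam)⁻¹).toReal := ENNReal.toReal_nonneg
  have hk1 : ((1 + gam)⁻¹).toReal ≤ 1 := by
    have : (1 + gam)⁻¹ ≤ 1 := ENNReal.inv_le_one.2 le_self_add
    simpa using ENNReal.toReal_mono ENNReal.one_ne_top this
  generalize ((1 + gam)⁻¹).toReal = k at hk hk1
  refine ⟨⟨rr_even lam hlam k, rr_mono lam hlam k hk hk1⟩, fun c hc => ⟨⟨c / √2, c / √2, ?_, by ring⟩, ?_⟩⟩
  · rw [div_pow, Real.sq_sqrt (by norm_num)]; ring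
  · rintro v ⟨x, y, hxy, rfl⟩
    have hsq : ∀ x, rr lam k (√(x^2)) = rr lam k x := by
      intro x
      rw [Real.sqrt_sq_eq_abs]
      rcases abs_choice x with h | h <;> rw [h]
      exact rr_even lam hlam k x
    have := (rr_conc lam hlam k hk hk1).2 (Set.mem_Ici.2 (sq_nonneg x)) (Set.mem_Ici.2 (sq_nonneg y))
      (by norm_num : (0:ℝ) ≤ 1/2) (by norm_num : (0:ℝ) ≤ 1/2) (by norm_num)
    simp only [smul_eq_mul, hsq] at this
    have e2 : 1 / 2 * x^2 + 1 / 2 * y^2 = (c / √2)^2 := by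
      rw [div_pow, Real.sq_sqrt (by norm_num)]; linarith
    rw [e2, hsq] at this
    linarith
end
end

section
/- Consider the unit-noise Gaussian sequence model on ℝⁿ (σ = 1) and the parameter space Θ(kₙ, μₙ) = {θ ∈ ℝⁿ : ‖θ‖₀ ≤ kₙ, ‖θ‖₂² ≤ kₙ μₙ²}. Suppose εₙ = kₙ/n → 0, μₙ → ∞, and μₙ = o(√(log εₙ⁻¹)) as n → ∞. Then the soft–linear estimator η̂_E(y, λₙ, γₙ) = η̂_S(y, λₙ)/(1+γₙ) with γₙ = (2 εₙ μₙ² e^{(3/2)μₙ²})⁻¹ − 1 and λₙ = 2μₙ has supremum risk sup over θ ∈ Θ(kₙ, μₙ) of E_θ‖η̂_E(y,λₙ,γₙ) − θ‖₂² = kₙ μₙ² − (√(2/π)+o(1))·(kₙ²/n)·μₙ e^{μₙ²}. -/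
open MeasureTheory ProbabilityTheory Filter
open scoped ENNReal NNReal Topology

noncomputable section

/-- Soft–linear ("elastic") estimator `η̂_E(y,λ,γ) = η̂_S(y,λ)/(1+γ)`. -/
def elasticEst (n : ℕ) (lam gam : ℝ) : (Fin n → ℝ) → Fin n → ℝ :=
  fun y i => (Real.sign (y i) * max (|y i| - lam) 0) / (1 + gam)

abbrev gG : Measure ℝ := gaussianReal 0 1

def gphi (x : ℝ) : ℝ := gaussianPDFReal 0 1 x

lemma gphi_eq (x : ℝ) : gphi x = (Real.sqrt (2 * Real.pi))⁻¹ * Real.exp (-(x ^ 2 / 2)) := by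
  simp only [gphi, gaussianPDFReal]
  simp
  left; ring

def gH (x : ℝ) : ℝ := ∫ z, max (x + z) 0 ∂gG
def gV (x : ℝ) : ℝ := ∫ z, (max (x + z) 0) ^ 2 ∂gG
def gP (x : ℝ) : ℝ := ∫ z in Set.Ioi (-x), gphi z
def gJ (j : ℕ) (a : ℝ) : ℝ :=
  ∫ t in Set.Ioi (0 : ℝ), t ^ j * Real.exp (-t) * Real.exp (-(t ^ 2 / (2 * a ^ 2)))

lemma gphi_continuous : Continuous gphi := by
  have : gphi = fun x => (Real.sqrt (2 * Real.pi))⁻¹ * Real.exp (-(x ^ 2 / 2)) := funext gphi_eq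
  rw [this]; fun_prop

lemma gphi_integrable : Integrable gphi := integrable_gaussianPDFReal 0 1

lemma gG_int_id : Integrable (fun z : ℝ => z) gG := by
  have := (memLp_id_gaussianReal (μ := 0) (v := 1) 1)
  exact this.integrable (by simp)

lemma gG_int_sq : Integrable (fun z : ℝ => z ^ 2) gG := by
  have := (memLp_id_gaussianReal (μ := 0) (v := 1) 2)
  exact this.integrable_sq

lemma gP_hasDerivAt (x : ℝ) : HasDerivAt gP (gphi x) x := by
  have h1 : ∀ y, gP y = (∫ z in (-y)..0, gphi z) + gP 0 := by
    intro y
    rw [← intervalIntegral.integral_Ioi_sub_Ioi' gphi_integrable.integrableOn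
      gphi_integrable.integrableOn]
    simp [gP]
  have h2 : HasDerivAt (fun u => ∫ z in u..0, gphi z) (-gphi (-x)) (-x) :=
    intervalIntegral.integral_hasDerivAt_left (gphi_integrable.intervalIntegrable)
      (gphi_continuous.stronglyMeasurableAtFilter _ _) gphi_continuous.continuousAt
  have h3 := (h2.comp x (hasDerivAt_neg x)).add_const (gP 0)
  have h4 : gP = fun y => (∫ z in (-y)..0, gphi z) + gP 0 := funext h1
  rw [h4]
  refine HasDerivAt.congr_deriv h3 ?_
  simp [gphi_eq]

lemma gH_integrable (x : ℝ) : Integrable (fun z => max (x + z) 0) gG := by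
  have h : Integrable (fun z : ℝ => x + z) gG := (integrable_const x).add gG_int_id
  exact h.pos_part

lemma gP_eq (x : ℝ) : ∫ z, (if -x < z then (1 : ℝ) else 0) ∂gG = gP x := by
  rw [integral_gaussianReal_eq_integral_smul one_ne_zero, gP, ← integral_indicator measurableSet_Ioi]
  congr 1; ext z
  by_cases h : -x < z <;> simp [h, gphi, Set.indicator]

lemma gP_nonneg (x : ℝ) : 0 ≤ gP x := by
  rw [← gP_eq]; exact integral_nonneg fun z => by dsimp; split_ifs <;> norm_num

lemma gP_le_one (x : ℝ) : gP x ≤ 1 := by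
  have h0 : gP x ≤ ∫ z, gphi z := by
    exact setIntegral_le_integral gphi_integrable
      (Eventually.of_forall fun z => gaussianPDFReal_nonneg 0 1 z)
  exact h0.trans_eq (integral_gaussianPDFReal_eq_one 0 one_ne_zero)

lemma gH_hasDerivAt (x : ℝ) : HasDerivAt gH (gP x) x := by
  rw [← gP_eq]
  refine (hasDerivAt_integral_of_dominated_loc_of_lip (μ := gG) (F := fun x z => max (x + z) 0)
    (bound := fun _ => 1) (s := Set.univ) (x₀ := x) univ_mem
    (Eventually.of_forall fun y => (gH_integrable y).aestronglyMeasurable)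
    (gH_integrable x) ?_ ?_ (integrable_const _) ?_).2
  · exact (Measurable.ite measurableSet_Ioi measurable_const
      measurable_const).aestronglyMeasurable
  · refine Eventually.of_forall fun z => ?_
    apply LipschitzOnWith.of_dist_le_mul
    intro a _ b _
    simp only [Real.dist_eq, map_one, NNReal.coe_one, one_mul]
    refine (abs_max_sub_max_le_abs _ _ _).trans (by simp)
  · have := nullSingletonClass_gaussianReal (μ := 0) (v := 1) one_ne_zero
    have : ∀ᵐ z ∂gG, z ≠ -x := by simp [ae_iff]
    filter_upwards [this] with z hz
    rcases lt_or_gt_of_ne hz with h | h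
    · rw [if_neg (by linarith)]
      have : (fun y => max (y + z) 0) =ᶠ[𝓝 x] fun _ => 0 := by
        filter_upwards [gt_mem_nhds (show x < -z by linarith)] with y hy
        exact max_eq_right (by linarith)
      exact (hasDerivAt_const x (0:ℝ)).congr_of_eventuallyEq this
    · rw [if_pos h]
      have : (fun y => max (y + z) 0) =ᶠ[𝓝 x] fun y => y + z := by
        filter_upwards [lt_mem_nhds (show -z < x by linarith)] with y hy
        exact max_eq_left (by linarith)
      exact ((hasDerivAt_id x).add_const z).congr_of_eventuallyEq this

/-- mean of soft thresholding -/
def gm (l θ : ℝ) : ℝ := gH (θ - l) - gH (-θ - l)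

lemma gm_neg (l θ : ℝ) : gm l (-θ) = - gm l θ := by simp [gm]

lemma gm_zero (l : ℝ) : gm l 0 = 0 := by simp [gm]

def gm' (l θ : ℝ) : ℝ := gP (θ - l) + gP (-θ - l)

lemma gm_hasDerivAt (l θ : ℝ) : HasDerivAt (gm l) (gm' l θ) θ := by
  have h1 := (gH_hasDerivAt (θ - l)).comp θ ((hasDerivAt_id θ).sub_const l)
  have h2 := (gH_hasDerivAt (-θ - l)).comp θ ((hasDerivAt_neg θ).sub_const l)
  refine HasDerivAt.congr_deriv (h1.sub h2) ?_
  simp [gm']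

lemma gm'_hasDerivAt (l θ : ℝ) : HasDerivAt (gm' l) (gphi (θ - l) - gphi (-θ - l)) θ := by
  have h1 := (gP_hasDerivAt (θ - l)).comp θ ((hasDerivAt_id θ).sub_const l)
  have h2 := (gP_hasDerivAt (-θ - l)).comp θ ((hasDerivAt_neg θ).sub_const l)
  refine HasDerivAt.congr_deriv (h1.add h2) ?_
  simp; ring

lemma gm_convex (l : ℝ) (hl : 0 ≤ l) : ConvexOn ℝ (Set.Ici 0) (gm l) := by
  have hd : deriv (gm l) = gm' l := funext fun θ => (gm_hasDerivAt l θ).deriv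
  apply convexOn_of_deriv2_nonneg' (convex_Ici 0)
  · exact fun θ _ => (gm_hasDerivAt l θ).differentiableAt.differentiableWithinAt
  · rw [hd]
    exact fun θ _ => (gm'_hasDerivAt l θ).differentiableAt.differentiableWithinAt
  · intro θ hθ
    simp only [Set.mem_Ici] at hθ
    simp only [Function.iterate_succ, Function.iterate_zero, Function.comp, id]
    rw [hd, (gm'_hasDerivAt l θ).deriv, gphi_eq, gphi_eq, sub_nonneg]
    have : (θ - l) ^ 2 ≤ (-θ - l) ^ 2 := by nlinarith [mul_nonneg hl hθ]
    exact mul_le_mul_of_nonneg_left (Real.exp_le_exp.2 (by linarith)) (by positivity)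

lemma gm_tangent (l : ℝ) (hl : 0 ≤ l) (u θ : ℝ) (hu : 0 < u) (hθ : 0 ≤ θ) :
    gm l u + gm' l u * (θ - u) ≤ gm l θ := by
  rcases lt_trichotomy u θ with h | h | h
  · have := (gm_convex l hl).le_slope_of_hasDerivAt (Set.mem_Ici.2 hu.le) (Set.mem_Ici.2 hθ) h
      (gm_hasDerivAt l u)
    rw [slope_def_field, le_div_iff₀ (by linarith)] at this
    linarith
  · simp [h]
  · have := (gm_convex l hl).slope_le_of_hasDerivAt (Set.mem_Ici.2 hθ) (Set.mem_Ici.2 hu.le) h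
      (gm_hasDerivAt l u)
    rw [slope_def_field, div_le_iff₀ (by linarith)] at this
    linarith

lemma gm_key (l : ℝ) (hl : 0 ≤ l) (u : ℝ) (hu : 0 < u) :
    ∃ s : ℝ, s ≤ 2 ∧ ∀ θ, u * gm l u + s * (θ ^ 2 - u ^ 2) ≤ θ * gm l θ := by
  have h0 := gm_tangent l hl u 0 hu le_rfl
  rw [gm_zero] at h0
  have hle : gm l u / u ≤ gm' l u := by rw [div_le_iff₀ hu]; linarith
  have hp : gm' l u ≤ 2 := by
    have := gP_le_one (u - l); have := gP_le_one (-u - l); unfold gm'; linarith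
  have key : ∀ θ, 0 ≤ θ → u * gm l u + ((gm' l u + gm l u / u) / 2) * (θ ^ 2 - u ^ 2)
      ≤ θ * gm l θ := by
    intro θ hθ
    have h1 := gm_tangent l hl u θ hu hθ
    have h2 := mul_le_mul_of_nonneg_left h1 hθ
    refine le_trans ?_ h2
    obtain ⟨q, hq⟩ : ∃ q, gm l u = q * u := ⟨gm l u / u, by field_simp⟩
    have hq' : gm l u / u = q := by rw [hq]; field_simp
    rw [hq'] at hle ⊢
    rw [hq]
    nlinarith [mul_nonneg (sub_nonneg.2 hle) (sq_nonneg (θ - u))]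
  refine ⟨(gm' l u + gm l u / u) / 2, by linarith, fun θ => ?_⟩
  rcases le_total 0 θ with h | h
  · exact key θ h
  · have := key (-θ) (by linarith)
    rw [gm_neg] at this
    simpa using this

lemma gJ_dom (j : ℕ) : Integrable (fun t : ℝ => t ^ j * Real.exp (-t))
    (volume.restrict (Set.Ioi 0)) := by
  have h := Real.GammaIntegral_convergent (s := (j : ℝ) + 1) (by positivity)
  refine h.congr ?_
  filter_upwards [ae_restrict_mem measurableSet_Ioi] with t ht
  simp [Real.rpow_natCast, mul_comm]

lemma gJ_lim (j : ℕ) {u : ℕ → ℝ} (hu : Tendsto u atTop atTop) :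
    Tendsto (fun n => gJ j (u n)) atTop (𝓝 (j.factorial : ℝ)) := by
  have h : (j.factorial : ℝ) = ∫ t in Set.Ioi (0:ℝ), t ^ j * Real.exp (-t) := by
    rw [← Real.Gamma_nat_eq_factorial, Real.Gamma_eq_integral (by positivity)]
    apply setIntegral_congr_fun measurableSet_Ioi
    intro t ht
    simp [Real.rpow_natCast, mul_comm]
  rw [h]
  refine tendsto_integral_filter_of_dominated_convergence
    (fun t : ℝ => t ^ j * Real.exp (-t)) ?_ ?_ (gJ_dom j) ?_
  · refine Eventually.of_forall fun n => ?_
    apply Continuous.aestronglyMeasurable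
    fun_prop
  · refine Eventually.of_forall fun n => ?_
    filter_upwards [ae_restrict_mem measurableSet_Ioi] with t ht
    have ht : 0 < t := ht
    rw [Real.norm_of_nonneg (by positivity)]
    have : Real.exp (-(t ^ 2 / (2 * u n ^ 2))) ≤ 1 := by
      rw [Real.exp_le_one_iff]; have : 0 ≤ t ^ 2 / (2 * u n ^ 2) := by positivity
      linarith
    exact mul_le_of_le_one_right (by positivity) this
  · refine Eventually.of_forall fun t => ?_
    have h1 : Tendsto (fun n => 2 * u n ^ 2) atTop atTop :=
      ((tendsto_pow_atTop two_ne_zero).comp hu).const_mul_atTop two_pos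
    have h2 := (h1.const_div_atTop (t ^ 2)).neg
    have h3 := ((Real.continuous_exp.tendsto _).comp h2).const_mul (t ^ j * Real.exp (-t))
    simpa using h3

lemma gpow_eq (j : ℕ) (hj : j ≠ 0) (a : ℝ) (ha : 0 < a) :
    ∫ z, (max (-a + z) 0) ^ j ∂gG = gphi a / a ^ (j + 1) * gJ j a := by
  rw [integral_gaussianReal_eq_integral_smul one_ne_zero]
  have e1 : (∫ z, gaussianPDFReal 0 1 z • (max (-a + z) 0) ^ j)
      = ∫ z, gphi (a + z) * (max z 0) ^ j := by
    rw [← integral_add_left_eq_self _ a]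
    congr 1; ext z
    simp [gphi]
  have e2 : (∫ z, gphi (a + z) * (max z 0) ^ j) = ∫ z in Set.Ioi 0, gphi (a + z) * z ^ j := by
    rw [← integral_indicator measurableSet_Ioi]
    congr 1; ext z
    by_cases hz : 0 < z
    · simp [Set.indicator, hz, hz.le]
    · simp [Set.indicator, hz, max_eq_right (not_lt.1 hz), hj]
  rw [e1, e2]
  have e3 := integral_comp_mul_left_Ioi (fun z => gphi (a + z) * z ^ j) 0 (inv_pos.2 ha)
  rw [mul_zero, inv_inv, smul_eq_mul] at e3
  have e4 : ∫ z in Set.Ioi 0, gphi (a + z) * z ^ j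
     = a⁻¹ * ∫ t in Set.Ioi (0:ℝ), gphi (a + a⁻¹ * t) * (a⁻¹ * t) ^ j := by
    rw [e3]; field_simp
  rw [e4, gJ, ← integral_const_mul, ← integral_const_mul]
  congr 1; ext t
  have : Real.exp (-((a + a⁻¹ * t) ^ 2 / 2))
      = Real.exp (-(a ^ 2 / 2)) * (Real.exp (-t) * Real.exp (-(t ^ 2 / (2 * a ^ 2)))) := by
    rw [← Real.exp_add, ← Real.exp_add]; congr 1; field_simp; ring
  rw [gphi_eq, gphi_eq, this, mul_pow, inv_pow]
  field_simp
  ring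

lemma gH_eq (a : ℝ) (ha : 0 < a) : gH (-a) = gphi a / a ^ 2 * gJ 1 a := by
  have := gpow_eq 1 one_ne_zero a ha
  simpa [gH] using this

lemma gV_eq (a : ℝ) (ha : 0 < a) : gV (-a) = gphi a / a ^ 3 * gJ 2 a :=
  gpow_eq 2 two_ne_zero a ha

def gsoft (l y : ℝ) : ℝ := max (y - l) 0 - max (-y - l) 0

lemma gsoft_eq (l y : ℝ) (hl : 0 ≤ l) : Real.sign y * max (|y| - l) 0 = gsoft l y := by
  unfold gsoft
  rcases lt_trichotomy y 0 with h | h | h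
  · rw [Real.sign_of_neg h, abs_of_neg h, max_eq_right (by linarith : y - l ≤ 0)]; ring
  · subst h; simp
  · rw [Real.sign_of_pos h, abs_of_pos h, max_eq_right (by linarith : -y - l ≤ 0)]; ring

lemma gsoft_sq (l y : ℝ) (hl : 0 ≤ l) :
    gsoft l y ^ 2 = (max (y - l) 0) ^ 2 + (max (-y - l) 0) ^ 2 := by
  unfold gsoft
  rcases le_total 0 y with h | h
  · rw [max_eq_right (by linarith : -y - l ≤ 0)]; ring
  · rw [max_eq_right (by linarith : y - l ≤ 0)]; ring

lemma gsoft_conv (l x y : ℝ) (hl : 0 ≤ l) :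
    gsoft l y ^ 2 - gsoft l x ^ 2 ≤ 2 * gsoft l y * (y - x) := by
  unfold gsoft
  rcases max_cases (y - l) 0 with ⟨h1, h1'⟩ | ⟨h1, h1'⟩ <;>
  rcases max_cases (-y - l) 0 with ⟨h2, h2'⟩ | ⟨h2, h2'⟩ <;>
  rcases max_cases (x - l) 0 with ⟨h3, h3'⟩ | ⟨h3, h3'⟩ <;>
  rcases max_cases (-x - l) 0 with ⟨h4, h4'⟩ | ⟨h4, h4'⟩ <;>
  rw [h1, h2, h3, h4] <;> nlinarith [sq_nonneg (x - y)]

lemma gsoft_continuous (l : ℝ) : Continuous (gsoft l) := by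
  unfold gsoft; fun_prop

lemma gsoft_abs (l y : ℝ) (hl : 0 ≤ l) : |gsoft l y| ≤ |y| := by
  unfold gsoft
  rcases le_total 0 y with h | h
  · rw [max_eq_right (by linarith : -y - l ≤ 0), abs_of_nonneg h, sub_zero,
      abs_of_nonneg (le_max_right _ _)]
    exact max_le (by linarith) h
  · rw [max_eq_right (by linarith : y - l ≤ 0), abs_of_nonpos h, zero_sub, abs_neg,
      abs_of_nonneg (le_max_right _ _)]
    exact max_le (by linarith) (by linarith)

lemma gG_int_add_sq (θ : ℝ) : Integrable (fun z : ℝ => (θ + z) ^ 2) gG := by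
  have : Integrable (fun z : ℝ => θ ^ 2 + 2 * θ * z + z ^ 2) gG :=
    ((integrable_const (θ ^ 2)).add (gG_int_id.const_mul (2 * θ))).add gG_int_sq
  refine this.congr (Eventually.of_forall fun z => ?_)
  simp only; ring

lemma gsoft_int (l θ : ℝ) (hl : 0 ≤ l) : Integrable (fun z => gsoft l (θ + z)) gG := by
  have h : Integrable (fun z : ℝ => θ + z) gG := (integrable_const θ).add gG_int_id
  refine h.mono ?_ (Eventually.of_forall fun z => gsoft_abs l _ hl)
  exact ((gsoft_continuous l).comp (continuous_const.add continuous_id)).aestronglyMeasurable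

lemma gsoft_sq_int (l θ : ℝ) (hl : 0 ≤ l) : Integrable (fun z => gsoft l (θ + z) ^ 2) gG := by
  refine (gG_int_add_sq θ).mono ?_ (Eventually.of_forall fun z => ?_)
  · exact (((gsoft_continuous l).comp
      (continuous_const.add continuous_id)).pow 2).aestronglyMeasurable
  · simp only [norm_pow, Real.norm_eq_abs]
    exact pow_le_pow_left₀ (abs_nonneg _) (gsoft_abs l _ hl) 2

lemma gG_neg (f : ℝ → ℝ) (hf : Continuous f) : ∫ z, f (-z) ∂gG = ∫ z, f z ∂gG := by
  have h : gG.map (fun x => -x) = gG := by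
    simpa using (gaussianReal_map_neg (μ := 0) (v := 1))
  conv_rhs => rw [← h]
  rw [integral_map (by fun_prop) hf.aestronglyMeasurable]

lemma gm_eq (l θ : ℝ) (hl : 0 ≤ l) : ∫ z, gsoft l (θ + z) ∂gG = gm l θ := by
  have e2 : (∫ z, max (-θ - l - z) 0 ∂gG) = gH (-θ - l) := by
    have := gG_neg (fun z => max (-θ - l + z) 0) (by fun_prop)
    simpa [gH, sub_eq_add_neg] using this
  have i2 : Integrable (fun z => max (-θ - l - z) 0) gG := by
    have h : Integrable (fun z : ℝ => -θ - l - z) gG := (integrable_const _).sub gG_int_id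
    exact h.pos_part
  rw [gm, ← e2, gH, ← integral_sub (gH_integrable _) i2]
  congr 1; ext z
  unfold gsoft
  congr 2 <;> ring

def gw (l θ : ℝ) : ℝ := ∫ z, gsoft l (θ + z) ^ 2 ∂gG

lemma gw_zero (l : ℝ) (hl : 0 ≤ l) : gw l 0 = 2 * gV (-l) := by
  have c1 : Continuous fun z : ℝ => (max (-l + z) 0) ^ 2 := by fun_prop
  have e2 := gG_neg _ c1
  have i1 : Integrable (fun z => (max (-l + z) 0) ^ 2) gG := by
    refine (gG_int_add_sq (-l)).mono c1.aestronglyMeasurable (Eventually.of_forall fun z => ?_)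
    simp only [norm_pow, Real.norm_eq_abs]
    refine pow_le_pow_left₀ (abs_nonneg _) ?_ 2
    rw [abs_of_nonneg (le_max_right _ _)]
    exact max_le (le_abs_self _) (abs_nonneg _)
  have i2 : Integrable (fun z => (max (-l + -z) 0) ^ 2) gG := by
    refine (gG_int_add_sq l).mono (Continuous.aestronglyMeasurable (by fun_prop))
      (Eventually.of_forall fun z => ?_)
    simp only [norm_pow, Real.norm_eq_abs]
    refine pow_le_pow_left₀ (abs_nonneg _) ?_ 2
    rw [abs_of_nonneg (le_max_right _ _)]
    exact max_le (by rw [← neg_add]; exact neg_le_abs _) (abs_nonneg _)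
  have : gw l 0 = ∫ z, ((max (-l + z) 0) ^ 2 + (max (-l + -z) 0) ^ 2) ∂gG := by
    unfold gw
    congr 1; ext z
    rw [gsoft_sq l _ hl, zero_add, sub_eq_neg_add, sub_eq_neg_add]
  rw [this, integral_add i1 i2, e2, gV]; ring

lemma gw_le (l θ : ℝ) (hl : 0 ≤ l) : gw l θ - gw l 0 ≤ 2 * (θ * gm l θ) := by
  rw [← gm_eq l θ hl, gw, gw, ← integral_sub (gsoft_sq_int l θ hl) (gsoft_sq_int l 0 hl),
    ← mul_assoc, ← integral_const_mul]
  refine integral_mono ((gsoft_sq_int l θ hl).sub (gsoft_sq_int l 0 hl))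
    ((gsoft_int l θ hl).const_mul _) fun z => ?_
  have := gsoft_conv l (0 + z) (θ + z) hl
  simp only
  linarith

lemma gw_ge (l θ : ℝ) (hl : 0 ≤ l) : gw l 0 ≤ gw l θ := by
  rw [← sub_nonpos]
  have h : gw l 0 - gw l θ ≤ (-2 * θ) * gm l 0 := by
    rw [← gm_eq l 0 hl, gw, gw, ← integral_sub (gsoft_sq_int l 0 hl) (gsoft_sq_int l θ hl),
      ← integral_const_mul]
    refine integral_mono ((gsoft_sq_int l 0 hl).sub (gsoft_sq_int l θ hl))
      ((gsoft_int l 0 hl).const_mul _) fun z => ?_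
    have := gsoft_conv l (θ + z) (0 + z) hl
    simp only
    linarith
  rw [gm_zero] at h
  linarith

def gr (l b θ : ℝ) : ℝ := θ ^ 2 - 2 * b * (θ * gm l θ) + b ^ 2 * gw l θ

lemma gr_eq (l b θ : ℝ) (hl : 0 ≤ l) :
    Integrable (fun z => (b * gsoft l (θ + z) - θ) ^ 2) gG ∧
    ∫ z, (b * gsoft l (θ + z) - θ) ^ 2 ∂gG = gr l b θ := by
  have e : (fun z => (b * gsoft l (θ + z) - θ) ^ 2) =
      fun z => (θ ^ 2 - 2 * b * θ * gsoft l (θ + z)) + b ^ 2 * gsoft l (θ + z) ^ 2 := by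
    ext z; ring
  have i1 := (gsoft_int l θ hl).const_mul (2 * b * θ)
  have i2 := (gsoft_sq_int l θ hl).const_mul (b ^ 2)
  have i0 : Integrable (fun _ : ℝ => θ ^ 2) gG := integrable_const _
  have i3 : Integrable (fun z => θ ^ 2 - 2 * b * θ * gsoft l (θ + z)) gG := i0.sub i1
  rw [e]
  refine ⟨i3.add i2, ?_⟩
  rw [integral_add i3 i2, integral_sub i0 i1, integral_const_mul, integral_const_mul,
    gm_eq l θ hl]
  simp [gr, gw]; ring

lemma gr_nonneg (l b θ : ℝ) (hl : 0 ≤ l) : 0 ≤ gr l b θ := by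
  rw [← (gr_eq l b θ hl).2]; exact integral_nonneg fun z => sq_nonneg _

lemma risk_eq_s14 (n : ℕ) (l g : ℝ) (hl : 0 ≤ l) (θ : Fin n → ℝ) :
    risk n 1 (elasticEst n l g) θ = ENNReal.ofReal (∑ i, gr l (1 + g)⁻¹ (θ i)) := by
  have hc : ∀ i, Continuous (fun y : ℝ => ((1 + g)⁻¹ * gsoft l y - θ i) ^ 2) := fun i =>
    ((continuous_const.mul (gsoft_continuous l)).sub continuous_const).pow 2
  have hm : ∀ i, Measurable (fun y : ℝ => ENNReal.ofReal (((1 + g)⁻¹ * gsoft l y - θ i) ^ 2)) :=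
    fun i => (hc i).measurable.ennreal_ofReal
  unfold risk gsm
  have e : ∀ y : Fin n → ℝ, ENNReal.ofReal (∑ i, (elasticEst n l g y i - θ i) ^ 2)
      = ∑ i, ENNReal.ofReal (((1 + g)⁻¹ * gsoft l (y i) - θ i) ^ 2) := by
    intro y
    rw [ENNReal.ofReal_sum_of_nonneg fun i _ => sq_nonneg _]
    refine Finset.sum_congr rfl fun i _ => ?_
    rw [elasticEst, gsoft_eq l _ hl, div_eq_inv_mul]
  simp_rw [e]
  have hm2 : ∀ i ∈ (Finset.univ : Finset (Fin n)), Measurable (fun y : Fin n → ℝ =>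
      ENNReal.ofReal (((1 + g)⁻¹ * gsoft l (y i) - θ i) ^ 2)) :=
    fun i _ => (hm i).comp (measurable_pi_apply i)
  rw [lintegral_finsetSum _ hm2,
    ENNReal.ofReal_sum_of_nonneg fun i _ => gr_nonneg _ _ _ hl]
  refine Finset.sum_congr rfl fun i _ => ?_
  have hp := measurePreserving_eval (fun i => gaussianReal (θ i) ((1 ^ 2 : ℝ).toNNReal)) i
  rw [← (gr_eq l _ _ hl).2, ofReal_integral_eq_lintegral_ofReal (gr_eq l _ _ hl).1
    (Eventually.of_forall fun z => sq_nonneg _)]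
  have e2 : gG.map (fun x => θ i + x) = gaussianReal (θ i) ((1 ^ 2 : ℝ).toNNReal) := by
    have := gaussianReal_map_const_add (μ := 0) (v := 1) (θ i)
    simpa using this
  rw [hp.lintegral_comp (hm i), ← e2, lintegral_map (hm i) (by fun_prop)]

lemma sum_upper (n k : ℕ) (l b u : ℝ) (hl : 0 ≤ l) (hu : 0 < u) (hb : 0 ≤ b) (hb4 : b ≤ 1 / 4)
    (θ : Fin n → ℝ) (hθ : θ ∈ paramSet n k u) :
    ∑ i, gr l b (θ i) ≤ k * u ^ 2 + n * b ^ 2 * gw l 0 - (1 - b) * (2 * b * k * u * gm l u) := by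
  classical
  obtain ⟨s, hs, hkey⟩ := gm_key l hl u hu
  obtain ⟨hc, hq⟩ := hθ
  have h0 : u * gm l u - s * u ^ 2 ≤ 0 := by have := hkey 0; simp at this; linarith
  have h1 : ∀ i, gr l b (θ i) ≤ θ i ^ 2 + b ^ 2 * gw l 0 - 2 * b * (1 - b) * (θ i * gm l (θ i)) := by
    intro i
    have := mul_le_mul_of_nonneg_left (gw_le l (θ i) hl) (sq_nonneg b)
    unfold gr; linarith
  have h2 : ∀ i, (if θ i ≠ 0 then u * gm l u - s * u ^ 2 else 0) + s * θ i ^ 2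
      ≤ θ i * gm l (θ i) := by
    intro i
    by_cases h : θ i = 0
    · simp [h]
    · rw [if_pos h]; linarith [hkey (θ i)]
  have h3 : (k : ℝ) * (u * gm l u - s * u ^ 2) + s * ∑ i, θ i ^ 2 ≤ ∑ i, θ i * gm l (θ i) := by
    refine le_trans ?_ (Finset.sum_le_sum fun i _ => h2 i)
    rw [Finset.sum_add_distrib, ← Finset.mul_sum, ← Finset.sum_filter, Finset.sum_const,
      nsmul_eq_mul]
    have : (((Finset.univ.filter fun i => θ i ≠ 0).card : ℕ) : ℝ) ≤ k := by
      have e : {i | θ i ≠ 0} = ((Finset.univ.filter fun i => θ i ≠ 0 : Finset (Fin n)) : Set (Fin n)) := by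
        ext; simp
      rw [e, Set.ncard_coe_finset] at hc
      exact_mod_cast hc
    nlinarith
  have h4 := Finset.sum_le_sum fun i (_ : i ∈ Finset.univ) => h1 i
  rw [Finset.sum_sub_distrib, Finset.sum_add_distrib, ← Finset.mul_sum, ← Finset.mul_sum] at h4
  simp only [Finset.sum_const, Finset.card_univ, Fintype.card_fin, nsmul_eq_mul] at h4
  have hbb : 0 ≤ 2 * b * (1 - b) := by nlinarith
  have h5 := mul_le_mul_of_nonneg_left h3 hbb
  have h6 : 2 * b * (1 - b) * s ≤ 1 := by nlinarith
  have h7 : 0 ≤ (1 - 2 * b * (1 - b) * s) * (k * u ^ 2 - ∑ i, θ i ^ 2) :=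
    mul_nonneg (by linarith) (by linarith)
  nlinarith

lemma sum_lower (n k : ℕ) (hkn : k ≤ n) (l b u : ℝ) (hl : 0 ≤ l) :
    ∃ θ ∈ paramSet n k u,
    k * u ^ 2 + n * b ^ 2 * gw l 0 - (2 * b * k * u * gm l u) ≤ ∑ i, gr l b (θ i) := by
  classical
  have hcard : (Finset.univ.filter fun i : Fin n => (i : ℕ) < k).card = k := by
    rw [Fin.card_filter_val_lt]; simp [hkn]
  have hs : ∀ c : ℝ, ∑ i : Fin n, (if (i : ℕ) < k then c else 0) = k * c := by
    intro c; rw [← Finset.sum_filter, Finset.sum_const, hcard, nsmul_eq_mul]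
  refine ⟨fun i => if (i : ℕ) < k then u else 0, ⟨?_, ?_⟩, ?_⟩
  · calc _ ≤ ((Finset.univ.filter fun i : Fin n => (i : ℕ) < k : Finset (Fin n)) : Set (Fin n)).ncard := by
          apply Set.ncard_le_ncard _ (Set.toFinite _)
          intro i hi
          by_contra h
          simp at h hi
          omega
      _ = k := by rw [Set.ncard_coe_finset, hcard]
  · refine le_of_eq ?_
    rw [← hs]
    refine Finset.sum_congr rfl fun i _ => ?_
    by_cases h : (i : ℕ) < k
    · simp only [if_pos h]
    · simp only [if_neg h]; norm_num
  · have : ∑ i : Fin n, ((if (i : ℕ) < k then u ^ 2 - 2 * b * (u * gm l u) else 0) + b ^ 2 * gw l 0)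
        ≤ ∑ i : Fin n, gr l b (if (i : ℕ) < k then u else 0) := by
      refine Finset.sum_le_sum fun i _ => ?_
      unfold gr
      have := mul_le_mul_of_nonneg_left (gw_ge l u hl) (sq_nonneg b)
      split_ifs
      · linarith
      · simp
    refine le_trans (le_of_eq ?_) this
    rw [Finset.sum_add_distrib, hs]
    simp; ring

/-- Lemma `lem:optimally-tuned_elastic`: unit-noise model,
supremum risk of `η̂_E(y, 2μₙ, (2εₙμₙ²e^{(3/2)μₙ²})⁻¹ − 1)` over `Θ(kₙ, μₙ)`. -/
theorem statement14
    (k : ℕ → ℕ) (μ ε : ℕ → ℝ)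
    (hk : ∀ n, 1 ≤ n → 1 ≤ k n ∧ k n ≤ n)
    (hμpos : ∀ n, 0 < μ n)
    (hε : ∀ n, ε n = (k n : ℝ) / n)
    (hε0 : Tendsto ε atTop (𝓝 0)) (hμtop : Tendsto μ atTop atTop)
    (hμo : Tendsto (fun n => μ n / Real.sqrt (Real.log (ε n)⁻¹)) atTop (𝓝 0)) :
    ∃ c : ℕ → ℝ, Tendsto c atTop (𝓝 (Real.sqrt (2 / Real.pi))) ∧
      ∀ᶠ n : ℕ in atTop,
        (⨆ θ ∈ paramSet n (k n) (μ n),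
            risk n 1
              (elasticEst n (2 * μ n)
                ((2 * ε n * μ n ^ 2 * Real.exp (3 / 2 * μ n ^ 2))⁻¹ - 1)) θ) =
          ENNReal.ofReal ((k n : ℝ) * μ n ^ 2 -
            c n * ((k n : ℝ) ^ 2 / n) * μ n * Real.exp (μ n ^ 2)) := by
  classical
  set b : ℕ → ℝ := fun n => 2 * ε n * μ n ^ 2 * Real.exp (3 / 2 * μ n ^ 2) with hb
  set W : ℕ → ℝ := fun n => ((k n : ℝ) ^ 2 / n) * μ n * Real.exp (μ n ^ 2) with hW
  set R : ℕ → ℝ≥0∞ := fun n => ⨆ θ ∈ paramSet n (k n) (μ n),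
            risk n 1 (elasticEst n (2 * μ n) ((b n)⁻¹ - 1)) θ with hR
  have hεpos : ∀ n, 1 ≤ n → 0 < ε n := by
    intro n hn
    rw [hε]
    have := (hk n hn).1
    have h1 : (0 : ℝ) < k n := by exact_mod_cast this
    have h2 : (0 : ℝ) < n := by exact_mod_cast hn
    positivity
  have hbpos : ∀ n, 1 ≤ n → 0 < b n := by
    intro n hn
    have := hεpos n hn
    have := hμpos n
    simp only [hb]; positivity
  have hWpos : ∀ n, 1 ≤ n → 0 < W n := by
    intro n hn
    have := (hk n hn).1
    have h1 : (0 : ℝ) < k n := by exact_mod_cast this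
    have h2 : (0 : ℝ) < n := by exact_mod_cast hn
    have := hμpos n
    simp only [hW]; positivity
  have hμ2 : Tendsto (fun n => μ n ^ 2) atTop atTop := (tendsto_pow_atTop two_ne_zero).comp hμtop
  have hexp : Tendsto (fun n => Real.exp (-(μ n ^ 2))) atTop (𝓝 0) :=
    Real.tendsto_exp_neg_atTop_nhds_zero.comp hμ2
  have hb0 : Tendsto b atTop (𝓝 0) := by
    have hub : Tendsto (fun n => 2 * Real.exp (-(μ n ^ 2))) atTop (𝓝 0) := by
      simpa using hexp.const_mul 2
    refine tendsto_of_tendsto_of_tendsto_of_le_of_le' tendsto_const_nhds hub ?_ ?_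
    · filter_upwards [eventually_ge_atTop 1] with n hn using (hbpos n hn).le
    · filter_upwards [eventually_ge_atTop 1, hε0.eventually (gt_mem_nhds one_pos),
        hμo.eventually (gt_mem_nhds (show (0:ℝ) < 1 / 4 by norm_num))] with n hn h1 h2
      have hp := hεpos n hn
      have hL : 0 < Real.log (ε n)⁻¹ := Real.log_pos ((one_lt_inv₀ hp).2 h1)
      rw [div_lt_iff₀ (Real.sqrt_pos.2 hL)] at h2
      have h3 : 16 * μ n ^ 2 ≤ Real.log (ε n)⁻¹ := by
        nlinarith [Real.sq_sqrt hL.le, Real.sqrt_nonneg (Real.log (ε n)⁻¹), hμpos n]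
      have h4 : ε n ≤ Real.exp (-(16 * μ n ^ 2)) := by
        rw [← Real.log_le_iff_le_exp hp]
        rw [Real.log_inv] at h3; linarith
      have h5 : μ n ^ 2 ≤ Real.exp (μ n ^ 2) := by linarith [Real.add_one_le_exp (μ n ^ 2)]
      calc b n = 2 * (ε n * μ n ^ 2 * Real.exp (3 / 2 * μ n ^ 2)) := by simp only [hb]; ring
        _ ≤ 2 * (Real.exp (-(16 * μ n ^ 2)) * Real.exp (μ n ^ 2) * Real.exp (3 / 2 * μ n ^ 2)) := by
          gcongr
        _ ≤ 2 * Real.exp (-(μ n ^ 2)) := by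
          rw [← Real.exp_add, ← Real.exp_add]
          gcongr
          nlinarith [sq_nonneg (μ n)]
  -- main quantities
  set X : ℕ → ℝ := fun n => n * b n ^ 2 * gw (2 * μ n) 0 with hX
  set Y : ℕ → ℝ := fun n => 2 * b n * k n * μ n * gm (2 * μ n) (μ n) with hY
  set K : ℝ := (Real.sqrt (2 * Real.pi))⁻¹ with hK
  have hKval : 2 * K = Real.sqrt (2 / Real.pi) := by
    rw [hK, eq_comm, Real.sqrt_eq_iff_mul_self_eq (by positivity) (by positivity)]
    have : Real.sqrt (2 * Real.pi) * Real.sqrt (2 * Real.pi) = 2 * Real.pi :=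
      Real.mul_self_sqrt (by positivity)
    have h2 : 2 * (Real.sqrt (2 * Real.pi))⁻¹ * (2 * (Real.sqrt (2 * Real.pi))⁻¹)
      = 4 * (Real.sqrt (2 * Real.pi) * Real.sqrt (2 * Real.pi))⁻¹ := by
        rw [mul_inv]; ring
    rw [h2, this]
    have := Real.pi_pos
    field_simp; norm_num
  have hXW : ∀ n, 1 ≤ n → X n = K * gJ 2 (2 * μ n) * W n := by
    intro n hn
    have h2 : (0 : ℝ) < n := by exact_mod_cast hn
    have hm := hμpos n
    have e1 : Real.exp (3 / 2 * μ n ^ 2) ^ 2 * Real.exp (-((2 * μ n) ^ 2 / 2))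
        = Real.exp (μ n ^ 2) := by
      rw [← Real.exp_nat_mul, ← Real.exp_add]; congr 1; push_cast; ring
    simp only [hX, hb, hW]
    rw [gw_zero _ (by positivity), gV_eq _ (by positivity), gphi_eq, ← e1, hε, ← hK]
    field_simp
  have hYW : ∀ n, 1 ≤ n → Y n = 4 * K * (gJ 1 (μ n) - Real.exp (-(4 * μ n ^ 2)) / 9 * gJ 1 (3 * μ n)) * W n := by
    intro n hn
    have h2 : (0 : ℝ) < n := by exact_mod_cast hn
    have hm := hμpos n
    have e1 : Real.exp (μ n ^ 2) = Real.exp (3 / 2 * μ n ^ 2) * Real.exp (-((μ n) ^ 2 / 2)) := by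
      rw [← Real.exp_add]; congr 1; ring
    have e2 : Real.exp (-((3 * μ n) ^ 2 / 2))
        = Real.exp (-(4 * μ n ^ 2)) * Real.exp (-((μ n) ^ 2 / 2)) := by
      rw [← Real.exp_add]; congr 1; ring
    simp only [hY, hb, hW]
    rw [gm, show μ n - 2 * μ n = -μ n by ring, show -μ n - 2 * μ n = -(3 * μ n) by ring,
      gH_eq _ hm, gH_eq _ (by positivity), gphi_eq, gphi_eq, e1, e2, hε, ← hK]
    field_simp
    ring
  have hXlim : Tendsto (fun n => X n / W n) atTop (𝓝 (K * 2)) := by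
    have h := (gJ_lim 2 (hμtop.const_mul_atTop two_pos)).const_mul K
    have h' : Tendsto (fun n => K * gJ 2 (2 * μ n)) atTop (𝓝 (K * 2)) := by
      simpa [Nat.factorial] using h
    refine h'.congr' ?_
    filter_upwards [eventually_ge_atTop 1] with n hn
    rw [hXW n hn, mul_div_cancel_right₀ _ (hWpos n hn).ne']
  have hYlim : Tendsto (fun n => Y n / W n) atTop (𝓝 (4 * K)) := by
    have h1 := gJ_lim 1 hμtop
    have h2 := gJ_lim 1 (hμtop.const_mul_atTop three_pos)
    have h3 : Tendsto (fun n => Real.exp (-(4 * μ n ^ 2))) atTop (𝓝 0) :=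
      Real.tendsto_exp_neg_atTop_nhds_zero.comp (hμ2.const_mul_atTop four_pos)
    have h4 := (h1.sub ((h3.div_const 9).mul h2)).const_mul (4 * K)
    have h' : Tendsto (fun n => 4 * K * (gJ 1 (μ n) - Real.exp (-(4 * μ n ^ 2)) / 9 * gJ 1 (3 * μ n)))
        atTop (𝓝 (4 * K)) := by
      simpa [Nat.factorial] using h4
    refine h'.congr' ?_
    filter_upwards [eventually_ge_atTop 1] with n hn
    rw [hYW n hn, mul_div_cancel_right₀ _ (hWpos n hn).ne']
  have hrisk : ∀ n θ, risk n 1 (elasticEst n (2 * μ n) ((b n)⁻¹ - 1)) θ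
      = ENNReal.ofReal (∑ i, gr (2 * μ n) (b n) (θ i)) := by
    intro n θ
    have := hμpos n
    rw [risk_eq_s14 n _ _ (by positivity)]
    simp
  have hbd : ∀ᶠ n in atTop, R n ≠ ∞ ∧
      (R n).toReal ≤ k n * μ n ^ 2 + X n - (1 - b n) * Y n ∧
      k n * μ n ^ 2 + X n - Y n ≤ (R n).toReal := by
    filter_upwards [eventually_ge_atTop 1,
      hb0.eventually (gt_mem_nhds (show (0:ℝ) < 1 / 4 by norm_num))] with n hn hb4
    have hm := hμpos n
    have hup : R n ≤ ENNReal.ofReal (k n * μ n ^ 2 + X n - (1 - b n) * Y n) := by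
      refine iSup₂_le fun θ hθ => ?_
      rw [hrisk]
      exact ENNReal.ofReal_le_ofReal
        (sum_upper n (k n) _ _ _ (by positivity) hm (hbpos n hn).le hb4.le θ hθ)
    obtain ⟨θ, hθ, hlow⟩ := sum_lower n (k n) (hk n hn).2 (2 * μ n) (b n) (μ n) (by positivity)
    have hlo : ENNReal.ofReal (∑ i, gr (2 * μ n) (b n) (θ i)) ≤ R n := by
      rw [← hrisk]
      exact le_iSup₂ (f := fun θ _ => risk n 1 (elasticEst n (2 * μ n) ((b n)⁻¹ - 1)) θ) θ hθ
    have hfin : R n ≠ ∞ := ne_top_of_le_ne_top ENNReal.ofReal_ne_top hup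
    have hsum : ∑ i, gr (2 * μ n) (b n) (θ i) ≤ k n * μ n ^ 2 + X n - (1 - b n) * Y n :=
      sum_upper n (k n) _ _ _ (by positivity) hm (hbpos n hn).le hb4.le θ hθ
    have hnn : 0 ≤ ∑ i, gr (2 * μ n) (b n) (θ i) :=
      Finset.sum_nonneg fun i _ => gr_nonneg _ _ _ (by positivity)
    refine ⟨hfin, ?_, ?_⟩
    · exact ENNReal.toReal_le_of_le_ofReal (hnn.trans hsum) hup
    · exact hlow.trans ((ENNReal.ofReal_le_iff_le_toReal hfin).1 hlo)
  refine ⟨fun n => (k n * μ n ^ 2 - (R n).toReal) / W n, ?_, ?_⟩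
  · have l1 : Tendsto (fun n => (1 - b n) * (Y n / W n) - X n / W n) atTop
        (𝓝 (Real.sqrt (2 / Real.pi))) := by
      have := ((hb0.const_sub 1).mul hYlim).sub hXlim
      rw [← hKval]
      convert this using 2
      ring
    have l2 : Tendsto (fun n => Y n / W n - X n / W n) atTop (𝓝 (Real.sqrt (2 / Real.pi))) := by
      have := hYlim.sub hXlim
      rw [← hKval]
      convert this using 2
      ring
    refine tendsto_of_tendsto_of_tendsto_of_le_of_le' l1 l2 ?_ ?_
    · filter_upwards [hbd, eventually_ge_atTop 1] with n h hn
      rw [← mul_div_assoc, ← sub_div]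
      exact div_le_div_of_nonneg_right (by linarith [h.2.1]) (hWpos n hn).le
    · filter_upwards [hbd, eventually_ge_atTop 1] with n h hn
      rw [← sub_div]
      exact div_le_div_of_nonneg_right (by linarith [h.2.2]) (hWpos n hn).le
  · filter_upwards [hbd, eventually_ge_atTop 1] with n h hn
    have e : (k n : ℝ) * μ n ^ 2 - (k n * μ n ^ 2 - (R n).toReal) / W n * ((k n : ℝ) ^ 2 / n) * μ n
        * Real.exp (μ n ^ 2) = (R n).toReal := by
      have : (k n * μ n ^ 2 - (R n).toReal) / W n * ((k n : ℝ) ^ 2 / n) * μ n * Real.exp (μ n ^ 2)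
          = (k n * μ n ^ 2 - (R n).toReal) / W n * W n := by simp only [hW]; ring
      rw [this, div_mul_cancel₀ _ (hWpos n hn).ne']; ring
    rw [e, ENNReal.ofReal_toReal h.1]
end
end

section
/- Consider the univariate Gaussian model Y = θ + Z with Z ~ N(0,1), and for ε ∈ [0,1], μ > 0 and a constant A > 1 the prior class Γ^A(ε, μ) = {π probability measure on ℝ : π({0}) ≥ 1−ε, ∫θ² dπ(θ) ≤ εμ², supp(π) ⊆ [−Aμ, Aμ]}. Let B^A(ε, μ, 1) = sup over π ∈ Γ^A(ε,μ) of the Bayes risk B(π). Suppose εₙ → 0, μₙ → ∞ and μₙ = o(√(log εₙ⁻¹)) as n → ∞. Then for any A > 1, B^A(εₙ, μₙ, 1) ≤ εₙ μₙ² − ((1+o(1))/2) εₙ² μₙ² e^{μₙ²}. -/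
open MeasureTheory ProbabilityTheory Filter
open scoped ENNReal NNReal Topology

noncomputable section

/-- Bayes risk of a prior `π` on `ℝ` in the univariate Gaussian model `Y = θ + Z`,
`Z ~ N(0,1)`, with squared error loss: the infimum over measurable estimators of the
integrated risk. -/
def bayesRiskUni (π : Measure ℝ) : ℝ≥0∞ :=
  ⨅ (est : ℝ → ℝ) (_ : Measurable est),
    ∫⁻ θ, ∫⁻ y, ENNReal.ofReal ((est y - θ) ^ 2) ∂(gaussianReal θ 1) ∂π

/-- The prior class `Γ^A(ε, μ)`: probability measures `π` on `ℝ` with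
`π({0}) ≥ 1 − ε`, `∫ θ² dπ ≤ ε μ²`, and support contained in `[−Aμ, Aμ]`. -/
def priorClass (A ε μ : ℝ) : Set (Measure ℝ) :=
  {π | IsProbabilityMeasure π ∧
       ENNReal.ofReal (1 - ε) ≤ π {0} ∧
       (∫⁻ θ, ENNReal.ofReal (θ ^ 2) ∂π) ≤ ENNReal.ofReal (ε * μ ^ 2) ∧
       π (Set.Icc (-(A * μ)) (A * μ))ᶜ = 0}

lemma aux_pow (a b : ℝ) (ha : 0 ≤ a) (hb : 0 ≤ b) (n : ℕ) :
    b ^ (n + 1) + (n + 1) * b ^ n * (a - b) ≤ a ^ (n + 1) := by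
  induction n with
  | zero => simp
  | succ k ih =>
    have h1 := mul_le_mul_of_nonneg_left ih ha
    have h2 : 0 ≤ (k + 1 : ℝ) * b ^ k * (a - b) ^ 2 := by positivity
    push_cast
    have e1 : a ^ (k + 1 + 1) = a * a ^ (k + 1) := by ring
    have e2 : a * (b ^ (k + 1) + (k + 1) * b ^ k * (a - b))
      = b ^ (k + 1 + 1) + (k + 1 + 1) * b ^ (k + 1) * (a - b)
        + (k + 1 : ℝ) * b ^ k * (a - b) ^ 2 := by ring
    linarith

lemma aux_tangent (x m : ℝ) (hm : 0 < m) :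
    m * Real.sinh m + (Real.sinh m / m + Real.cosh m) / 2 * (x ^ 2 - m ^ 2)
      ≤ x * Real.sinh x := by
  have h1 := (Real.hasSum_sinh x).mul_left x
  have h2 := (Real.hasSum_sinh m).mul_left m
  have h3 := ((((Real.hasSum_sinh m).div_const m).add (Real.hasSum_cosh m)).div_const 2).mul_right
    (x ^ 2 - m ^ 2)
  refine hasSum_le (fun n => ?_) (h2.add h3) h1
  have hp := aux_pow (x ^ 2) (m ^ 2) (by positivity) (by positivity) n
  have hf : (((2 * n + 1).factorial : ℕ) : ℝ) = (2 * n + 1) * ((2 * n).factorial : ℝ) := by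
    rw [Nat.factorial_succ]; push_cast; ring
  have hf0 : (0 : ℝ) < ((2 * n).factorial : ℝ) := by exact_mod_cast Nat.factorial_pos _
  have hn : (0 : ℝ) < 2 * n + 1 := by positivity
  rw [hf]
  have e1 : x * (x ^ (2 * n + 1) / ((2 * n + 1) * ((2 * n).factorial : ℝ)))
      = (x ^ 2) ^ (n + 1) / ((2 * n + 1) * ((2 * n).factorial : ℝ)) := by
    rw [← pow_mul]; ring
  have e2 : m * (m ^ (2 * n + 1) / ((2 * n + 1) * ((2 * n).factorial : ℝ)))
      + (m ^ (2 * n + 1) / ((2 * n + 1) * ((2 * n).factorial : ℝ)) / m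
        + m ^ (2 * n) / ((2 * n).factorial : ℝ)) / 2 * (x ^ 2 - m ^ 2)
      = ((m ^ 2) ^ (n + 1) + (n + 1) * (m ^ 2) ^ n * (x ^ 2 - m ^ 2))
        / ((2 * n + 1) * ((2 * n).factorial : ℝ)) := by
    rw [← pow_mul, ← pow_mul]
    field_simp
    ring
  rw [e1, e2]
  gcongr

lemma aux_int (θ t : ℝ) :
    ∫ y, Real.exp (t * y) ∂(gaussianReal θ 1) = Real.exp (θ * t + t ^ 2 / 2) := by
  have := mgf_gaussianReal (μ := θ) (v := 1) (p := gaussianReal θ 1) (X := id) (by simp) t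
  simpa [mgf] using this

lemma aux_risk_s16 (α μ θ : ℝ) :
    ∫⁻ y, ENNReal.ofReal ((α * (Real.exp (μ * y) - Real.exp (-μ * y)) - θ) ^ 2)
        ∂(gaussianReal θ 1)
      = ENNReal.ofReal (α ^ 2 * (Real.exp (2 * μ * θ + 2 * μ ^ 2)
          + Real.exp (-2 * μ * θ + 2 * μ ^ 2) - 2)
        - 2 * θ * α * (Real.exp (μ * θ + μ ^ 2 / 2) - Real.exp (-μ * θ + μ ^ 2 / 2))
        + θ ^ 2) := by
  have hi (t : ℝ) : Integrable (fun y => Real.exp (t * y)) (gaussianReal θ 1) :=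
    integrable_exp_mul_gaussianReal t
  have hfun : (fun y : ℝ => (α * (Real.exp (μ * y) - Real.exp (-μ * y)) - θ) ^ 2)
      = fun y => α ^ 2 * (Real.exp ((2 * μ) * y) + Real.exp ((-2 * μ) * y) - 2)
        - 2 * θ * α * (Real.exp (μ * y) - Real.exp (-μ * y)) + θ ^ 2 := by
    funext y
    have h1 : Real.exp ((2 * μ) * y) = Real.exp (μ * y) ^ 2 := by
      rw [← Real.exp_nat_mul]; congr 1; push_cast; ring
    have h2 : Real.exp ((-2 * μ) * y) = Real.exp (-μ * y) ^ 2 := by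
      rw [← Real.exp_nat_mul]; congr 1; push_cast; ring
    have h3 : Real.exp (μ * y) * Real.exp (-μ * y) = 1 := by
      rw [← Real.exp_add]; simp
    rw [h1, h2]
    linear_combination (-2 * α ^ 2) * h3
  have i1 : Integrable (fun y => α ^ 2 * (Real.exp ((2 * μ) * y) + Real.exp ((-2 * μ) * y) - 2))
      (gaussianReal θ 1) := (((hi _).add (hi _)).sub (integrable_const _)).const_mul _
  have i2 : Integrable (fun y => 2 * θ * α * (Real.exp (μ * y) - Real.exp (-μ * y)))
      (gaussianReal θ 1) := ((hi _).sub (hi _)).const_mul _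
  have hint : Integrable (fun y : ℝ => (α * (Real.exp (μ * y) - Real.exp (-μ * y)) - θ) ^ 2)
      (gaussianReal θ 1) := by
    rw [hfun]; exact (i1.sub i2).add (integrable_const _)
  rw [← ofReal_integral_eq_lintegral_ofReal hint (Eventually.of_forall fun y => sq_nonneg _)]
  congr 1
  rw [hfun, integral_add (f := fun y => α ^ 2 * (Real.exp ((2 * μ) * y)
        + Real.exp ((-2 * μ) * y) - 2) - 2 * θ * α * (Real.exp (μ * y) - Real.exp (-μ * y)))
      (i1.sub i2) (integrable_const _), integral_sub i1 i2, integral_const_mul, integral_const_mul,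
    integral_sub (hi _) (hi _),
    integral_sub (f := fun y => Real.exp ((2 * μ) * y) + Real.exp ((-2 * μ) * y))
      ((hi _).add (hi _)) (integrable_const _), integral_add (hi _) (hi _)]
  simp only [aux_int, integral_const, probReal_univ, smul_eq_mul, one_mul]
  congr 3 <;> congr 1 <;> congr 1 <;> congr 1 <;> ring

lemma aux_trivial (A ε μ : ℝ) (π : Measure ℝ) (h : π ∈ priorClass A ε μ) :
    bayesRiskUni π ≤ ENNReal.ofReal (ε * μ ^ 2) := by
  refine le_trans ?_ h.2.2.1
  refine (iInf₂_le (fun _ => (0 : ℝ)) measurable_const).trans ?_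
  simp

lemma aux_point (A ε μ θ : ℝ) (hA : 1 < A) (hε : 0 ≤ ε) (hμ : 0 < μ)
    (hθ : |θ| ≤ A * μ) :
    (ε * μ * Real.exp (-(μ ^ 2 / 2)) / 2) ^ 2 * (Real.exp (2 * μ * θ + 2 * μ ^ 2)
          + Real.exp (-2 * μ * θ + 2 * μ ^ 2) - 2)
        - 2 * θ * (ε * μ * Real.exp (-(μ ^ 2 / 2)) / 2)
          * (Real.exp (μ * θ + μ ^ 2 / 2) - Real.exp (-μ * θ + μ ^ 2 / 2))
        + θ ^ 2
    ≤ (1 - ε * (Real.sinh (μ ^ 2) + μ ^ 2 * Real.cosh (μ ^ 2))) * θ ^ 2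
      + (ε * μ ^ 2 * (μ ^ 2 * Real.cosh (μ ^ 2) - Real.sinh (μ ^ 2))
        + ε ^ 2 * μ ^ 2 * Real.exp (μ ^ 2) * Real.exp (2 * A * μ ^ 2) / 2) := by
  have hm : 0 < μ ^ 2 := by positivity
  have ht := aux_tangent (μ * θ) (μ ^ 2) hm
  have hs : 2 * θ * (ε * μ * Real.exp (-(μ ^ 2 / 2)) / 2)
          * (Real.exp (μ * θ + μ ^ 2 / 2) - Real.exp (-μ * θ + μ ^ 2 / 2))
      = 2 * ε * (μ * θ * Real.sinh (μ * θ)) := by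
    have h1 : Real.exp (-(μ ^ 2 / 2)) * Real.exp (μ ^ 2 / 2) = 1 := by
      rw [← Real.exp_add]; simp
    rw [Real.exp_add, Real.exp_add, Real.sinh_eq, neg_mul]
    linear_combination (ε * μ * θ * (Real.exp (μ * θ) - Real.exp (-(μ * θ)))) * h1
  have hq : (ε * μ * Real.exp (-(μ ^ 2 / 2)) / 2) ^ 2 * (Real.exp (2 * μ * θ + 2 * μ ^ 2)
          + Real.exp (-2 * μ * θ + 2 * μ ^ 2) - 2)
      ≤ ε ^ 2 * μ ^ 2 * Real.exp (μ ^ 2) * Real.exp (2 * A * μ ^ 2) / 2 := by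
    obtain ⟨hθ1, hθ2⟩ := abs_le.mp hθ
    have b1 : Real.exp (2 * μ * θ + 2 * μ ^ 2) ≤ Real.exp (2 * A * μ ^ 2 + 2 * μ ^ 2) := by
      apply Real.exp_le_exp.mpr; nlinarith
    have b2 : Real.exp (-2 * μ * θ + 2 * μ ^ 2) ≤ Real.exp (2 * A * μ ^ 2 + 2 * μ ^ 2) := by
      apply Real.exp_le_exp.mpr; nlinarith
    have b3 : Real.exp (2 * μ * θ + 2 * μ ^ 2)
          + Real.exp (-2 * μ * θ + 2 * μ ^ 2) - 2 ≤ 2 * Real.exp (2 * A * μ ^ 2 + 2 * μ ^ 2) := by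
      linarith
    refine (mul_le_mul_of_nonneg_left b3 (sq_nonneg _)).trans (le_of_eq ?_)
    have h1 : Real.exp (-(μ ^ 2 / 2)) ^ 2 * Real.exp (2 * μ ^ 2) = Real.exp (μ ^ 2) := by
      rw [← Real.exp_nat_mul, ← Real.exp_add]; congr 1; push_cast; ring
    rw [Real.exp_add, ← h1]; ring
  have ht2 : 2 * ε * (μ * θ * Real.sinh (μ * θ)) ≥
      2 * ε * (μ ^ 2 * Real.sinh (μ ^ 2) + (Real.sinh (μ ^ 2) / μ ^ 2 + Real.cosh (μ ^ 2)) / 2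
        * ((μ * θ) ^ 2 - (μ ^ 2) ^ 2)) := by gcongr
  have ht3 : 2 * ε * (μ ^ 2 * Real.sinh (μ ^ 2)
      + (Real.sinh (μ ^ 2) / μ ^ 2 + Real.cosh (μ ^ 2)) / 2
        * ((μ * θ) ^ 2 - (μ ^ 2) ^ 2)) =
      ε * (Real.sinh (μ ^ 2) + μ ^ 2 * Real.cosh (μ ^ 2)) * θ ^ 2
      - ε * μ ^ 2 * (μ ^ 2 * Real.cosh (μ ^ 2) - Real.sinh (μ ^ 2)) := by
    field_simp
    ring
  rw [hs]
  linarith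

lemma aux_main (A ε μ : ℝ) (hA : 1 < A) (hε : 0 ≤ ε) (hε1 : ε ≤ 1) (hμ : 0 < μ)
    (hg : ε * Real.exp (2 * A * μ ^ 2) ≤ 1)
    (π : Measure ℝ) (h : π ∈ priorClass A ε μ) :
    bayesRiskUni π ≤ ENNReal.ofReal (ε * μ ^ 2 -
      (1 - Real.exp (-2 * μ ^ 2) - ε * Real.exp (2 * A * μ ^ 2)) / 2
        * ε ^ 2 * μ ^ 2 * Real.exp (μ ^ 2)) := by
  obtain ⟨hπ, h0, h2, hsupp⟩ := h
  set a := ε ^ 2 * μ ^ 2 * Real.sinh (μ ^ 2) with ha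
  set b := 1 - ε * (Real.sinh (μ ^ 2) + μ ^ 2 * Real.cosh (μ ^ 2)) with hb
  set c := ε * μ ^ 2 * (μ ^ 2 * Real.cosh (μ ^ 2) - Real.sinh (μ ^ 2))
        + ε ^ 2 * μ ^ 2 * Real.exp (μ ^ 2) * Real.exp (2 * A * μ ^ 2) / 2 with hc
  have hm : 0 < μ ^ 2 := by positivity
  have hsh : 0 < Real.sinh (μ ^ 2) := Real.sinh_pos_iff.mpr hm
  have ha0 : 0 ≤ a := by positivity
  have hb0 : 0 ≤ b := by
    have e1 : Real.sinh (μ ^ 2) ≤ Real.exp (μ ^ 2) := by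
      rw [Real.sinh_eq]; linarith [Real.exp_pos (μ ^ 2), Real.exp_pos (-μ ^ 2)]
    have e2 : Real.cosh (μ ^ 2) ≤ Real.exp (μ ^ 2) := by
      rw [Real.cosh_eq]
      have : Real.exp (-μ ^ 2) ≤ Real.exp (μ ^ 2) := Real.exp_le_exp.mpr (by linarith)
      linarith
    have e3 : Real.sinh (μ ^ 2) + μ ^ 2 * Real.cosh (μ ^ 2) ≤ Real.exp (2 * A * μ ^ 2) := by
      calc _ ≤ Real.exp (μ ^ 2) + μ ^ 2 * Real.exp (μ ^ 2) := by gcongr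
        _ = (μ ^ 2 + 1) * Real.exp (μ ^ 2) := by ring
        _ ≤ Real.exp (μ ^ 2) * Real.exp (μ ^ 2) := by
          gcongr; exact Real.add_one_le_exp _
        _ = Real.exp (μ ^ 2 + μ ^ 2) := by rw [Real.exp_add]
        _ ≤ _ := Real.exp_le_exp.mpr (by nlinarith)
    have := mul_le_mul_of_nonneg_left e3 hε
    rw [hb]; linarith
  have hc0 : 0 ≤ c := by
    have ht := aux_tangent 0 (μ ^ 2) hm
    have e : μ ^ 2 * Real.sinh (μ ^ 2) + (Real.sinh (μ ^ 2) / μ ^ 2 + Real.cosh (μ ^ 2)) / 2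
        * (0 ^ 2 - (μ ^ 2) ^ 2)
        = - (μ ^ 2 * (μ ^ 2 * Real.cosh (μ ^ 2) - Real.sinh (μ ^ 2)) / 2) := by
      field_simp; ring
    rw [e] at ht
    have h3 : 0 ≤ μ ^ 2 * (μ ^ 2 * Real.cosh (μ ^ 2) - Real.sinh (μ ^ 2)) := by linarith
    have h4 : 0 ≤ ε * (μ ^ 2 * (μ ^ 2 * Real.cosh (μ ^ 2) - Real.sinh (μ ^ 2))) :=
      mul_nonneg hε h3
    have h5 : 0 ≤ ε ^ 2 * μ ^ 2 * Real.exp (μ ^ 2) * Real.exp (2 * A * μ ^ 2) / 2 := by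
      positivity
    rw [hc]; linarith
  have hmeas0 : π {0}ᶜ ≤ ENNReal.ofReal ε := by
    rw [prob_compl_eq_one_sub (measurableSet_singleton _), tsub_le_iff_right]
    calc (1 : ℝ≥0∞) = ENNReal.ofReal (ε + (1 - ε)) := by simp
      _ = ENNReal.ofReal ε + ENNReal.ofReal (1 - ε) :=
        ENNReal.ofReal_add hε (by linarith)
      _ ≤ _ := by gcongr
  set α := ε * μ * Real.exp (-(μ ^ 2 / 2)) / 2 with hα
  refine (iInf₂_le (fun y => α * (Real.exp (μ * y) - Real.exp (-μ * y)))
    (by fun_prop)).trans ?_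
  have hae : ∀ᵐ θ ∂π, θ ∈ Set.Icc (-(A * μ)) (A * μ) := by
    rw [ae_iff]; exact hsupp
  have hbd : ∀ᵐ θ ∂π, ∫⁻ y, ENNReal.ofReal ((α * (Real.exp (μ * y) - Real.exp (-μ * y)) - θ) ^ 2)
        ∂(gaussianReal θ 1) ≤ ENNReal.ofReal a + (ENNReal.ofReal b * ENNReal.ofReal (θ ^ 2)
          + Set.indicator {0}ᶜ (fun _ => ENNReal.ofReal c) θ) := by
    filter_upwards [hae] with θ hθ
    rw [aux_risk_s16]
    by_cases hz : θ = 0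
    · subst hz
      refine le_trans (le_of_eq ?_) le_self_add
      congr 1
      have h1 : Real.exp (-(μ ^ 2 / 2)) ^ 2 * Real.exp (2 * μ ^ 2) = Real.exp (μ ^ 2) := by
        rw [← Real.exp_nat_mul, ← Real.exp_add]; congr 1; push_cast; ring
      have h2 : Real.exp (-(μ ^ 2 / 2)) ^ 2 = Real.exp (-μ ^ 2) := by
        rw [← Real.exp_nat_mul]; congr 1; push_cast; ring
      simp only [mul_zero, zero_add, zero_mul]
      rw [ha, hα, Real.sinh_eq, ← h1, ← h2]
      ring
    · rw [Set.indicator_of_mem (by simpa using hz), ← ENNReal.ofReal_mul hb0,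
        ← ENNReal.ofReal_add (by positivity) hc0]
      refine le_trans (ENNReal.ofReal_le_ofReal ?_) le_add_self
      exact aux_point A ε μ θ hA hε hμ (abs_le.mpr hθ)
  refine (lintegral_mono_ae hbd).trans ?_
  rw [lintegral_add_left measurable_const, lintegral_add_left (by fun_prop),
    lintegral_const_mul _ (by fun_prop), lintegral_indicator (by measurability),
    lintegral_const, setLIntegral_const, measure_univ, mul_one]
  calc _ ≤ ENNReal.ofReal a + (ENNReal.ofReal b * ENNReal.ofReal (ε * μ ^ 2)
        + ENNReal.ofReal c * ENNReal.ofReal ε) := by gcongr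
    _ = ENNReal.ofReal (a + (b * (ε * μ ^ 2) + c * ε)) := by
      rw [← ENNReal.ofReal_mul hb0, ← ENNReal.ofReal_mul hc0,
        ← ENNReal.ofReal_add (by positivity) (by positivity),
        ← ENNReal.ofReal_add ha0 (by positivity)]
    _ = _ := by
      congr 1
      have h1 : Real.exp (-2 * μ ^ 2) * Real.exp (μ ^ 2) = Real.exp (-μ ^ 2) := by
        rw [← Real.exp_add]; congr 1; ring
      have h2 : Real.exp (μ ^ 2) - Real.exp (-μ ^ 2) = 2 * Real.sinh (μ ^ 2) := by
        rw [Real.sinh_eq]; ring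
      rw [ha, hb, hc]
      linear_combination (-ε ^ 2 * μ ^ 2 / 2) * h1 + (ε ^ 2 * μ ^ 2 / 2) * h2

/-- Lemma `lem::univariate-Bayes`: for any `A > 1`, in the regime
`εₙ → 0`, `μₙ → ∞`, `μₙ = o(√(log εₙ⁻¹))`,
`B^A(εₙ, μₙ, 1) ≤ εₙ μₙ² − ((1+o(1))/2) εₙ² μₙ² e^{μₙ²}`. -/
theorem statement16
    (A : ℝ) (hA : 1 < A) (ε μ : ℕ → ℝ)
    (hεmem : ∀ n, ε n ∈ Set.Icc (0 : ℝ) 1) (hμpos : ∀ n, 0 < μ n)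
    (hε0 : Tendsto ε atTop (𝓝 0)) (hμtop : Tendsto μ atTop atTop)
    (hμo : Tendsto (fun n => μ n / Real.sqrt (Real.log (ε n)⁻¹)) atTop (𝓝 0)) :
    ∃ c : ℕ → ℝ, Tendsto c atTop (𝓝 1) ∧
      ∀ n : ℕ,
        (⨆ π ∈ priorClass A (ε n) (μ n), bayesRiskUni π) ≤
          ENNReal.ofReal (ε n * μ n ^ 2 -
            c n / 2 * ε n ^ 2 * μ n ^ 2 * Real.exp (μ n ^ 2)) := by
  classical
  have hev : ∀ᶠ n in atTop, ε n * Real.exp (2 * A * μ n ^ 2) ≤ Real.sqrt (ε n) := by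
    have hsq : Tendsto (fun n => (μ n / Real.sqrt (Real.log (ε n)⁻¹)) ^ 2) atTop (𝓝 0) := by
      simpa using hμo.pow 2
    have hA4 : (0 : ℝ) < 1 / (4 * A) := by positivity
    filter_upwards [hsq.eventually_lt_const hA4, hε0.eventually_lt_const one_pos] with n h1 h2
    rcases (hεmem n).1.eq_or_lt with h0 | h0
    · rw [← h0]; simp
    · have hL : 0 < Real.log (ε n)⁻¹ := Real.log_pos ((one_lt_inv₀ h0).mpr h2)
      rw [div_pow, Real.sq_sqrt hL.le, div_lt_div_iff₀ hL (by positivity)] at h1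
      have he : ε n = Real.exp (-Real.log (ε n)⁻¹) := by
        rw [Real.log_inv, neg_neg, Real.exp_log h0]
      apply Real.le_sqrt_of_sq_le
      have hle : Real.exp (2 * A * μ n ^ 2) ^ 2 ≤ (ε n)⁻¹ := by
        rw [← Real.exp_nat_mul, ← Real.exp_log (inv_pos.mpr h0)]
        apply Real.exp_le_exp.mpr
        push_cast
        linarith
      calc (ε n * Real.exp (2 * A * μ n ^ 2)) ^ 2
          = ε n ^ 2 * Real.exp (2 * A * μ n ^ 2) ^ 2 := by ring
        _ ≤ ε n ^ 2 * (ε n)⁻¹ := by gcongr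
        _ = ε n := by field_simp
  have hsqrt : Tendsto (fun n => Real.sqrt (ε n)) atTop (𝓝 0) := by
    simpa using hε0.sqrt
  have hg : Tendsto (fun n => ε n * Real.exp (2 * A * μ n ^ 2)) atTop (𝓝 0) :=
    squeeze_zero' (Eventually.of_forall fun n => mul_nonneg (hεmem n).1 (Real.exp_pos _).le)
      hev hsqrt
  have hexp : Tendsto (fun n => Real.exp (-2 * μ n ^ 2)) atTop (𝓝 0) := by
    apply Real.tendsto_exp_atBot.comp
    exact ((tendsto_pow_atTop two_ne_zero).comp hμtop).const_mul_atTop_of_neg (by norm_num)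
  refine ⟨fun n => if ε n * Real.exp (2 * A * μ n ^ 2) ≤ 1 then
    1 - Real.exp (-2 * μ n ^ 2) - ε n * Real.exp (2 * A * μ n ^ 2) else 0, ?_, fun n => ?_⟩
  · have hlim : Tendsto (fun n => 1 - Real.exp (-2 * μ n ^ 2) - ε n * Real.exp (2 * A * μ n ^ 2))
        atTop (𝓝 1) := by
      simpa using (tendsto_const_nhds (x := (1 : ℝ))).sub hexp |>.sub hg
    refine hlim.congr' ?_
    filter_upwards [hg.eventually_le_const one_pos] with n hn
    rw [if_pos hn]
  · refine iSup₂_le fun π hπ => ?_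
    dsimp only
    split_ifs with h
    · exact aux_main A (ε n) (μ n) hA (hεmem n).1 (hεmem n).2 (hμpos n) h π hπ
    · simpa using aux_trivial A (ε n) (μ n) π hπ
end
end
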